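/- arXiv:2404.07441 — 7 statements merged into one kernel-verified Lean document; each statement's English description precedes it below -/
import Mathlib

section
/- Let q be a power of 2. For every sufficiently small constant c > 0 the following holds for all sufficiently large ℓ such that k := q^{2(1+c)ℓ} is an integer; set β = q^{−2(1+2c/3)ℓ} and η = q^{−100ℓ^{100}}. With the distributions 𝒟 and 𝒟' on (F_q^{3k})^{2ℓ} defined in the context, there exists a set E ⊆ (F_q^{3k})^{2ℓ} such that 𝒟(E) ≤ η^{40} and 𝒟'(E) ≤ η^{40}, and for every tuple (x₁, …, x_{2ℓ}) ∉ E one has 0.9 ≤ 𝒟(x₁, …, x_{2ℓ}) / 𝒟'(x₁, …, x_{2ℓ}) ≤ 1.1. -/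
open Module Finset

/-- The span `H` of the `0/1` indicator vectors of the `k` blocks `{i} × Fin 3` of the
coordinate set `Fin k × Fin 3`. -/
noncomputable def blockSpan (F : Type) [Field F] (k : ℕ) :
    Submodule F ((Fin k × Fin 3) → F) :=
  Submodule.span F
    (Set.range fun i : Fin k => fun p : Fin k × Fin 3 => if p.1 = i then (1 : F) else 0)

/-- Given a choice `v i` for each block (`none` = keep the whole block, `some j` = keep only
coordinate `j`), the set `F_q^V` of vectors supported on the kept coordinates `V`. -/
def suppSet (F : Type) [Field F] (k : ℕ) (v : Fin k → Option (Fin 3)) :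
    Set ((Fin k × Fin 3) → F) :=
  {y | ∀ (i : Fin k) (j j₀ : Fin 3), v i = some j₀ → j ≠ j₀ → y (i, j) = 0}

/-- Given the choice `v` of kept coordinates, the probability that `x' + w = y` when `x'` is
uniform in `F_q^V` and `w` is uniform in `H`. -/
noncomputable def condMass (F : Type) [Field F] [Fintype F] (k : ℕ)
    (v : Fin k → Option (Fin 3)) (y : (Fin k × Fin 3) → F) : ℝ :=
  (Nat.card {z : ((Fin k × Fin 3) → F) × ((Fin k × Fin 3) → F) //
      z.1 ∈ suppSet F k v ∧ z.2 ∈ blockSpan F k ∧ z.1 + z.2 = y} : ℝ) /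
    ((Nat.card ↥(suppSet F k v) : ℝ) * (Nat.card ↥(blockSpan F k) : ℝ))

/-- The probability of the choice `v` of kept coordinates: independently each block is fully
kept with probability `1 - β`, and each of its three singletons is kept with probability
`β/3`. -/
noncomputable def weightV (k : ℕ) (β : ℝ) (v : Fin k → Option (Fin 3)) : ℝ :=
  ∏ i : Fin k, (if v i = none then 1 - β else β / 3)

/-- The mass function of the uniform distribution `𝒟` on `(F_q^{3k})^{2ℓ}`. -/
noncomputable def Dmass (F : Type) [Field F] [Fintype F] (k ℓ₂ : ℕ)
    (_ : Fin ℓ₂ → (Fin k × Fin 3) → F) : ℝ :=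
  ((Fintype.card F : ℝ) ^ (3 * k * ℓ₂))⁻¹

/-- The mass function of the distribution `𝒟'` on `(F_q^{3k})^{2ℓ}`: choose kept coordinates
`V` block-wise, sample `x'₁, …` uniformly in `F_q^V` and `w₁, …` uniformly in `H`, and
output `(x'₁ + w₁, …)`. -/
noncomputable def D'mass (F : Type) [Field F] [Fintype F] (k ℓ₂ : ℕ) (β : ℝ)
    (x : Fin ℓ₂ → (Fin k × Fin 3) → F) : ℝ :=
  ∑ v : Fin k → Option (Fin 3), weightV k β v * ∏ j : Fin ℓ₂, condMass F k v (x j)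

/-- The total mass a mass function `μ` assigns to a set `E`. -/
noncomputable def massOf {α : Type*} [Fintype α] (μ : α → ℝ) (E : Set α) : ℝ :=
  ∑ x : α, E.indicator μ x

/-- Expanding a sum over functions of a product of coordinatewise factors. -/
lemma sum_prod_eq_pow {R : Type*} [Fintype R] (k : ℕ) (g : R → ℝ) :
    ∑ f : Fin k → R, ∏ i, g (f i) = (∑ r, g r) ^ k := by
  classical
  have h := Finset.prod_univ_sum (fun _ : Fin k => (Finset.univ : Finset R)) (fun _ r => g r)
  rw [Fintype.piFinset_univ] at h
  rw [← h]
  simp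

/-- A second-order pointwise bound on `g` bounds the normalized `k`-fold product moment. -/
lemma sum_prod_le_exp {R : Type*} [Fintype R] [Nonempty R] (k : ℕ) (X g : R → ℝ)
    {a C V B : ℝ} (hg : ∀ r, 0 ≤ g r) (hX : ∑ r, X r = 0)
    (hV : ∑ r, X r ^ 2 ≤ Fintype.card R * V) (hC : 0 ≤ C)
    (hgX : ∀ r, g r ≤ 1 + a * X r + C * X r ^ 2) (hB : k * (C * V) ≤ B) :
    ∑ f : Fin k → R, ∏ i, g (f i) ≤ (Fintype.card R : ℝ) ^ k * Real.exp B := by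
  rw [sum_prod_eq_pow]
  have h1 : ∑ r, g r ≤ (Fintype.card R : ℝ) * Real.exp (C * V) := by
    calc ∑ r, g r ≤ ∑ r, (1 + a * X r + C * X r ^ 2) := Finset.sum_le_sum fun r _ => hgX r
      _ = Fintype.card R + C * ∑ r, X r ^ 2 := by
          simp [Finset.sum_add_distrib, ← Finset.mul_sum, hX]
      _ ≤ Fintype.card R * (C * V + 1) := by nlinarith
      _ ≤ _ := by gcongr; exact Real.add_one_le_exp _
  calc (∑ r, g r) ^ k ≤ ((Fintype.card R : ℝ) * Real.exp (C * V)) ^ k :=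
        pow_le_pow_left₀ (Finset.sum_nonneg fun r _ => hg r) h1 k
    _ = (Fintype.card R : ℝ) ^ k * Real.exp (k * (C * V)) := by
        rw [mul_pow, ← Real.exp_nat_mul]
    _ ≤ _ := by gcongr

lemma exp_le_one_add_add_sq {y : ℝ} (hy : |y| ≤ 1) : Real.exp y ≤ 1 + y + y ^ 2 := by
  have := (abs_le.1 (Real.abs_exp_sub_one_sub_id_le hy)).2
  linarith

/-- Concentration of a product of independent, centred, bounded perturbations of `1`, with
respect to both the original and the tilted distribution. -/
lemma sum_tail_prod_le {R : Type*} [Fintype R] [Nonempty R] (k : ℕ) (X : R → ℝ)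
    {d s V : ℝ} (hX : ∑ r, X r = 0) (hV : ∑ r, X r ^ 2 ≤ Fintype.card R * V)
    (hd : ∀ r, |X r| ≤ d) (hs : 1 ≤ s) (hsd : (s + 1) * d ≤ 1 / 3) (hk : k * (s ^ 2 * V) ≤ 1)
    (A : Set (Fin k → R))
    (hA : ∀ f ∈ A, 10 / 9 ≤ ∏ i, (1 + X (f i)) ∨ ∏ i, (1 + X (f i)) ≤ 10 / 11) :
    ∑ f, A.indicator (fun f => 1 + ∏ i, (1 + X (f i))) f ≤
      (Fintype.card R : ℝ) ^ k * (4 * Real.exp 6 * Real.exp (-s * Real.log 1.1)) := by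
  have hd0 : 0 ≤ d := (abs_nonneg _).trans (hd (Classical.arbitrary R))
  have hd1 : d ≤ 1 / 6 := by nlinarith
  have hmax : ∀ r, -(1 / 6) ≤ X r ∧ X r ≤ 1 / 6 := fun r => abs_le.1 ((hd r).trans hd1)
  have hV0 : 0 ≤ V := by
    have h0 : 0 ≤ ∑ r, X r ^ 2 := Finset.sum_nonneg fun r _ => sq_nonneg _
    have h1 : (0 : ℝ) < Fintype.card R := by exact_mod_cast Fintype.card_pos
    by_contra! h
    nlinarith
  have hup : ∀ t : ℝ, 0 ≤ t → t ≤ s + 1 →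
      ∑ f : Fin k → R, ∏ i, Real.exp (t * X (f i)) ≤
        (Fintype.card R : ℝ) ^ k * Real.exp 6 := by
    intro t ht hts
    refine sum_prod_le_exp k X (fun r => Real.exp (t * X r)) (a := t) (C := 6 * s ^ 2)
      (fun r => (Real.exp_pos _).le) hX hV (by positivity) (fun r => ?_) (by nlinarith)
    have h1 : |t * X r| ≤ 1 := by
      rw [abs_mul, abs_of_nonneg ht]
      nlinarith [hd r, abs_nonneg (X r)]
    have h2 : t ^ 2 ≤ 6 * s ^ 2 := by nlinarith
    have h3 := exp_le_one_add_add_sq h1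
    nlinarith [mul_le_mul_of_nonneg_right h2 (sq_nonneg (X r))]
  have hlow : ∑ f : Fin k → R, ∏ i, Real.exp (s * (-X (f i) + 2 * X (f i) ^ 2)) ≤
        (Fintype.card R : ℝ) ^ k * Real.exp 6 := by
    refine sum_prod_le_exp k X (fun r => Real.exp (s * (-X r + 2 * X r ^ 2))) (a := -s)
      (C := 6 * s ^ 2)
      (fun r => (Real.exp_pos _).le) hX hV (by positivity) (fun r => ?_) (by nlinarith)
    have h0 : |-X r + 2 * X r ^ 2| ≤ 2 * |X r| := by
      have : -X r + 2 * X r ^ 2 = X r * (2 * X r - 1) := by ring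
      rw [this, abs_mul, mul_comm]
      gcongr
      rw [abs_le]
      constructor <;> linarith [hmax r]
    have h1 : |s * (-X r + 2 * X r ^ 2)| ≤ 1 := by
      rw [abs_mul, abs_of_nonneg (by linarith)]
      nlinarith [hd r, abs_nonneg (X r)]
    have h3 := exp_le_one_add_add_sq h1
    have h4 : (-X r + 2 * X r ^ 2) ^ 2 ≤ 4 * X r ^ 2 := by
      have := pow_le_pow_left₀ (abs_nonneg _) h0 2
      rw [sq_abs, mul_pow, sq_abs] at this
      linarith
    have h5 : s * X r ^ 2 ≤ s ^ 2 * X r ^ 2 := by gcongr; nlinarith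
    have h6 : s ^ 2 * (-X r + 2 * X r ^ 2) ^ 2 ≤ s ^ 2 * (4 * X r ^ 2) := by gcongr
    nlinarith
  have hexp : Real.exp (-s * Real.log 1.1) = Real.exp (-Real.log 1.1) ^ s := by
    rw [← Real.exp_mul]; ring_nf
  have hpt : ∀ f, A.indicator (fun f => 1 + ∏ i, (1 + X (f i))) f ≤
      Real.exp (-s * Real.log 1.1) *
        (∏ i, Real.exp (s * X (f i)) + ∏ i, Real.exp ((s + 1) * X (f i)) +
          2 * ∏ i, Real.exp (s * (-X (f i) + 2 * X (f i) ^ 2))) := by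
    intro f
    by_cases hf : f ∈ A
    swap
    · rw [Set.indicator_of_notMem hf]
      positivity
    rw [Set.indicator_of_mem hf]
    have hpos : ∀ i, 0 < 1 + X (f i) := fun i => by linarith [hmax (f i)]
    have hT : 0 < ∏ i, (1 + X (f i)) := Finset.prod_pos fun i _ => hpos i
    set T := ∏ i, (1 + X (f i)) with hTdef
    simp_rw [← Real.exp_sum, ← Finset.mul_sum]
    set Z := ∑ i, X (f i) with hZ
    set W := ∑ i, (-X (f i) + 2 * X (f i) ^ 2) with hW
    have hTZ : T ≤ Real.exp Z := by
      rw [hZ, Real.exp_sum]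
      refine Finset.prod_le_prod (fun i _ => (hpos i).le) fun i _ => ?_
      linarith [Real.add_one_le_exp (X (f i))]
    have hTW : T⁻¹ ≤ Real.exp W := by
      rw [hW, Real.exp_sum, hTdef, ← Finset.prod_inv_distrib]
      refine Finset.prod_le_prod (fun i _ => (inv_pos.2 (hpos i)).le) fun i _ => ?_
      refine le_trans ?_ (Real.add_one_le_exp _)
      rw [inv_le_iff_one_le_mul₀ (hpos i)]
      nlinarith [mul_nonneg (sq_nonneg (X (f i)))
        (by linarith [hmax (f i)] : (0 : ℝ) ≤ 1 + 2 * X (f i))]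
    have hsplit : Real.exp ((s + 1) * Z) = Real.exp (s * Z) * Real.exp Z := by
      rw [← Real.exp_add]; ring_nf
    have hll : Real.exp (Real.log 1.1) = 1.1 := Real.exp_log (by norm_num)
    rcases hA f hf with h | h
    · have h1 : Real.log 1.1 ≤ Z := by
        rw [← Real.exp_le_exp, hll]
        refine le_trans ?_ hTZ
        exact le_trans (by norm_num) h
      have h2 : 1 ≤ Real.exp (-s * Real.log 1.1) * Real.exp (s * Z) := by
        rw [← Real.exp_add]
        exact Real.one_le_exp (by nlinarith)
      have h3 : 0 ≤ Real.exp (-s * Real.log 1.1) * (2 * Real.exp (s * W)) := by positivity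
      rw [hsplit]
      have h4 : 1 * T ≤ Real.exp (-s * Real.log 1.1) * Real.exp (s * Z) * Real.exp Z :=
        mul_le_mul h2 hTZ hT.le (by positivity)
      nlinarith
    · have h1 : Real.log 1.1 ≤ W := by
        rw [← Real.exp_le_exp, hll]
        refine le_trans ?_ hTW
        rw [le_inv_comm₀ (by norm_num) hT]
        exact h.trans (by norm_num)
      have h2 : 1 ≤ Real.exp (-s * Real.log 1.1) * Real.exp (s * W) := by
        rw [← Real.exp_add]
        exact Real.one_le_exp (by nlinarith)
      have h3 : 0 ≤ Real.exp (-s * Real.log 1.1) *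
        (Real.exp (s * Z) + Real.exp ((s + 1) * Z)) := by positivity
      nlinarith
  calc _ ≤ ∑ f : Fin k → R, Real.exp (-s * Real.log 1.1) *
        (∏ i, Real.exp (s * X (f i)) + ∏ i, Real.exp ((s + 1) * X (f i)) +
          2 * ∏ i, Real.exp (s * (-X (f i) + 2 * X (f i) ^ 2))) :=
        Finset.sum_le_sum fun f _ => hpt f
    _ = Real.exp (-s * Real.log 1.1) * (∑ f : Fin k → R, ∏ i, Real.exp (s * X (f i)) +
          ∑ f : Fin k → R, ∏ i, Real.exp ((s + 1) * X (f i)) +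
          2 * ∑ f : Fin k → R, ∏ i, Real.exp (s * (-X (f i) + 2 * X (f i) ^ 2))) := by
        rw [← Finset.mul_sum, Finset.sum_add_distrib, Finset.sum_add_distrib, Finset.mul_sum]
    _ ≤ Real.exp (-s * Real.log 1.1) * ((Fintype.card R : ℝ) ^ k * Real.exp 6 +
          (Fintype.card R : ℝ) ^ k * Real.exp 6 +
          2 * ((Fintype.card R : ℝ) ^ k * Real.exp 6)) := by
        gcongr
        · exact hup s (by linarith) (by linarith)
        · exact hup (s + 1) (by linarith) le_rfl
    _ = _ := by ring

/-- A block of coordinates agrees off `j₀`, i.e. the two coordinates other than `j₀` agree. -/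
def AgreeOff {F : Type} (j₀ : Fin 3) (t : Fin 3 → F) : Prop := t (j₀ + 1) = t (j₀ + 2)

lemma card_agreeOff (F : Type) [Fintype F] (j₀ : Fin 3) :
    Nat.card {t : Fin 3 → F // AgreeOff j₀ t} = Fintype.card F ^ 2 := by
  have e : {t : Fin 3 → F // AgreeOff j₀ t} ≃ F × F :=
    { toFun := fun t => (t.1 j₀, t.1 (j₀ + 1))
      invFun := fun p => ⟨fun j => if j = j₀ then p.1 else p.2, by
        fin_cases j₀ <;> simp [AgreeOff]⟩
      left_inv := by
        rintro ⟨t, ht⟩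
        change t (j₀ + 1) = t (j₀ + 2) at ht
        ext j
        fin_cases j₀ <;> fin_cases j <;> simp
        all_goals exact ht
      right_inv := by
        rintro ⟨a, b⟩
        fin_cases j₀ <;> simp }
  rw [Nat.card_congr e, Nat.card_prod, Nat.card_eq_fintype_card, sq]

lemma forall_ne_eq_iff {F : Type} (j₀ : Fin 3) (t : Fin 3 → F) (a : F) :
    (∀ j, j ≠ j₀ → t j = a) ↔ AgreeOff j₀ t ∧ a = t (j₀ + 1) := by
  fin_cases j₀ <;> simp [AgreeOff, Fin.forall_fin_succ] <;> grind

open scoped Classical in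
/-- The number of coordinates off which all rows of the block `r` agree. -/
noncomputable def agreeCount {F : Type} {m : ℕ} (r : Fin m → Fin 3 → F) : ℝ :=
  ∑ j₀ : Fin 3, if ∀ j, AgreeOff j₀ (r j) then 1 else 0

lemma agreeCount_nonneg {F : Type} {m : ℕ} (r : Fin m → Fin 3 → F) : 0 ≤ agreeCount r :=
  Finset.sum_nonneg fun _ _ => by split_ifs <;> norm_num

lemma agreeCount_le {F : Type} {m : ℕ} (r : Fin m → Fin 3 → F) : agreeCount r ≤ 3 := by
  classical
  calc agreeCount r ≤ ∑ _j : Fin 3, (1 : ℝ) :=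
        Finset.sum_le_sum fun _ _ => by split_ifs <;> norm_num
    _ = 3 := by simp

lemma sum_agreeCount (F : Type) [Fintype F] (m : ℕ) :
    ∑ r : Fin m → Fin 3 → F, agreeCount r = 3 * ((Fintype.card F : ℝ) ^ 2) ^ m := by
  classical
  have h : ∀ j₀ : Fin 3,
      Nat.card {r : Fin m → Fin 3 → F // ∀ j, AgreeOff j₀ (r j)} =
        (Fintype.card F ^ 2) ^ m := by
    intro j₀
    rw [Nat.card_congr (Equiv.subtypePiEquivPi (p := fun _ : Fin m => AgreeOff j₀)),
      Nat.card_pi]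
    simp only [card_agreeOff, Finset.prod_const, Finset.card_univ, Fintype.card_fin]
  unfold agreeCount
  rw [Finset.sum_comm]
  have h' : ∀ j₀ : Fin 3, (∑ r : Fin m → Fin 3 → F,
      if ∀ j, AgreeOff j₀ (r j) then (1 : ℝ) else 0) = ((Fintype.card F : ℝ) ^ 2) ^ m := by
    intro j₀
    rw [Finset.sum_boole, ← Fintype.card_subtype, ← Nat.card_eq_fintype_card, h]
    push_cast
    rfl
  simp [h']

lemma mem_blockSpan_iff (F : Type) [Field F] (k : ℕ) (y : Fin k × Fin 3 → F) :
    y ∈ blockSpan F k ↔ ∃ a : Fin k → F, y = fun p => a p.1 := by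
  rw [blockSpan, Submodule.mem_span_range_iff_exists_fun]
  refine exists_congr fun a => ?_
  rw [eq_comm]
  refine Eq.congr_right ?_
  ext p
  simp [Finset.sum_apply]

lemma card_blockSpan (F : Type) [Field F] [Fintype F] (k : ℕ) :
    Nat.card (blockSpan F k) = Fintype.card F ^ k := by
  have e : (Fin k → F) ≃ blockSpan F k := Equiv.ofBijective
    (fun a => ⟨fun p => a p.1, (mem_blockSpan_iff F k _).2 ⟨a, rfl⟩⟩) <| by
      constructor
      · intro a b hab
        ext i
        exact congrFun (congrArg Subtype.val hab) (i, 0)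
      · rintro ⟨y, hy⟩
        obtain ⟨a, rfl⟩ := (mem_blockSpan_iff F k _).1 hy
        exact ⟨a, rfl⟩
  rw [← Nat.card_congr e]
  simp

/-- The single-block support condition for the choice `o`. -/
def BlockSupp {F : Type} [Field F] (o : Option (Fin 3)) (t : Fin 3 → F) : Prop :=
  ∀ j j₀ : Fin 3, o = some j₀ → j ≠ j₀ → t j = 0

lemma card_blockSupp (F : Type) [Field F] [Fintype F] (o : Option (Fin 3)) :
    Nat.card {t : Fin 3 → F // BlockSupp o t} =
      if o = none then Fintype.card F ^ 3 else Fintype.card F := by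
  rcases o with _ | j₀
  · have : ∀ t : Fin 3 → F, BlockSupp none t := fun t j j₀ h => by simp at h
    rw [Nat.card_congr (Equiv.subtypeUnivEquiv this)]
    simp
  · have e : {t : Fin 3 → F // BlockSupp (some j₀) t} ≃ F :=
      { toFun := fun t => t.1 j₀
        invFun := fun a => ⟨Pi.single j₀ a, by
          intro j j₁ h hj
          obtain rfl := Option.some_injective _ h
          simp [hj]⟩
        left_inv := by
          rintro ⟨t, ht⟩
          ext j
          by_cases hj : j = j₀
          · subst hj; simp
          · simp [Pi.single_eq_of_ne hj, ht j j₀ rfl hj]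
        right_inv := fun a => by simp }
    rw [Nat.card_congr e]
    simp

lemma card_suppSet (F : Type) [Field F] [Fintype F] (k : ℕ) (v : Fin k → Option (Fin 3)) :
    Nat.card (suppSet F k v) =
      ∏ i, if v i = none then Fintype.card F ^ 3 else Fintype.card F := by
  have e : suppSet F k v ≃ {f : Fin k → Fin 3 → F // ∀ i, BlockSupp (v i) (f i)} :=
    (Equiv.curry (Fin k) (Fin 3) F).subtypeEquiv fun y => Iff.rfl
  rw [Nat.card_congr e,
    Nat.card_congr (Equiv.subtypePiEquivPi (p := fun i : Fin k => BlockSupp (v i))), Nat.card_pi]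
  simp_rw [card_blockSupp]

open scoped Classical in
lemma card_fiber (F : Type) [Field F] [Fintype F] (k : ℕ) (v : Fin k → Option (Fin 3))
    (y : Fin k × Fin 3 → F) :
    Nat.card {z : ((Fin k × Fin 3) → F) × ((Fin k × Fin 3) → F) //
      z.1 ∈ suppSet F k v ∧ z.2 ∈ blockSpan F k ∧ z.1 + z.2 = y} =
    ∏ i, (match v i with
      | none => Fintype.card F
      | some j₀ => if AgreeOff j₀ (fun j => y (i, j)) then 1 else 0) := by
  have e : {a : Fin k → F // ∀ i, ∀ j j₀, v i = some j₀ → j ≠ j₀ → y (i, j) = a i} ≃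
      {z : ((Fin k × Fin 3) → F) × ((Fin k × Fin 3) → F) //
      z.1 ∈ suppSet F k v ∧ z.2 ∈ blockSpan F k ∧ z.1 + z.2 = y} := Equiv.ofBijective
    (fun a => ⟨(fun p => y p - a.1 p.1, fun p => a.1 p.1),
      fun i j j₀ h hj => sub_eq_zero.2 (a.2 i j j₀ h hj),
      (mem_blockSpan_iff F k _).2 ⟨a.1, rfl⟩, by ext p; simp⟩) <| by
      constructor
      · intro a b hab
        ext i
        exact congrFun (congrArg (fun z => z.1.2) hab) (i, 0)
      · rintro ⟨⟨z₁, z₂⟩, h₁, h₂, h₃⟩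
        obtain ⟨a, rfl⟩ := (mem_blockSpan_iff F k _).1 h₂
        have hz : z₁ = fun p => y p - a p.1 := by
          rw [← h₃]; ext p; simp
        subst hz
        exact ⟨⟨a, fun i j j₀ h hj => sub_eq_zero.1 (h₁ i j j₀ h hj)⟩, rfl⟩
  rw [← Nat.card_congr e, Nat.card_congr (Equiv.subtypePiEquivPi
    (p := fun (i : Fin k) (a : F) => ∀ j j₀, v i = some j₀ → j ≠ j₀ → y (i, j) = a)),
    Nat.card_pi]
  refine Finset.prod_congr rfl fun i _ => ?_
  rcases hv : v i with _ | j₀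
  · simp
  · have h : ∀ a, (∀ j j₁, some j₀ = some j₁ → j ≠ j₁ → y (i, j) = a) ↔
        AgreeOff j₀ (fun j => y (i, j)) ∧ a = y (i, j₀ + 1) := by
      intro a
      rw [← forall_ne_eq_iff j₀ (fun j => y (i, j)) a]
      simp
    simp_rw [h]
    split_ifs with hA <;> simp [hA]

open scoped Classical in
lemma condMass_eq_prod (F : Type) [Field F] [Fintype F] (k : ℕ) (v : Fin k → Option (Fin 3))
    (y : Fin k × Fin 3 → F) :
    condMass F k v y = ∏ i, (match v i with
      | none => ((Fintype.card F : ℝ) ^ 3)⁻¹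
      | some j₀ => ((Fintype.card F : ℝ) ^ 3)⁻¹ *
          (if AgreeOff j₀ (fun j => y (i, j)) then (Fintype.card F : ℝ) else 0)) := by
  have hq : (Fintype.card F : ℝ) ≠ 0 := by exact_mod_cast Fintype.card_ne_zero
  rw [condMass, card_fiber, card_suppSet, card_blockSpan]
  push_cast
  rw [show (Fintype.card F : ℝ) ^ k = ∏ _i : Fin k, (Fintype.card F : ℝ) by simp,
    ← Finset.prod_mul_distrib, ← Finset.prod_div_distrib]
  refine Finset.prod_congr rfl fun i _ => ?_
  rcases v i with _ | j₀
  · simp; field_simp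
  · simp only [reduceCtorEq, if_false]
    split_ifs <;> (simp; try field_simp)

/-- The `i`-th block of every sample. -/
def sampleBlocks (F : Type) (k m : ℕ) :
    (Fin m → Fin k × Fin 3 → F) ≃ (Fin k → Fin m → Fin 3 → F) where
  toFun x i j t := x j (i, t)
  invFun f j p := f p.1 j p.2
  left_inv _ := rfl
  right_inv _ := rfl

lemma D'mass_eq_Dmass_mul_prod (F : Type) [Field F] [Fintype F] (k m : ℕ) (β : ℝ)
    (x : Fin m → Fin k × Fin 3 → F) :
    D'mass F k m β x = Dmass F k m x *
      ∏ i, (1 + (-β + β / 3 * (Fintype.card F : ℝ) ^ m * agreeCount (sampleBlocks F k m x i))) := by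
  classical
  have hq : (Fintype.card F : ℝ) ≠ 0 := by exact_mod_cast Fintype.card_ne_zero
  have hD : Dmass F k m x = ∏ _i : Fin k, (((Fintype.card F : ℝ) ^ 3)⁻¹) ^ m := by
    simp only [Dmass, Finset.prod_const, Finset.card_univ, Fintype.card_fin, ← pow_mul, inv_pow]
    ring_nf
  rw [hD, ← Finset.prod_mul_distrib, D'mass]
  simp_rw [condMass_eq_prod, weightV]
  have h1 : ∀ v : Fin k → Option (Fin 3),
      (∏ i, if v i = none then 1 - β else β / 3) * ∏ j : Fin m, ∏ i, (match v i with
        | none => ((Fintype.card F : ℝ) ^ 3)⁻¹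
        | some j₀ => ((Fintype.card F : ℝ) ^ 3)⁻¹ *
          (if AgreeOff j₀ (fun t => x j (i, t)) then (Fintype.card F : ℝ) else 0)) =
      ∏ i, ((if v i = none then 1 - β else β / 3) * ∏ j : Fin m, (match v i with
        | none => ((Fintype.card F : ℝ) ^ 3)⁻¹
        | some j₀ => ((Fintype.card F : ℝ) ^ 3)⁻¹ *
          (if AgreeOff j₀ (fun t => x j (i, t)) then (Fintype.card F : ℝ) else 0))) := by
    intro v
    rw [Finset.prod_comm, ← Finset.prod_mul_distrib]
  have h2 := Finset.prod_univ_sum (fun _ : Fin k => (Finset.univ : Finset (Option (Fin 3))))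
    (fun i o => ((if o = none then 1 - β else β / 3) * ∏ j : Fin m, (match o with
        | none => ((Fintype.card F : ℝ) ^ 3)⁻¹
        | some j₀ => ((Fintype.card F : ℝ) ^ 3)⁻¹ *
          (if AgreeOff j₀ (fun t => x j (i, t)) then (Fintype.card F : ℝ) else 0))))
  rw [Fintype.piFinset_univ] at h2
  rw [Finset.sum_congr rfl fun v _ => h1 v, ← h2]
  refine Finset.prod_congr rfl fun i _ => ?_
  have h3 : ∀ j₀ : Fin 3, (∏ j : Fin m,
      if AgreeOff j₀ (fun t => x j (i, t)) then (Fintype.card F : ℝ) else 0) =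
      (Fintype.card F : ℝ) ^ m *
        if ∀ j, AgreeOff j₀ (sampleBlocks F k m x i j) then 1 else 0 := by
    intro j₀
    split_ifs with h
    · have h' : ∀ j, AgreeOff j₀ (fun t => x j (i, t)) := h
      simp [h']
    · obtain ⟨j, hj⟩ := not_forall.1 h
      rw [mul_zero]
      exact Finset.prod_eq_zero (Finset.mem_univ j) (if_neg hj)
  rw [Fintype.sum_option]
  simp only [reduceCtorEq, if_true, if_false, Finset.prod_mul_distrib, h3, agreeCount,
    Finset.prod_const, Finset.card_univ, Fintype.card_fin]
  rw [mul_add, mul_add]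
  simp_rw [Finset.mul_sum]
  rw [show ∀ a d : ℝ, a * 1 + (a * -β + d) = (1 - β) * a + d by intros; ring]
  congr 1
  refine Finset.sum_congr rfl fun j₀ _ => ?_
  ring

/-- Closeness of `𝒟` and `𝒟'` off a small set, with the parameters expressed through
`s = q^(cℓ/3)`. -/
lemma exists_exceptional_set (F : Type) [Field F] [Fintype F] (k m : ℕ) {β s : ℝ} (hs : 2 ≤ s)
    (hk : (k : ℝ) = (Fintype.card F : ℝ) ^ m * s ^ 6)
    (hβ : β = ((Fintype.card F : ℝ) ^ m * s ^ 4)⁻¹) :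
    ∃ E : Set (Fin m → (Fin k × Fin 3) → F),
      massOf (Dmass F k m) E ≤ 4 * Real.exp 6 * Real.exp (-s * Real.log 1.1) ∧
      massOf (D'mass F k m β) E ≤ 4 * Real.exp 6 * Real.exp (-s * Real.log 1.1) ∧
      ∀ x, x ∉ E → 0.9 ≤ Dmass F k m x / D'mass F k m β x ∧
        Dmass F k m x / D'mass F k m β x ≤ 1.1 := by
  have hq : (1 : ℝ) ≤ Fintype.card F := by exact_mod_cast Fintype.card_pos
  set Q : ℝ := (Fintype.card F : ℝ) ^ m with hQdef
  have hQ : 1 ≤ Q := one_le_pow₀ hq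
  have hQ0 : 0 < Q := by linarith
  have hβ0 : 0 < β := by rw [hβ]; positivity
  have hβQ : β * Q = (s ^ 4)⁻¹ := by rw [hβ]; field_simp
  set X : (Fin m → Fin 3 → F) → ℝ := fun r => -β + β / 3 * Q * agreeCount r with hXdef
  have hcard : (Fintype.card (Fin m → Fin 3 → F) : ℝ) = Q ^ 3 := by
    simp only [Fintype.card_fun, Fintype.card_fin, hQdef]
    push_cast
    rw [← pow_mul, ← pow_mul, mul_comm]
  have hsum : ∑ r : Fin m → Fin 3 → F, agreeCount r = 3 * Q ^ 2 := by
    rw [sum_agreeCount, hQdef, ← pow_mul, ← pow_mul, mul_comm 2 m]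
  have hsum_sq : ∑ r : Fin m → Fin 3 → F, agreeCount r ^ 2 ≤ 9 * Q ^ 2 := by
    calc ∑ r : Fin m → Fin 3 → F, agreeCount r ^ 2
        ≤ ∑ r : Fin m → Fin 3 → F, 3 * agreeCount r := Finset.sum_le_sum fun r _ => by
          nlinarith [agreeCount_nonneg r, agreeCount_le r]
      _ = 9 * Q ^ 2 := by rw [← Finset.mul_sum, hsum]; ring
  have hX : ∑ r, X r = 0 := by
    simp only [hXdef, Finset.sum_add_distrib, ← Finset.mul_sum, hsum, Finset.sum_const,
      Finset.card_univ, nsmul_eq_mul, hcard]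
    ring
  have hV : ∑ r, X r ^ 2 ≤ Fintype.card (Fin m → Fin 3 → F) * (β ^ 2 * Q) := by
    have h1 : ∀ r, X r ^ 2 = β ^ 2 - 2 * β ^ 2 / 3 * Q * agreeCount r +
        (β * Q / 3) ^ 2 * agreeCount r ^ 2 := fun r => by simp only [hXdef]; ring
    simp only [h1, Finset.sum_add_distrib, Finset.sum_sub_distrib, ← Finset.mul_sum, hsum,
      Finset.sum_const, Finset.card_univ, nsmul_eq_mul, hcard]
    have h2 := mul_le_mul_of_nonneg_left hsum_sq (sq_nonneg (β * Q / 3))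
    have h3 : 0 ≤ Q ^ 3 * β ^ 2 := by positivity
    linarith
  have hd : ∀ r, |X r| ≤ β * Q := by
    intro r
    have h1 : 0 ≤ β * Q * agreeCount r := mul_nonneg (by positivity) (agreeCount_nonneg r)
    have h2 : β * Q * agreeCount r ≤ β * Q * 3 :=
      mul_le_mul_of_nonneg_left (agreeCount_le r) (by positivity)
    have h3 : β ≤ β * Q := le_mul_of_one_le_right hβ0.le hQ
    rw [abs_le]
    constructor <;> simp only [hXdef] <;> linarith
  have hs4 : 16 ≤ s ^ 4 := by
    calc (16 : ℝ) = 2 ^ 4 := by norm_num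
      _ ≤ s ^ 4 := by gcongr
  have hsd : (s + 1) * (β * Q) ≤ 1 / 3 := by
    rw [hβQ, ← div_eq_mul_inv, div_le_iff₀ (by positivity)]
    have : 8 ≤ s ^ 3 := by
      calc (8 : ℝ) = 2 ^ 3 := by norm_num
        _ ≤ s ^ 3 := by gcongr
    nlinarith
  have hkV : k * (s ^ 2 * (β ^ 2 * Q)) ≤ 1 := by
    rw [hk, hβ]
    apply le_of_eq
    field_simp
  have hsmall : β * Q ≤ 1 / 2 := by
    rw [hβQ]
    exact (inv_anti₀ (by norm_num) hs4).trans (by norm_num)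
  set T : (Fin k → Fin m → Fin 3 → F) → ℝ := fun f => ∏ i, (1 + X (f i)) with hT
  have hTpos : ∀ f, 0 < T f := fun f => Finset.prod_pos fun i _ => by
    linarith [(abs_le.1 (hd (f i))).1]
  set A : Set (Fin k → Fin m → Fin 3 → F) := {f | 10 / 9 ≤ T f ∨ T f ≤ 10 / 11} with hA
  have htail := sum_tail_prod_le k X hX hV hd (by linarith) hsd hkV A fun f hf => hf
  set P : ℝ := (Q ^ 3) ^ k with hP
  have hP0 : 0 < P := by positivity
  rw [hcard] at htail
  have hD : ∀ x, Dmass F k m x = P⁻¹ := fun x => by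
    simp only [Dmass, hP, hQdef, ← pow_mul]
    ring_nf
  have hD' : ∀ x, D'mass F k m β x = P⁻¹ * T (sampleBlocks F k m x) := fun x => by
    rw [D'mass_eq_Dmass_mul_prod, hD]
  have hmass : ∀ μ : (Fin m → (Fin k × Fin 3) → F) → ℝ,
      (∀ x, μ x ≤ P⁻¹ * (1 + T (sampleBlocks F k m x))) →
      massOf μ (sampleBlocks F k m ⁻¹' A) ≤
        4 * Real.exp 6 * Real.exp (-s * Real.log 1.1) := by
    intro μ hμ
    calc massOf μ (sampleBlocks F k m ⁻¹' A)
        ≤ ∑ x, P⁻¹ * A.indicator (fun f => 1 + T f) (sampleBlocks F k m x) := by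
          refine Finset.sum_le_sum fun x _ => ?_
          by_cases hx : sampleBlocks F k m x ∈ A
          · rw [Set.indicator_of_mem hx, Set.indicator_of_mem (by exact hx)]
            exact hμ x
          · rw [Set.indicator_of_notMem hx, Set.indicator_of_notMem (by exact hx), mul_zero]
      _ = P⁻¹ * ∑ f, A.indicator (fun f => 1 + T f) f := by
          rw [← Finset.mul_sum,
            (sampleBlocks F k m).sum_comp (fun f => A.indicator (fun f => 1 + T f) f)]
      _ ≤ P⁻¹ * (P * (4 * Real.exp 6 * Real.exp (-s * Real.log 1.1))) := by gcongr
      _ = _ := by rw [inv_mul_cancel_left₀ hP0.ne']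
  refine ⟨sampleBlocks F k m ⁻¹' A, hmass _ fun x => ?_, hmass _ fun x => ?_, fun x hx => ?_⟩
  · rw [hD]
    exact le_mul_of_one_le_right (inv_pos.2 hP0).le (by linarith [hTpos (sampleBlocks F k m x)])
  · rw [hD']
    gcongr
    linarith
  · have hx' : ¬ (10 / 9 ≤ T (sampleBlocks F k m x) ∨ T (sampleBlocks F k m x) ≤ 10 / 11) := hx
    push Not at hx'
    have h0 := hTpos (sampleBlocks F k m x)
    have hPi : P⁻¹ ≠ 0 := (inv_pos.2 hP0).ne'
    rw [hD, hD', div_mul_cancel_left₀ hPi]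
    constructor
    · rw [le_inv_comm₀ (by norm_num) h0]
      exact hx'.1.le.trans (by norm_num)
    · rw [inv_le_comm₀ h0 (by norm_num)]
      exact le_trans (by norm_num) hx'.2.le

/-- Exponential growth of `s = q^(cℓ/3)` beats the polynomial exponent of `η`. -/
lemma eventually_tail_le {q c : ℝ} (hq : 2 ≤ q) (hc : 0 < c) :
    ∀ᶠ ℓ : ℕ in Filter.atTop, 2 ≤ q ^ (c * ℓ / 3) ∧
      4 * Real.exp 6 * Real.exp (-q ^ (c * ℓ / 3) * Real.log 1.1) ≤
        (q ^ (-(100 * (ℓ : ℝ) ^ 100))) ^ 40 := by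
  have hq0 : 0 < q := by linarith
  have hlq : 0 < Real.log q := Real.log_pos (by linarith)
  have hl : 0 < Real.log 1.1 := Real.log_pos (by norm_num)
  set K : ℝ := 2 + (Real.log 4 + 6 + 4000 * Real.log q) / Real.log 1.1 with hK
  have hl4 : 0 < Real.log 4 := Real.log_pos (by norm_num)
  have hK2 : 2 ≤ K := by
    have : 0 ≤ (Real.log 4 + 6 + 4000 * Real.log q) / Real.log 1.1 := by positivity
    linarith
  have hb : 0 < c * Real.log q / 3 := by positivity
  have hK0 : 0 < K := by linarith
  have hlim := ((isLittleO_pow_exp_pos_mul_atTop 100 hb).def (inv_pos.2 hK0)).natCast_atTop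
  filter_upwards [hlim, Filter.eventually_ge_atTop 1] with ℓ h hℓ
  have hℓ1 : (1 : ℝ) ≤ (ℓ : ℝ) ^ 100 := one_le_pow₀ (by exact_mod_cast hℓ)
  have hs : q ^ (c * ℓ / 3) = Real.exp (c * Real.log q / 3 * ℓ) := by
    rw [Real.rpow_def_of_pos hq0]; ring_nf
  rw [← hs, Real.norm_of_nonneg (by positivity), Real.norm_of_nonneg (by positivity),
    inv_mul_eq_div, le_div_iff₀ (by linarith)] at h
  set s := q ^ (c * ℓ / 3) with hsdef
  refine ⟨by nlinarith, ?_⟩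
  have h1 : (q ^ (-(100 * (ℓ : ℝ) ^ 100))) ^ 40 =
      Real.exp (-(4000 * Real.log q * (ℓ : ℝ) ^ 100)) := by
    rw [Real.rpow_def_of_pos hq0, ← Real.exp_nat_mul]; ring_nf
  rw [h1]
  nth_rewrite 1 [← Real.exp_log (by norm_num : (0 : ℝ) < 4)]
  rw [← Real.exp_add, ← Real.exp_add, Real.exp_le_exp]
  have h2 : (Real.log 4 + 6 + 4000 * Real.log q) * (ℓ : ℝ) ^ 100 ≤ s * Real.log 1.1 := by
    have h3 : (Real.log 4 + 6 + 4000 * Real.log q) = (K - 2) * Real.log 1.1 := by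
      rw [hK]; field_simp; ring
    rw [h3]
    nlinarith
  nlinarith

/-- the improved covering property, Lemma 5.6.  Let `q` be a power of `2`.
For every sufficiently small `c > 0`, for all sufficiently large `ℓ` with
`k = q^(2(1+c)ℓ) ∈ ℕ`, setting `β = q^(-2(1+2c/3)ℓ)` and `η = q^(-100ℓ^100)`, there is a
set `E` of `𝒟`- and `𝒟'`-mass at most `η^40` outside of which the two mass functions agree
up to a factor in `[0.9, 1.1]`. -/
theorem stmt6 (F : Type) [Field F] [Fintype F]
    (hq : ∃ e : ℕ, 0 < e ∧ Fintype.card F = 2 ^ e) :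
    ∃ c₀ : ℝ, 0 < c₀ ∧ ∀ c : ℝ, 0 < c → c ≤ c₀ →
      ∃ ℓ₀ : ℕ, ∀ ℓ : ℕ, ℓ₀ ≤ ℓ →
        ∀ k : ℕ, (k : ℝ) = (Fintype.card F : ℝ) ^ (2 * (1 + c) * (ℓ : ℝ)) →
        ∀ β η : ℝ,
          β = (Fintype.card F : ℝ) ^ (-(2 * (1 + 2 * c / 3) * (ℓ : ℝ))) →
          η = (Fintype.card F : ℝ) ^ (-(100 * (ℓ : ℝ) ^ 100)) →
          ∃ E : Set (Fin (2 * ℓ) → (Fin k × Fin 3) → F),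
            massOf (Dmass F k (2 * ℓ)) E ≤ η ^ 40 ∧
            massOf (D'mass F k (2 * ℓ) β) E ≤ η ^ 40 ∧
            ∀ x : Fin (2 * ℓ) → (Fin k × Fin 3) → F, x ∉ E →
              0.9 ≤ Dmass F k (2 * ℓ) x / D'mass F k (2 * ℓ) β x ∧
                Dmass F k (2 * ℓ) x / D'mass F k (2 * ℓ) β x ≤ 1.1 := by
  obtain ⟨e, he, hqe⟩ := hq
  have hq2 : (2 : ℝ) ≤ Fintype.card F := by
    rw [hqe]
    exact_mod_cast Nat.le_self_pow he.ne' 2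
  have hq0 : (0 : ℝ) < Fintype.card F := by linarith
  refine ⟨1, one_pos, fun c hc _ => ?_⟩
  obtain ⟨ℓ₀, hℓ₀⟩ := Filter.eventually_atTop.1 (eventually_tail_le hq2 hc)
  refine ⟨ℓ₀, fun ℓ hℓ k hk β η hβ hη => ?_⟩
  obtain ⟨hs, htail⟩ := hℓ₀ ℓ hℓ
  rw [← hη] at htail
  obtain ⟨E, h₁, h₂, h₃⟩ := exists_exceptional_set F k (2 * ℓ) (β := β) hs
    (by
      rw [hk, ← Real.rpow_natCast, ← Real.rpow_mul_natCast hq0.le, ← Real.rpow_add hq0]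
      congr 1; push_cast; ring)
    (by
      rw [hβ, ← Real.rpow_natCast, ← Real.rpow_mul_natCast hq0.le, ← Real.rpow_add hq0,
        ← Real.rpow_neg hq0.le]
      congr 1; push_cast; ring)
  exact ⟨E, h₁.trans htail, h₂.trans htail, h₃⟩
end

section
/- Let q be a prime power, r ≥ 1 and t ≥ 2 integers, V a finite-dimensional F_q-vector space, and 𝒮 a set of N subspaces of V, each of codimension r in V. Then there exists a subspace V' ⊆ V, an integer s ≤ r, and a subset 𝒮' ⊆ 𝒮 with |𝒮'| ≥ N^{1/((r+1)·(t−1)!)} / q^{3r} such that every member of 𝒮' is contained in V' and has codimension exactly s with respect to V', and 𝒮' is t-generic with respect to V'. -/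
open Module

/-- A collection `𝒮` of subspaces (each of codimension `r` inside `V'`) is `t`-generic with
respect to `V'` if every `t` distinct members intersect in codimension `t·r` with respect
to `V'`. -/
def IsGeneric (F V : Type*) [Field F] [AddCommGroup V] [Module F V]
    (t r : ℕ) (V' : Submodule F V) (𝒮 : Set (Submodule F V)) : Prop :=
  ∀ s : Finset (Submodule F V), ↑s ⊆ 𝒮 → s.card = t →
    finrank F ↥(s.inf id) + t * r = finrank F ↥V'

open scoped Pointwise in
theorem Submodule.finset_sup_subset_nsmul {F X : Type*} [Field F] [AddCommGroup X] [Module F X]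
    [DecidableEq X] (T : Finset (Submodule F X)) (B : Finset X)
    (hB : ∀ U ∈ T, ∀ x ∈ U, x ∈ B) : ∀ x ∈ T.sup id, x ∈ T.card • B := by
  classical
  induction T using Finset.induction_on with
  | empty => simp
  | insert U T hU ih =>
    intro x hx
    rw [Finset.sup_insert, id, Submodule.mem_sup] at hx
    obtain ⟨y, hy, z, hz, rfl⟩ := hx
    rw [Finset.card_insert_of_notMem hU, succ_nsmul', Finset.mem_add]
    exact ⟨y, hB U (Finset.mem_insert_self _ _) y hy, z,
      ih (fun W hW => hB W (Finset.mem_insert_of_mem hW)) z hz, rfl⟩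

/-- Every member of `M` contains `A` and has dimension `d` modulo `A`, and every at most `t`
members are independent modulo `A`. -/
def IsIndependentModulo {F X : Type*} [Field F] [AddCommGroup X] [Module F X]
    (t d : ℕ) (A : Submodule F X) (M : Finset (Submodule F X)) : Prop :=
  (∀ U ∈ M, A ≤ U ∧ finrank F U = finrank F A + d) ∧
    ∀ T ⊆ M, T.card ≤ t → finrank F ↥(A ⊔ T.sup id) = finrank F A + T.card * d

theorem IsIndependentModulo.empty {F X : Type*} [Field F] [AddCommGroup X] [Module F X]
    (t d : ℕ) (A : Submodule F X) : IsIndependentModulo t d A ∅ :=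
  ⟨by simp, fun T hT _ => by
    obtain rfl := Finset.subset_empty.1 hT
    rw [Finset.sup_empty, sup_bot_eq, Finset.card_empty, zero_mul, add_zero]⟩

/-- A member of a family which cannot be added to a subfamily independent modulo `A` meets the
span of few members of the subfamily outside `A`. -/
theorem IsIndependentModulo.exists_mem_sup {F X : Type*} [Field F] [AddCommGroup X] [Module F X]
    [FiniteDimensional F X] [DecidableEq (Submodule F X)] {k d : ℕ} (hk : 1 ≤ k) (hd : 1 ≤ d)
    {A U : Submodule F X} {M : Finset (Submodule F X)} (hM : IsIndependentModulo (k + 1) d A M)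
    (hAU : A ≤ U) (hU : finrank F U = finrank F A + d)
    (hmax : IsIndependentModulo (k + 1) d A (insert U M) → U ∈ M) :
    ∃ T ⊆ M, T.card ≤ k ∧ ∃ x ∈ T.sup id, x ∈ U ∧ x ∉ A := by
  have key : ∃ T ⊆ M, T.card ≤ k ∧ ∃ v ∈ A ⊔ T.sup id, v ∈ U ∧ v ∉ A := by
    by_cases hUM : U ∈ M
    · have hlt : ¬ U ≤ A := fun h => by
        have := Submodule.finrank_mono h
        omega
      obtain ⟨v, hv, hvA⟩ := SetLike.not_le_iff_exists.1 hlt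
      exact ⟨{U}, by simpa using hUM, by simpa using hk, v,
        (le_sup_right : _ ≤ A ⊔ _) (by simpa using hv), hv, hvA⟩
    · have hnot : ¬ IsIndependentModulo (k + 1) d A (insert U M) := fun h => hUM (hmax h)
      have hmem : ∀ W ∈ insert U M, A ≤ W ∧ finrank F W = finrank F A + d := by
        intro W hW
        rcases Finset.mem_insert.1 hW with rfl | hW
        · exact ⟨hAU, hU⟩
        · exact hM.1 W hW
      have : ∃ T' ⊆ insert U M, T'.card ≤ k + 1 ∧
          finrank F ↥(A ⊔ T'.sup id) ≠ finrank F A + T'.card * d := by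
        by_contra! hcon
        exact hnot ⟨hmem, hcon⟩
      obtain ⟨T', hT', hcard, hne⟩ := this
      have hUT : U ∈ T' := by
        by_contra hUT
        exact hne (hM.2 T' ((Finset.subset_insert_iff_of_notMem hUT).1 hT') hcard)
      have hTM : T'.erase U ⊆ M := Finset.subset_insert_iff.1 hT'
      have hTc : (T'.erase U).card + 1 = T'.card := Finset.card_erase_add_one hUT
      refine ⟨T'.erase U, hTM, by omega, ?_⟩
      by_contra! hcon
      apply hne
      have hinf : (A ⊔ (T'.erase U).sup id) ⊓ U = A :=
        le_antisymm (fun v hv => hcon v hv.1 hv.2) (le_inf le_sup_left hAU)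
      have hdim := Submodule.finrank_sup_add_finrank_inf_eq (A ⊔ (T'.erase U).sup id) U
      have hsup : (A ⊔ (T'.erase U).sup id) ⊔ U = A ⊔ T'.sup id := by
        conv_rhs => rw [← Finset.insert_erase hUT, Finset.sup_insert, id]
        rw [sup_assoc, sup_comm U]
      rw [hinf, hsup, hM.2 _ hTM (by omega), hU] at hdim
      rw [← hTc, add_mul]
      omega
  obtain ⟨T, hTM, hTk, v, hv, hvU, hvA⟩ := key
  obtain ⟨a, ha, x, hx, rfl⟩ := Submodule.mem_sup.1 hv
  exact ⟨T, hTM, hTk, x, hx, (Submodule.add_mem_iff_right U (hAU ha)).1 hvU,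
    fun hxA => hvA (A.add_mem ha hxA)⟩

open scoped Pointwise in
/-- A family of `r`-dimensional subspaces containing `A`, none of whose subfamilies independent
modulo some subspace has more than `m` members, is small. -/
theorem card_le_of_isIndependentModulo_card_le {F X : Type*} [Field F] [Fintype F]
    [AddCommGroup X] [Module F X] [FiniteDimensional F X] {k r m : ℕ} (hk : 1 ≤ k) (d : ℕ)
    (A : Submodule F X) (S : Finset (Submodule F X)) (hA : finrank F A + d = r)
    (hS : ∀ U ∈ S, A ≤ U ∧ finrank F U = r)
    (hm : ∀ (A' : Submodule F X) (d' : ℕ) (M : Finset (Submodule F X)), M ⊆ S →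
      finrank F A' + d' = r → IsIndependentModulo (k + 1) d' A' M → M.card ≤ m) :
    S.card ≤ (m * Fintype.card F ^ r) ^ (k * d) := by
  classical
  have : Finite X := Module.finite_of_finite F
  have : Fintype X := Fintype.ofFinite X
  induction d generalizing A S with
  | zero =>
    rw [mul_zero, pow_zero, Finset.card_le_one]
    have hSA : ∀ U ∈ S, A = U := fun U hU =>
      Submodule.eq_of_le_of_finrank_eq (hS U hU).1 (by have := (hS U hU).2; omega)
    exact fun U hU W hW => (hSA U hU).symm.trans (hSA W hW)
  | succ d ih =>
    obtain ⟨M, hM, hMmax⟩ := Finset.exists_max_image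
      (S.powerset.filter (IsIndependentModulo (k + 1) (d + 1) A)) Finset.card
      ⟨∅, by simp [IsIndependentModulo.empty]⟩
    rw [Finset.mem_filter, Finset.mem_powerset] at hM
    obtain ⟨hMS, hMi⟩ := hM
    let B : Finset X := M.biUnion fun U => Finset.univ.filter (· ∈ U)
    have hBmem : ∀ U ∈ M, ∀ x ∈ U, x ∈ B := fun U hU x hx =>
      Finset.mem_biUnion.2 ⟨U, hU, by simpa using hx⟩
    have hB : B.card ≤ m * Fintype.card F ^ r := by
      refine (Finset.card_biUnion_le_card_mul M _ (Fintype.card F ^ r) fun U hU => ?_).trans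
        (Nat.mul_le_mul_right _ (hm A (d + 1) M hMS hA hMi))
      rw [← Fintype.card_subtype, ← (hS U (hMS hU)).2]
      exact (Module.card_eq_pow_finrank (K := F) (V := U)).le
    have hcover : S ⊆ ((k • B).filter (· ∉ A)).biUnion fun v => S.filter (v ∈ ·) := by
      intro U hU
      obtain ⟨T, hTM, hTk, x, hx, hxU, hxA⟩ := hMi.exists_mem_sup hk (by omega)
        (hS U hU).1 (by have := (hS U hU).2; omega) (fun hins => by
          by_contra hUM
          have := hMmax (insert U M) (Finset.mem_filter.2
            ⟨Finset.mem_powerset.2 (Finset.insert_subset hU hMS), hins⟩)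
          rw [Finset.card_insert_of_notMem hUM] at this
          omega)
      have hTne : T.Nonempty := by
        rw [Finset.nonempty_iff_ne_empty]
        rintro rfl
        rw [Finset.sup_empty, Submodule.mem_bot] at hx
        exact hxA (hx ▸ A.zero_mem)
      obtain ⟨W, hW⟩ := hTne
      have h0 : (0 : X) ∈ B := hBmem W (hTM hW) 0 W.zero_mem
      have hxB : x ∈ k • B := Finset.nsmul_subset_nsmul_right h0 hTk
        (Submodule.finset_sup_subset_nsmul T B (fun W hW => hBmem W (hTM hW)) x hx)
      exact Finset.mem_biUnion.2 ⟨x, Finset.mem_filter.2 ⟨hxB, hxA⟩,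
        Finset.mem_filter.2 ⟨hU, hxU⟩⟩
    calc S.card ≤ _ := Finset.card_le_card hcover
      _ ≤ ((k • B).filter (· ∉ A)).card * (m * Fintype.card F ^ r) ^ (k * d) := by
        refine Finset.card_biUnion_le_card_mul _ _ _ fun v hv => ?_
        have hvA := (Finset.mem_filter.1 hv).2
        refine ih (A ⊔ F ∙ v) _ ?_ (fun U hU => ?_)
          (fun A' d' M' hM' => hm A' d' M' (hM'.trans (Finset.filter_subset _ _)))
        · have hv0 : v ≠ 0 := fun h => hvA (h ▸ A.zero_mem)
          have hdim := Submodule.finrank_sup_add_finrank_inf_eq A (F ∙ v)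
          have hinf : A ⊓ F ∙ v = ⊥ := disjoint_iff.1
            ((Submodule.disjoint_span_singleton' hv0).2 hvA)
          rw [hinf, finrank_bot, finrank_span_singleton hv0] at hdim
          omega
        · rw [Finset.mem_filter] at hU
          exact ⟨sup_le (hS U hU.1).1 ((Submodule.span_singleton_le_iff_mem v U).2 hU.2),
            (hS U hU.1).2⟩
      _ ≤ (m * Fintype.card F ^ r) ^ k * (m * Fintype.card F ^ r) ^ (k * d) := by
        gcongr
        exact (Finset.card_filter_le _ _).trans
          (Finset.card_nsmul_le.trans (Nat.pow_le_pow_left hB k))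
      _ = _ := by rw [← pow_add]; congr 1; ring

theorem rpow_div_le_of_le_pow {N m Q r k : ℕ} (hQ : 1 ≤ Q) (hr : 1 ≤ r) (hk : 1 ≤ k)
    (h : N ≤ (m * Q ^ r) ^ (k * r)) :
    (N : ℝ) ^ ((1 : ℝ) / ((r + 1) * k.factorial)) / (Q : ℝ) ^ (3 * r) ≤ m := by
  have hQ' : (1 : ℝ) ≤ Q := by exact_mod_cast hQ
  have he : (0 : ℝ) < (r + 1) * k.factorial := by positivity
  rw [div_le_iff₀ (by positivity)]
  rcases Nat.eq_zero_or_pos m with rfl | hm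
  · have hN : N = 0 := by
      rw [zero_mul, zero_pow (by positivity)] at h
      omega
    rw [hN, Nat.cast_zero, Real.zero_rpow (by positivity)]
    positivity
  · have hb : (1 : ℝ) ≤ m * (Q : ℝ) ^ r :=
      one_le_mul_of_one_le_of_one_le (by exact_mod_cast hm) (one_le_pow₀ hQ')
    have hexp : k * r ≤ (r + 1) * k.factorial := by
      rw [mul_comm]
      exact Nat.mul_le_mul (Nat.le_succ r) k.self_le_factorial
    have hexp' : ((k * r : ℕ) : ℝ) ≤ (r + 1) * k.factorial := by exact_mod_cast hexp
    calc (N : ℝ) ^ ((1 : ℝ) / ((r + 1) * k.factorial))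
        ≤ ((m * (Q : ℝ) ^ r) ^ (k * r)) ^ ((1 : ℝ) / ((r + 1) * k.factorial)) :=
          Real.rpow_le_rpow (by positivity) (by exact_mod_cast h) (by positivity)
      _ = (m * (Q : ℝ) ^ r) ^ (((k * r : ℕ) : ℝ) * (1 / ((r + 1) * k.factorial))) := by
          rw [Real.rpow_mul (by positivity), Real.rpow_natCast]
      _ ≤ (m * (Q : ℝ) ^ r) ^ (1 : ℝ) := by
          refine Real.rpow_le_rpow_of_exponent_le hb ?_
          rw [mul_one_div]
          exact (div_le_one he).2 hexp'
      _ ≤ m * (Q : ℝ) ^ (3 * r) := by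
          rw [Real.rpow_one]
          gcongr
          omega

theorem Subspace.dualAnnihilator_finset_inf {F V : Type*} [Field F] [AddCommGroup V] [Module F V]
    [FiniteDimensional F V] (T : Finset (Submodule F V)) :
    (T.inf id).dualAnnihilator = T.sup Submodule.dualAnnihilator := by
  classical
  induction T using Finset.induction_on with
  | empty => simp
  | insert W T _ ih => rw [Finset.inf_insert, Finset.sup_insert, id, ← ih,
      Subspace.dualAnnihilator_inf_eq]

/-- The members of a finite family whose annihilators are independent modulo `A` form a generic
family with respect to the coannihilator of `A`. -/
theorem IsIndependentModulo.isGeneric {F V : Type*} [Field F] [AddCommGroup V] [Module F V]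
    [FiniteDimensional F V] {t d : ℕ} (ht : 1 ≤ t) {A : Submodule F (Dual F V)}
    {M : Finset (Submodule F (Dual F V))} (hM : IsIndependentModulo t d A M)
    {𝒮 : Set (Submodule F V)} (h𝒮 : ∀ W ∈ 𝒮, W.dualAnnihilator ∈ M) :
    IsGeneric F V t d A.dualCoannihilator 𝒮 := by
  classical
  intro T hT hTt
  have hcard : (T.image Submodule.dualAnnihilator).card = t := by
    rw [Finset.card_image_of_injective _ fun _ _ => Subspace.dualAnnihilator_inj.1, hTt]
  have hTM : T.image Submodule.dualAnnihilator ⊆ M := by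
    intro U hU
    obtain ⟨W, hW, rfl⟩ := Finset.mem_image.1 hU
    exact h𝒮 W (hT hW)
  have hdim := hM.2 _ hTM hcard.le
  obtain ⟨W, hW⟩ : T.Nonempty := Finset.card_pos.1 (by omega)
  have hA : A ≤ T.sup Submodule.dualAnnihilator :=
    (hM.1 _ (h𝒮 W (hT hW))).1.trans (Finset.le_sup (f := Submodule.dualAnnihilator) hW)
  rw [Finset.sup_image, Function.id_comp, sup_eq_right.2 hA,
    ← Subspace.dualAnnihilator_finset_inf, hcard] at hdim
  have h₁ := Subspace.finrank_add_finrank_dualAnnihilator_eq (T.inf id)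
  have h₂ := Subspace.finrank_add_finrank_dualCoannihilator_eq A
  omega

/-- Lemma 5.14, extracting a large generic subfamily.  Any family `𝒮` of
`N` subspaces of codimension `r` in `V` contains a subfamily `𝒮'` of size at least
`N^(1/((r+1)(t-1)!)) / q^(3r)`, all members of which lie in a common subspace `V' ⊆ V` with
the same codimension `s ≤ r` with respect to `V'`, and which is `t`-generic with respect to
`V'`. -/
theorem stmt7 (F : Type) [Field F] [Fintype F]
    (V : Type) [AddCommGroup V] [Module F V] [FiniteDimensional F V]
    (r t N : ℕ) (hr : 1 ≤ r) (ht : 2 ≤ t)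
    (𝒮 : Finset (Submodule F V)) (hcard : 𝒮.card = N)
    (hcodim : ∀ W ∈ 𝒮, finrank F ↥W + r = finrank F V) :
    ∃ (V' : Submodule F V) (s : ℕ) (𝒮' : Finset (Submodule F V)),
      𝒮' ⊆ 𝒮 ∧ s ≤ r ∧
      (N : ℝ) ^ ((1 : ℝ) / ((r + 1) * (Nat.factorial (t - 1)))) /
          (Fintype.card F : ℝ) ^ (3 * r) ≤ (𝒮'.card : ℝ) ∧
      (∀ W ∈ 𝒮', W ≤ V' ∧ finrank F ↥W + s = finrank F ↥V') ∧
      IsGeneric F V t s V' ↑𝒮' := by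
  classical
  obtain ⟨k, rfl⟩ : ∃ k, t = k + 1 := ⟨t - 1, by omega⟩
  have hk : 1 ≤ k := by omega
  let D : Finset (Submodule F (Dual F V)) := 𝒮.image Submodule.dualAnnihilator
  have hinj : Function.Injective (Submodule.dualAnnihilator (R := F) (M := V)) :=
    fun _ _ => Subspace.dualAnnihilator_inj.1
  have hD : ∀ U ∈ D, (⊥ : Submodule F (Dual F V)) ≤ U ∧ finrank F U = r := by
    intro U hU
    obtain ⟨W, hW, rfl⟩ := Finset.mem_image.1 hU
    have h₁ := Subspace.finrank_add_finrank_dualAnnihilator_eq W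
    have h₂ := hcodim W hW
    exact ⟨bot_le, by omega⟩
  obtain ⟨M, hM, hMmax⟩ := Finset.exists_max_image
    (D.powerset.filter fun M => ∃ (A : Submodule F (Dual F V)) (d : ℕ),
      finrank F A + d = r ∧ IsIndependentModulo (k + 1) d A M) Finset.card
    ⟨∅, Finset.mem_filter.2 ⟨Finset.empty_mem_powerset D, ⊥, r, by simp, .empty _ _ _⟩⟩
  rw [Finset.mem_filter, Finset.mem_powerset] at hM
  obtain ⟨hMD, A, d, hA, hMi⟩ := hM
  have hbound := card_le_of_isIndependentModulo_card_le hk r ⊥ D (by simp) hD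
    (m := M.card) fun A' d' M' hM' hA' hi => hMmax M' (Finset.mem_filter.2
      ⟨Finset.mem_powerset.2 hM', A', d', hA', hi⟩)
  rw [Finset.card_image_of_injective _ hinj, hcard] at hbound
  have hM𝒮 : (𝒮.filter fun W => W.dualAnnihilator ∈ M).image Submodule.dualAnnihilator = M := by
    rw [← Finset.filter_image (p := (· ∈ M)), Finset.filter_mem_eq_inter, Finset.inter_eq_right]
    exact hMD
  refine ⟨A.dualCoannihilator, d, 𝒮.filter fun W => W.dualAnnihilator ∈ M,
    Finset.filter_subset _ _, by omega, ?_, ?_, ?_⟩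
  · rw [← Finset.card_image_of_injective _ hinj, hM𝒮]
    exact rpow_div_le_of_le_pow Fintype.card_pos hr hk hbound
  · intro W hW
    obtain ⟨hW𝒮, hWM⟩ := Finset.mem_filter.1 hW
    refine ⟨(Submodule.le_dualAnnihilator_iff_le_dualCoannihilator).1 (hMi.1 _ hWM).1, ?_⟩
    have h₁ := Subspace.finrank_add_finrank_dualCoannihilator_eq A
    have h₂ := hcodim W hW𝒮
    omega
  · exact hMi.isGeneric (by omega) fun W hW => (Finset.mem_filter.1 hW).2
end

section
/- Let q be a prime power, V a finite-dimensional F_q-vector space, r ≥ 1 and j ≥ 2 integers, and let 𝒮 = {W₁, …, W_N} be a set of N subspaces of V of codimension r that is j-generic with respect to V. Then there is a subset of 𝒮 of size at least N^{1/j}/q^r that is (j+1)-generic with respect to V. -/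
open Module

section

variable {F V : Type*} [Field F] [AddCommGroup V] [Module F V] [FiniteDimensional F V]

theorem finrank_le_finrank_finsetInf_add {r : ℕ} (T : Finset (Submodule F V))
    (hT : ∀ W ∈ T, finrank F W + r = finrank F V) :
    finrank F V ≤ finrank F ↥(T.inf id) + T.card * r := by
  classical
  induction T using Finset.induction_on with
  | empty => rw [Finset.inf_empty, finrank_top]; omega
  | insert W T hW ih =>
    have h1 := ih fun U hU => hT U (Finset.mem_insert_of_mem hU)
    have h2 := hT W (Finset.mem_insert_self W T)
    have h3 := Submodule.finrank_sup_add_finrank_inf_eq W (T.inf id)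
    have h4 := Submodule.finrank_le (W ⊔ T.inf id)
    rw [Finset.inf_insert, Finset.card_insert_of_notMem hW, add_mul, id]
    omega

theorem IsGeneric.sup_eq_top {r j : ℕ} (hj : 2 ≤ j) {𝒮 : Finset (Submodule F V)}
    (hcard : j ≤ 𝒮.card) (hcodim : ∀ W ∈ 𝒮, finrank F W + r = finrank F V)
    (hgen : IsGeneric F V j r ⊤ ↑𝒮) {W₁ W₂ : Submodule F V} (h₁ : W₁ ∈ 𝒮) (h₂ : W₂ ∈ 𝒮)
    (hne : W₁ ≠ W₂) : W₁ ⊔ W₂ = ⊤ := by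
  classical
  by_contra hsup
  have hpair : ({W₁, W₂} : Finset (Submodule F V)) ⊆ 𝒮 := by
    simp [Finset.insert_subset_iff, h₁, h₂]
  have hpair_card : ({W₁, W₂} : Finset (Submodule F V)).card = 2 := Finset.card_pair hne
  obtain ⟨T, hpT, hT𝒮, hTj⟩ :=
    Finset.exists_subsuperset_card_eq hpair (hpair_card.trans_le hj) hcard
  have hT := hgen T (by exact_mod_cast hT𝒮) hTj
  rw [finrank_top] at hT
  have hrest := finrank_le_finrank_finsetInf_add (T \ {W₁, W₂})
    fun W hW => hcodim W (hT𝒮 (Finset.mem_sdiff.1 hW).1)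
  have hrest_card : (T \ {W₁, W₂}).card + 2 = j := by
    rw [← hpair_card, Finset.card_sdiff_add_card_eq_card hpT, hTj]
  have hinf : T.inf id = (T \ {W₁, W₂}).inf id ⊓ (W₁ ⊓ W₂) := by
    conv_lhs => rw [← Finset.sdiff_union_of_subset hpT]
    rw [Finset.inf_union, Finset.inf_insert, Finset.inf_singleton, id, id]
  have h3 := Submodule.finrank_sup_add_finrank_inf_eq ((T \ {W₁, W₂}).inf id) (W₁ ⊓ W₂)
  have h4 := Submodule.finrank_le ((T \ {W₁, W₂}).inf id ⊔ (W₁ ⊓ W₂))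
  have h5 := Submodule.finrank_sup_add_finrank_inf_eq W₁ W₂
  have h6 := Submodule.finrank_lt hsup
  have h7 := hcodim W₁ h₁
  have h8 := hcodim W₂ h₂
  rw [← hinf] at h3
  rw [← hrest_card, add_mul] at hT
  omega

theorem IsGeneric.exists_dual_of_not_insert {r j : ℕ} [DecidableEq (Submodule F V)]
    {𝒮 𝒯 : Finset (Submodule F V)}
    (hcodim : ∀ W ∈ 𝒮, finrank F W + r = finrank F V)
    (hgen : IsGeneric F V j r ⊤ ↑𝒮) (h𝒯 : 𝒯 ⊆ 𝒮) (h𝒯gen : IsGeneric F V (j + 1) r ⊤ ↑𝒯)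
    {W : Submodule F V} (hW : W ∈ 𝒮) (hins : ¬ IsGeneric F V (j + 1) r ⊤ ↑(insert W 𝒯)) :
    ∃ f : Dual F V, f ≠ 0 ∧ W ≤ f.ker ∧ ∃ T ∈ 𝒯.powersetCard j, T.inf id ≤ f.ker := by
  unfold IsGeneric at hins
  push Not at hins
  obtain ⟨s, hs, hsj, hdim⟩ := hins
  replace hs : s ⊆ insert W 𝒯 := by exact_mod_cast hs
  have hWs : W ∈ s := by
    by_contra hWs
    exact hdim (h𝒯gen s (by exact_mod_cast (Finset.subset_insert_iff_of_notMem hWs).1 hs) hsj)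
  have hT𝒯 : s.erase W ⊆ 𝒯 := Finset.subset_insert_iff.1 hs
  have hTj : (s.erase W).card = j := by rw [Finset.card_erase_of_mem hWs, hsj]; rfl
  have hTdim := hgen (s.erase W) (by exact_mod_cast hT𝒯.trans h𝒯) hTj
  have hsup : W ⊔ (s.erase W).inf id < ⊤ := by
    refine lt_top_iff_ne_top.2 fun hsup => hdim ?_
    have h1 := Submodule.finrank_sup_add_finrank_inf_eq W ((s.erase W).inf id)
    have h2 := hcodim W hW
    have hinf : s.inf id = W ⊓ (s.erase W).inf id := by
      conv_lhs => rw [← Finset.insert_erase hWs]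
      simp [Finset.inf_insert]
    rw [hsup, ← hinf] at h1
    rw [finrank_top] at h1 hTdim ⊢
    rw [add_mul]
    omega
  obtain ⟨f, hf, hker⟩ := Submodule.exists_le_ker_of_lt_top _ hsup
  exact ⟨f, hf, le_sup_left.trans hker, s.erase W, Finset.mem_powersetCard.2 ⟨hT𝒯, hTj⟩,
    le_sup_right.trans hker⟩

theorem natCard_dualAnnihilator_of_finrank_add [Fintype F] {k : ℕ} {U : Submodule F V}
    (hU : finrank F U + k = finrank F V) :
    Nat.card U.dualAnnihilator = Fintype.card F ^ k := by
  have h := Subspace.finrank_add_finrank_dualAnnihilator_eq U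
  rw [Module.natCard_eq_pow_finrank (K := F), Nat.card_eq_fintype_card,
    show finrank F U.dualAnnihilator = k by omega]

theorem IsGeneric.exists_card_le_pow [Fintype F] {r j : ℕ} (hj : 2 ≤ j)
    {𝒮 : Finset (Submodule F V)} (hcard : j ≤ 𝒮.card)
    (hcodim : ∀ W ∈ 𝒮, finrank F W + r = finrank F V) (hgen : IsGeneric F V j r ⊤ ↑𝒮) :
    ∃ 𝒯 ⊆ 𝒮, 𝒮.card ≤ (𝒯.card * Fintype.card F ^ r) ^ j ∧ IsGeneric F V (j + 1) r ⊤ ↑𝒯 := by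
  classical
  obtain ⟨𝒯, h𝒯, hmax⟩ := Finset.exists_max_image
    (𝒮.powerset.filter fun 𝒯 : Finset (Submodule F V) => IsGeneric F V (j + 1) r ⊤ ↑𝒯) Finset.card
    ⟨∅, by
      simp only [Finset.mem_filter, Finset.empty_mem_powerset, true_and]
      intro s hs hsj
      rw [Finset.coe_empty, Set.subset_empty_iff, Finset.coe_eq_empty] at hs
      simp [hs] at hsj⟩
  simp only [Finset.mem_filter, Finset.mem_powerset] at h𝒯 hmax
  obtain ⟨h𝒯𝒮, h𝒯gen⟩ := h𝒯
  refine ⟨𝒯, h𝒯𝒮, ?_, h𝒯gen⟩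
  have hex : ∀ W ∈ 𝒮 \ 𝒯, ∃ f : Dual F V, f ≠ 0 ∧ W ≤ f.ker ∧
      ∃ T ∈ 𝒯.powersetCard j, T.inf id ≤ f.ker := by
    intro W hW
    obtain ⟨hW𝒮, hW𝒯⟩ := Finset.mem_sdiff.1 hW
    refine hgen.exists_dual_of_not_insert hcodim h𝒯𝒮 h𝒯gen hW𝒮 fun hins => ?_
    have := hmax _ ⟨Finset.insert_subset hW𝒮 h𝒯𝒮, hins⟩
    rw [Finset.card_insert_of_notMem hW𝒯] at this
    omega
  choose! f hf0 hfW hfT using hex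
  have : Finite (Dual F V) := Module.finite_of_finite F
  have : Fintype (Dual F V) := Fintype.ofFinite _
  let A (T : Finset (Submodule F V)) : Finset (Dual F V) :=
    (Finset.univ.filter (· ∈ (T.inf id).dualAnnihilator)).erase 0
  have hA : ∀ T ∈ 𝒯.powersetCard j, (A T).card ≤ Fintype.card F ^ (j * r) - 1 := by
    intro T hT
    obtain ⟨hT𝒯, hTj⟩ := Finset.mem_powersetCard.1 hT
    have h1 := hgen T (by exact_mod_cast hT𝒯.trans h𝒯𝒮) hTj
    rw [finrank_top] at h1
    rw [Finset.card_erase_of_mem (by simp), ← natCard_dualAnnihilator_of_finrank_add h1,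
      Nat.card_eq_fintype_card, ← Fintype.card_subtype]
  have hmaps : Set.MapsTo f ↑(𝒮 \ 𝒯) ↑((𝒯.powersetCard j).biUnion A) := by
    intro W hW
    obtain ⟨T, hT, hle⟩ := hfT W hW
    refine Finset.mem_biUnion.2 ⟨T, hT, Finset.mem_erase.2 ⟨hf0 W hW, ?_⟩⟩
    simpa [Submodule.mem_dualAnnihilator] using fun w hw => hle hw
  have hinj : Set.InjOn f ↑(𝒮 \ 𝒯) := by
    intro W₁ h₁ W₂ h₂ heq
    by_contra hne
    have htop := hgen.sup_eq_top hj hcard hcodim (Finset.mem_sdiff.1 h₁).1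
      (Finset.mem_sdiff.1 h₂).1 hne
    have hle : W₁ ⊔ W₂ ≤ (f W₁).ker := sup_le (hfW W₁ h₁) (heq ▸ hfW W₂ h₂)
    rw [htop, top_le_iff, LinearMap.ker_eq_top] at hle
    exact hf0 W₁ h₁ hle
  have hcount := (Finset.card_le_card_of_injOn f hmaps hinj).trans
    (Finset.card_biUnion_le_card_mul _ _ _ hA)
  rw [Finset.card_powersetCard] at hcount
  have hsplit := Finset.card_sdiff_add_card_eq_card h𝒯𝒮
  have hq : 1 ≤ Fintype.card F ^ (j * r) := Nat.one_le_pow _ _ Fintype.card_pos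
  calc 𝒮.card ≤ 𝒯.card ^ j * (Fintype.card F ^ (j * r) - 1) + 𝒯.card ^ j := by
        rw [← hsplit]
        gcongr
        · exact hcount.trans (Nat.mul_le_mul_right _ (Nat.choose_le_pow _ _))
        · exact Nat.le_self_pow (by omega) _
    _ = 𝒯.card ^ j * Fintype.card F ^ (j * r) := by
        rw [← Nat.mul_succ, Nat.succ_eq_add_one, Nat.sub_add_cancel hq]
    _ = (𝒯.card * Fintype.card F ^ r) ^ j := by rw [mul_pow, ← pow_mul, mul_comm r]

end

/-- Lemma 5.15.  Any `j`-generic (with respect to `V`) family of `N`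
subspaces of codimension `r` contains a `(j+1)`-generic subfamily of size at least
`N^(1/j) / q^r`. -/
theorem stmt8 (F : Type) [Field F] [Fintype F]
    (V : Type) [AddCommGroup V] [Module F V] [FiniteDimensional F V]
    (r j N : ℕ) (hr : 1 ≤ r) (hj : 2 ≤ j)
    (𝒮 : Finset (Submodule F V)) (hcard : 𝒮.card = N)
    (hcodim : ∀ W ∈ 𝒮, finrank F ↥W + r = finrank F V)
    (hgen : IsGeneric F V j r ⊤ ↑𝒮) :
    ∃ 𝒮' : Finset (Submodule F V), 𝒮' ⊆ 𝒮 ∧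
      (N : ℝ) ^ ((1 : ℝ) / j) / (Fintype.card F : ℝ) ^ r ≤ (𝒮'.card : ℝ) ∧
      IsGeneric F V (j + 1) r ⊤ ↑𝒮' := by
  subst hcard
  have hq : 0 < Fintype.card F := Fintype.card_pos
  obtain ⟨𝒯, h𝒯, hle, h𝒯gen⟩ : ∃ 𝒯 ⊆ 𝒮, 𝒮.card ≤ (𝒯.card * Fintype.card F ^ r) ^ j ∧
      IsGeneric F V (j + 1) r ⊤ ↑𝒯 := by
    rcases le_or_gt j 𝒮.card with hN | hN
    · exact hgen.exists_card_le_pow hj hN hcodim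
    · refine ⟨𝒮, subset_rfl, ?_, fun s hs hsj => ?_⟩
      · exact (Nat.le_mul_of_pos_right _ (pow_pos hq r)).trans (Nat.le_self_pow (by omega) _)
      · have := Finset.card_le_card (Finset.coe_subset.1 hs)
        omega
  refine ⟨𝒯, h𝒯, ?_, h𝒯gen⟩
  rw [div_le_iff₀ (by positivity), one_div,
    Real.rpow_inv_le_iff_of_pos (by positivity) (by positivity) (by positivity),
    Real.rpow_natCast]
  exact_mod_cast hle
end

section
/- Let q be a prime power, V a finite-dimensional F_q-vector space, r ≥ 1, and let {W₁, …, W_N} be a set of N distinct subspaces of V of codimension r with respect to V. Then there exists a subspace V' ⊆ V, an integer 1 ≤ s ≤ r, and a subset of at least m ≥ N^{1/(r+1)}/q^r of the subspaces, say {W₁, …, W_m}, all contained in V', such that each W_i (1 ≤ i ≤ m) has codimension exactly s with respect to V', and each intersection W_i ∩ W_j (1 ≤ i ≠ j ≤ m) has codimension exactly 2s with respect to V'. -/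
open Module

/-- The members of `𝒯` are subspaces of `V'` of codimension `s`, any two distinct ones of which
meet in codimension `2 * s`; equivalently, their annihilators form a sunflower. -/
structure IsDualSunflower {F V : Type*} [Field F] [AddCommGroup V] [Module F V]
    (V' : Submodule F V) (s : ℕ) (𝒯 : Finset (Submodule F V)) : Prop where
  mem : ∀ W ∈ 𝒯, W ≤ V' ∧ finrank F ↥W + s = finrank F ↥V'
  pair : ∀ W₁ ∈ 𝒯, ∀ W₂ ∈ 𝒯, W₁ ≠ W₂ → finrank F ↥(W₁ ⊓ W₂) + 2 * s = finrank F ↥V'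

section

variable {F V : Type*} [Field F] [AddCommGroup V] [Module F V]

theorem IsDualSunflower.empty (V' : Submodule F V) (s : ℕ) : IsDualSunflower V' s ∅ :=
  ⟨by simp, by simp⟩

variable [FiniteDimensional F V]

/-- A proper subspace `U` of `V'` lies in a hyperplane of `V'` cut out by a functional
vanishing on `U`. -/
theorem Submodule.exists_dualAnnihilator_finrank_inf_ker {U V' : Submodule F V} (h : U < V') :
    ∃ f ∈ U.dualAnnihilator, U ≤ V' ⊓ LinearMap.ker f ∧
      finrank F ↥(V' ⊓ LinearMap.ker f) + 1 = finrank F ↥V' := by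
  obtain ⟨v, hv, hvU⟩ := SetLike.exists_of_lt h
  obtain ⟨f, hfv, hf⟩ := Submodule.exists_le_ker_of_notMem hvU
  refine ⟨f, (Submodule.mem_dualAnnihilator f).2 fun w hw => hf hw, le_inf h.le hf, ?_⟩
  have hne : f ∘ₗ V'.subtype ≠ 0 := fun h0 => hfv (LinearMap.congr_fun h0 ⟨v, hv⟩)
  have h1 := Module.Dual.finrank_ker_add_one_of_ne_zero hne
  rw [← h1, LinearMap.ker_comp, ← Submodule.map_comap_subtype,
    Submodule.finrank_map_subtype_eq]

/-- A subspace of codimension `s > 0` in `V'` meets some member of a maximal family in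
larger dimension than the generic one. -/
theorem IsDualSunflower.exists_sup_lt {V' : Submodule F V} {s : ℕ}
    {𝒯 : Finset (Submodule F V)} (h𝒯 : IsDualSunflower V' s 𝒯) (hs : 0 < s)
    {W : Submodule F V} (hW : W ≤ V') (hWs : finrank F ↥W + s = finrank F ↥V')
    (hmax : ∀ 𝒯', IsDualSunflower V' s 𝒯' → (∀ U ∈ 𝒯', U = W ∨ U ∈ 𝒯) → 𝒯'.card ≤ 𝒯.card) :
    ∃ U ∈ 𝒯, W ⊔ U < V' := by
  classical
  by_contra! hcon
  have hsup : ∀ U ∈ 𝒯, W ⊔ U = V' := fun U hU =>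
    (sup_le hW (h𝒯.mem U hU).1).eq_of_not_lt (hcon U hU)
  have hWT : W ∉ 𝒯 := fun h => by
    have := hsup W h
    rw [sup_idem] at this
    subst this
    omega
  have hpair : ∀ U ∈ 𝒯, finrank F ↥(W ⊓ U) + 2 * s = finrank F ↥V' := fun U hU => by
    have h1 := Submodule.finrank_sup_add_finrank_inf_eq W U
    rw [hsup U hU] at h1
    have h2 := (h𝒯.mem U hU).2
    omega
  have hins : IsDualSunflower V' s (insert W 𝒯) := by
    refine ⟨fun U hU => ?_, fun U₁ h₁ U₂ h₂ hne => ?_⟩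
    · rcases Finset.mem_insert.1 hU with rfl | hU
      exacts [⟨hW, hWs⟩, h𝒯.mem U hU]
    · rcases Finset.mem_insert.1 h₁ with rfl | hU₁ <;>
        rcases Finset.mem_insert.1 h₂ with rfl | hU₂
      · exact absurd rfl hne
      · exact hpair U₂ hU₂
      · rw [inf_comm]
        exact hpair U₁ hU₁
      · exact h𝒯.pair U₁ hU₁ U₂ hU₂ hne
  have := hmax _ hins fun U hU => Finset.mem_insert.1 hU
  rw [Finset.card_insert_of_notMem hWT] at this
  omega

/-- The sunflower bound for subspaces of codimension `s` in `V'` and `r` in `V`. -/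
theorem card_le_of_isDualSunflower_card_le [Finite F] {r k : ℕ} (s : ℕ) (V' : Submodule F V)
    (𝒮 : Finset (Submodule F V)) (hr : ∀ W ∈ 𝒮, finrank F ↥W + r = finrank F V)
    (hs : ∀ W ∈ 𝒮, W ≤ V' ∧ finrank F ↥W + s = finrank F ↥V')
    (hk : ∀ (U : Submodule F V) (t : ℕ) (𝒯 : Finset (Submodule F V)), 𝒯 ⊆ 𝒮 → 1 ≤ t → t ≤ s →
      IsDualSunflower U t 𝒯 → 𝒯.card ≤ k) :
    𝒮.card ≤ (k * Nat.card F ^ r) ^ s := by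
  classical
  induction s generalizing V' 𝒮 with
  | zero =>
    rw [pow_zero, Finset.card_le_one]
    intro A hA B hB
    rw [Submodule.eq_of_le_of_finrank_eq (hs A hA).1 (hs A hA).2,
      Submodule.eq_of_le_of_finrank_eq (hs B hB).1 (hs B hB).2]
  | succ s ih =>
    obtain ⟨𝒯, h𝒯, hmax⟩ := Finset.exists_max_image
      (𝒮.powerset.filter fun 𝒯 => IsDualSunflower V' (s + 1) 𝒯) Finset.card
      ⟨∅, by simp [IsDualSunflower.empty]⟩
    simp only [Finset.mem_filter, Finset.mem_powerset] at h𝒯 hmax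
    have : Finite (Module.Dual F V) := Module.finite_of_finite F
    let := Fintype.ofFinite (Module.Dual F V)
    let A : Submodule F V → Finset (Module.Dual F V) := fun U =>
      Finset.univ.filter fun f => f ∈ U.dualAnnihilator ∧
        finrank F ↥(V' ⊓ LinearMap.ker f) + 1 = finrank F ↥V'
    let B : Module.Dual F V → Finset (Submodule F V) := fun f =>
      𝒮.filter fun W => W ≤ V' ⊓ LinearMap.ker f
    have hA : ∀ U ∈ 𝒯, (A U).card ≤ Nat.card F ^ r := fun U hU => by
      have h1 : finrank F ↥U.dualAnnihilator = r := by
        have h2 := Subspace.finrank_add_finrank_dualAnnihilator_eq U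
        have h3 := hr U (h𝒯.1 hU)
        omega
      rw [← h1, ← Module.natCard_eq_pow_finrank (K := F) (V := U.dualAnnihilator),
        ← SetLike.coe_sort_coe, Nat.card_coe_set_eq, ← Set.ncard_coe_finset]
      refine Set.ncard_le_ncard (fun f hf => ?_) (Set.toFinite _)
      simp only [A, Finset.coe_filter, Set.mem_ofPred_eq] at hf
      exact hf.2.1
    have hB : ∀ U, ∀ f ∈ A U, (B f).card ≤ (k * Nat.card F ^ r) ^ s := fun U f hf => by
      simp only [A, Finset.mem_filter] at hf
      refine ih (V' ⊓ LinearMap.ker f) (B f) (fun W hW => hr W (Finset.filter_subset _ _ hW))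
        (fun W hW => ?_) fun U' t 𝒯' h1 h2 h3 h4 =>
          hk U' t 𝒯' (h1.trans (Finset.filter_subset _ _)) h2 (by omega) h4
      obtain ⟨hW, hWf⟩ := Finset.mem_filter.1 hW
      have := (hs W hW).2
      exact ⟨hWf, by omega⟩
    have hcover : 𝒮 ⊆ 𝒯.biUnion fun U => (A U).biUnion B := fun W hW => by
      obtain ⟨U, hU, hlt⟩ := h𝒯.2.exists_sup_lt s.succ_pos (hs W hW).1 (hs W hW).2
        fun 𝒯' h1 h2 => hmax 𝒯' ⟨fun X hX => (h2 X hX).elim (fun h => h ▸ hW) (h𝒯.1 ·), h1⟩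
      obtain ⟨f, hf, hle, hfin⟩ := Submodule.exists_dualAnnihilator_finrank_inf_ker hlt
      simp only [Finset.mem_biUnion, A, B, Finset.mem_filter, Finset.mem_univ, true_and]
      exact ⟨U, hU, f, ⟨Submodule.dualAnnihilator_anti le_sup_right hf, hfin⟩, hW,
        le_sup_left.trans hle⟩
    calc 𝒮.card ≤ (𝒯.biUnion fun U => (A U).biUnion B).card := Finset.card_le_card hcover
      _ ≤ 𝒯.card * (Nat.card F ^ r * (k * Nat.card F ^ r) ^ s) :=
        Finset.card_biUnion_le_card_mul _ _ _ fun U hU =>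
          (Finset.card_biUnion_le_card_mul _ _ _ (hB U)).trans
            (Nat.mul_le_mul_right _ (hA U hU))
      _ ≤ k * (Nat.card F ^ r * (k * Nat.card F ^ r) ^ s) :=
        Nat.mul_le_mul_right _ (hk V' (s + 1) 𝒯 h𝒯.1 (by omega) le_rfl h𝒯.2)
      _ = (k * Nat.card F ^ r) ^ (s + 1) := by ring

end

/-- Corollary 5.17.  Given `N` distinct subspaces of codimension `r` in
`V`, there are a subspace `V' ⊆ V`, an integer `1 ≤ s ≤ r`, and at least
`N^(1/(r+1))/q^r` of the subspaces, all contained in `V'`, each of codimension exactly `s`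
with respect to `V'`, with all pairwise intersections of codimension exactly `2s` with
respect to `V'`. -/
theorem stmt10 (F : Type) [Field F] [Fintype F]
    (V : Type) [AddCommGroup V] [Module F V] [FiniteDimensional F V]
    (r N : ℕ) (hr : 1 ≤ r)
    (𝒮 : Finset (Submodule F V)) (hcard : 𝒮.card = N)
    (hcodim : ∀ W ∈ 𝒮, finrank F ↥W + r = finrank F V) :
    ∃ (V' : Submodule F V) (s : ℕ) (𝒯 : Finset (Submodule F V)),
      𝒯 ⊆ 𝒮 ∧ 1 ≤ s ∧ s ≤ r ∧
      (N : ℝ) ^ ((1 : ℝ) / (r + 1)) / (Fintype.card F : ℝ) ^ r ≤ (𝒯.card : ℝ) ∧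
      (∀ W ∈ 𝒯, W ≤ V' ∧ finrank F ↥W + s = finrank F ↥V') ∧
      (∀ W₁ ∈ 𝒯, ∀ W₂ ∈ 𝒯, W₁ ≠ W₂ →
        finrank F ↥(W₁ ⊓ W₂) + 2 * s = finrank F ↥V') := by
  classical
  subst hcard
  by_contra! hcon
  have hsmall : ∀ (U : Submodule F V) (t : ℕ) (𝒯 : Finset (Submodule F V)), 𝒯 ⊆ 𝒮 → 1 ≤ t →
      t ≤ r → IsDualSunflower U t 𝒯 →
        (𝒯.card : ℝ) < (𝒮.card : ℝ) ^ ((1 : ℝ) / (r + 1)) / (Fintype.card F : ℝ) ^ r := by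
    intro U t 𝒯 h1 h2 h3 h4
    by_contra! h5
    obtain ⟨W₁, hW₁, W₂, hW₂, hne, h6⟩ := hcon U t 𝒯 h1 h2 h3 h5 h4.mem
    exact h6 (h4.pair W₁ hW₁ W₂ hW₂ hne)
  obtain ⟨𝒯, h𝒯, hmax⟩ := Finset.exists_max_image
    (𝒮.powerset.filter fun 𝒯 => ∃ U t, 1 ≤ t ∧ t ≤ r ∧ IsDualSunflower U t 𝒯) Finset.card
    ⟨∅, by simpa using ⟨⊤, 1, le_rfl, hr, IsDualSunflower.empty ⊤ 1⟩⟩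
  simp only [Finset.mem_filter, Finset.mem_powerset] at h𝒯 hmax
  obtain ⟨hsub, U, t, h1, h2, h3⟩ := h𝒯
  have hlt := hsmall U t 𝒯 hsub h1 h2 h3
  have hq : 0 < Fintype.card F := Fintype.card_pos
  have hbound : 𝒮.card ≤ (𝒯.card * Nat.card F ^ r) ^ r :=
    card_le_of_isDualSunflower_card_le r ⊤ 𝒮 hcodim
      (fun W hW => ⟨le_top, by rw [finrank_top]; exact hcodim W hW⟩)
      fun U' t' 𝒯' g1 g2 g3 g4 => hmax 𝒯' ⟨g1, U', t', g2, g3, g4⟩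
  rw [Nat.card_eq_fintype_card] at hbound
  have hbound' : 𝒮.card ≤ (𝒯.card * Fintype.card F ^ r) ^ (r + 1) := by
    rcases Nat.eq_zero_or_pos (𝒯.card * Fintype.card F ^ r) with h0 | h0
    · rw [h0, zero_pow (by omega)] at hbound
      omega
    · exact hbound.trans (Nat.pow_le_pow_right h0 r.le_succ)
  rw [lt_div_iff₀ (by positivity)] at hlt
  refine hlt.not_ge ?_
  rw [one_div, Real.rpow_inv_le_iff_of_pos (by positivity) (by positivity) (by positivity)]
  exact_mod_cast hbound'
end

section
/- Let q be a prime power, V a finite-dimensional F_q-vector space, Q ⊆ V a subspace of dimension a, and 𝒮 = {W₁, …, W_m} a set of m subspaces of V, each of codimension r, all containing Q, that is 2-generic with respect to V. Let j be an integer with a ≤ j, j + 2r ≤ dim(V), and dim(V) ≥ 2^{100}·q^j. For L ∈ Zoom_j[Q, V] let N_𝒮(L) = |{W ∈ 𝒮 : L ⊆ W}|, and let p₁ = Pr_{L ∈ Zoom_j[Q,V]}[L ⊆ W] for an arbitrary fixed W ∈ 𝒮 (this probability does not depend on the choice of W). Then, over a uniformly random L ∈ Zoom_j[Q, V], the expectation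 of N_𝒮(L) equals p₁·m and the variance of N_𝒮(L) is at most p₁·m. -/
open Module

theorem sigma_tuple_ext {F V ι : Type*} [Field F] [AddCommGroup V] [Module F V]
    {P : Submodule F V → Prop}
    {x y : Σ L : {L : Submodule F V // P L}, {s : ι → L.1 // LinearIndependent F s}}
    (h : x.1.1 = y.1.1) (hs : ∀ i, (x.2.1 i : V) = y.2.1 i) : x = y := by
  obtain ⟨⟨L, hL⟩, s, hs'⟩ := x
  obtain ⟨⟨L', hL'⟩, t, ht⟩ := y
  obtain rfl : L = L' := h
  obtain rfl : s = t := funext fun i => Subtype.ext (hs i)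
  rfl

/-- Linearly independent `k`-tuples of a subspace, sorted by the subspace they span. -/
noncomputable def linearIndependentEquivSigma {F V : Type*} [Field F] [AddCommGroup V]
    [Module F V] [FiniteDimensional F V] (k : ℕ) (U : Submodule F V) :
    {s : Fin k → U // LinearIndependent F s} ≃
      Σ L : {L : Submodule F V // finrank F L = k ∧ L ≤ U},
        {s : Fin k → L.1 // LinearIndependent F s} where
  toFun s := 
    ⟨⟨Submodule.span F (Set.range fun i => (s.1 i : V)), by
        have h : LinearIndependent F (fun i => (s.1 i : V)) :=
          s.2.map' U.subtype U.ker_subtype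
        simpa using finrank_span_eq_card h, by
        rw [Submodule.span_le]
        rintro _ ⟨i, rfl⟩
        exact (s.1 i).2⟩,
      ⟨fun i => ⟨s.1 i, Submodule.subset_span ⟨i, rfl⟩⟩, by
        have h : LinearIndependent F (fun i => (s.1 i : V)) :=
          s.2.map' U.subtype U.ker_subtype
        exact LinearIndependent.of_comp (Submodule.subtype _) h⟩⟩
  invFun t := ⟨fun i => ⟨t.2.1 i, t.1.2.2 (t.2.1 i).2⟩, by
    have h : LinearIndependent F (fun i => (t.2.1 i : V)) :=
      t.2.2.map' t.1.1.subtype t.1.1.ker_subtype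
    exact LinearIndependent.of_comp U.subtype h⟩
  left_inv s := by ext; rfl
  right_inv := by
    rintro ⟨⟨L, hL, hLU⟩, s, hs⟩
    have h : LinearIndependent F (fun i => (s i : V)) := hs.map' L.subtype L.ker_subtype
    have hspan : Submodule.span F (Set.range fun i => (s i : V)) = L := by
      apply Submodule.eq_of_le_of_finrank_eq
      · rw [Submodule.span_le]
        rintro _ ⟨i, rfl⟩
        exact (s i).2
      · exact (by simpa using finrank_span_eq_card h :
          finrank F (Submodule.span F (Set.range fun i => (s i : V))) = k).trans hL.symm
    exact sigma_tuple_ext hspan fun _ => rfl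

theorem card_submodule_le_mul {F V : Type*} [Field F] [Fintype F] [AddCommGroup V]
    [Module F V] [FiniteDimensional F V] (k : ℕ) (U : Submodule F V) (hk : k ≤ finrank F U) :
    Nat.card {L : Submodule F V // finrank F L = k ∧ L ≤ U} *
        ∏ i : Fin k, (Fintype.card F ^ k - Fintype.card F ^ i.val) =
      ∏ i : Fin k, (Fintype.card F ^ finrank F U - Fintype.card F ^ i.val) := by
  classical
  have : Finite V := Module.finite_of_finite F
  have : Fintype (Submodule F V) := Fintype.ofFinite _
  rw [← card_linearIndependent hk, Nat.card_congr (linearIndependentEquivSigma k U),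
    Nat.card_sigma]
  rw [Finset.sum_congr rfl fun L _ => by
    rw [card_linearIndependent (K := F) (V := L.1) L.2.1.ge, L.2.1]]
  simp [Nat.card_eq_fintype_card]

theorem finrank_map_mkQ_add {F V : Type*} [Field F] [AddCommGroup V] [Module F V]
    [FiniteDimensional F V] (Q L : Submodule F V) (hL : Q ≤ L) :
    finrank F (L.map Q.mkQ) + finrank F Q = finrank F L := by
  have h := (Q.mkQ.domRestrict L).finrank_range_add_finrank_ker
  rw [LinearMap.range_domRestrict, LinearMap.ker_domRestrict, Submodule.ker_mkQ] at h
  rwa [(Submodule.comapSubtypeEquivOfLe hL).finrank_eq] at h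

theorem card_submodule_between {F V : Type*} [Field F] [AddCommGroup V]
    [Module F V] [FiniteDimensional F V] (j : ℕ) (Q W : Submodule F V) (hW : Q ≤ W)
    (hQ : finrank F Q ≤ j) :
    Nat.card {L : Submodule F V // finrank F L = j ∧ Q ≤ L ∧ L ≤ W} =
      Nat.card {L : Submodule F (V ⧸ Q) //
        finrank F L = j - finrank F Q ∧ L ≤ W.map Q.mkQ} := by
  refine Nat.card_congr
    { toFun := fun L => ⟨L.1.map Q.mkQ, by have := finrank_map_mkQ_add Q L.1 L.2.2.1; have := L.2.1; lia,
        Submodule.map_mono L.2.2.2⟩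
      invFun := fun L => ⟨L.1.comap Q.mkQ, by
          have := finrank_map_mkQ_add Q (L.1.comap Q.mkQ) (Submodule.le_comap_mkQ Q L.1)
          rw [Submodule.map_comap_eq_of_surjective Q.mkQ_surjective, L.2.1] at this
          lia, Submodule.le_comap_mkQ Q L.1, by
          have := Submodule.comap_mono (f := Q.mkQ) L.2.2
          rwa [Submodule.comap_map_mkQ, sup_eq_right.mpr hW] at this⟩
      left_inv := fun L => Subtype.ext (by
        simp [Submodule.comap_map_mkQ, L.2.2.1])
      right_inv := fun L => Subtype.ext
        (Submodule.map_comap_eq_of_surjective Q.mkQ_surjective _) }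

theorem card_submodule_between_mul {F V : Type*} [Field F] [Fintype F] [AddCommGroup V]
    [Module F V] [FiniteDimensional F V] (j : ℕ) (Q W : Submodule F V) (hW : Q ≤ W)
    (hQ : finrank F Q ≤ j) (hj : j ≤ finrank F W) :
    Nat.card {L : Submodule F V // finrank F L = j ∧ Q ≤ L ∧ L ≤ W} *
        ∏ i : Fin (j - finrank F Q),
          (Fintype.card F ^ (j - finrank F Q) - Fintype.card F ^ i.val) =
      ∏ i : Fin (j - finrank F Q),
        (Fintype.card F ^ (finrank F W - finrank F Q) - Fintype.card F ^ i.val) := by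
  have h := finrank_map_mkQ_add Q W hW
  have h' : finrank F (W.map Q.mkQ) = finrank F W - finrank F Q := by lia
  rw [card_submodule_between j Q W hW hQ, card_submodule_le_mul _ _ (by lia), h']

theorem prod_pow_sub_pow_le_sq (q k N r : ℕ) (hq : 1 < q) (h : k + 2 * r ≤ N) :
    (∏ i : Fin k, (q ^ N - q ^ i.val)) * ∏ i : Fin k, (q ^ (N - 2 * r) - q ^ i.val) ≤
      (∏ i : Fin k, (q ^ (N - r) - q ^ i.val)) ^ 2 := by
  rw [← Finset.prod_mul_distrib, ← Finset.prod_pow]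
  refine Finset.prod_le_prod' fun i _ => ?_
  obtain ⟨M, rfl⟩ := Nat.exists_eq_add_of_le' (le_of_add_le_right h)
  have e1 : M + 2 * r - 2 * r = M := by lia
  have e2 : M + 2 * r - r = M + r := by lia
  have hi : i.val ≤ M := by lia
  rw [e1, e2]
  have l0 : q ^ i.val ≤ q ^ M := Nat.pow_le_pow_right hq.le hi
  have l1 : q ^ i.val ≤ q ^ (M + r) := Nat.pow_le_pow_right hq.le (by lia)
  have l2 : q ^ i.val ≤ q ^ (M + 2 * r) := Nat.pow_le_pow_right hq.le (by lia)
  zify [l0, l1, l2]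
  rw [pow_add, pow_add, pow_mul']
  nlinarith [mul_nonneg (by positivity : (0 : ℤ) ≤ (q : ℤ) ^ M * (q : ℤ) ^ i.val)
    (sq_nonneg ((q : ℤ) ^ r - 1))]

theorem prod_pow_sub_pow_pos (q k : ℕ) (hq : 1 < q) :
    0 < ∏ i : Fin k, (q ^ k - q ^ i.val) :=
  Finset.prod_pos fun i _ => Nat.sub_pos_of_lt (Nat.pow_lt_pow_right hq i.2)

/-- The number of `j`-dimensional spaces between `Q` and `W` is log-concave in `dim W`. -/
theorem card_submodule_between_log_concave {F V : Type*} [Field F] [Fintype F] [AddCommGroup V]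
    [Module F V] [FiniteDimensional F V] (j r : ℕ) (Q U W T : Submodule F V)
    (hU : Q ≤ U) (hW : U ≤ W) (hT : W ≤ T) (hQ : finrank F Q ≤ j) (hj : j ≤ finrank F U)
    (hUW : finrank F U + r = finrank F W) (hWT : finrank F W + r = finrank F T) :
    Nat.card {L : Submodule F V // finrank F L = j ∧ Q ≤ L ∧ L ≤ T} *
        Nat.card {L : Submodule F V // finrank F L = j ∧ Q ≤ L ∧ L ≤ U} ≤
      Nat.card {L : Submodule F V // finrank F L = j ∧ Q ≤ L ∧ L ≤ W} ^ 2 := by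
  have hq : 1 < Fintype.card F := Fintype.one_lt_card
  have hc := prod_pow_sub_pow_pos (Fintype.card F) (j - finrank F Q) hq
  have eU := card_submodule_between_mul j Q U hU hQ hj
  have eW := card_submodule_between_mul j Q W (hU.trans hW) hQ (by lia)
  have eT := card_submodule_between_mul j Q T (hU.trans (hW.trans hT)) hQ (by lia)
  have key := prod_pow_sub_pow_le_sq (Fintype.card F) (j - finrank F Q)
    (finrank F T - finrank F Q) r hq (by lia)
  rw [show finrank F T - finrank F Q - 2 * r = finrank F U - finrank F Q by lia,
    show finrank F T - finrank F Q - r = finrank F W - finrank F Q by lia,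
    ← eU, ← eW, ← eT] at key
  refine Nat.le_of_mul_le_mul_right ?_ (pow_pos hc 2)
  calc _ = _ := by ring
    _ ≤ _ := key
    _ = _ := by ring

/-- The number of `j`-dimensional spaces between `Q` and `W` depends only on `dim W`. -/
theorem card_submodule_between_congr {F V : Type*} [Field F] [Fintype F] [AddCommGroup V]
    [Module F V] [FiniteDimensional F V] (j : ℕ) (Q U W : Submodule F V)
    (hU : Q ≤ U) (hW : Q ≤ W) (hQ : finrank F Q ≤ j) (hj : j ≤ finrank F U)
    (hUW : finrank F U = finrank F W) :
    Nat.card {L : Submodule F V // finrank F L = j ∧ Q ≤ L ∧ L ≤ U} =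
      Nat.card {L : Submodule F V // finrank F L = j ∧ Q ≤ L ∧ L ≤ W} := by
  have hq : 1 < Fintype.card F := Fintype.one_lt_card
  have hc := prod_pow_sub_pow_pos (Fintype.card F) (j - finrank F Q) hq
  refine Nat.eq_of_mul_eq_mul_right hc ?_
  rw [card_submodule_between_mul j Q U hU hQ hj,
    card_submodule_between_mul j Q W hW hQ (hUW ▸ hj), hUW]

/-- Double counting over a finite second coordinate. -/
theorem card_subtype_prod_eq_sum {α β : Type*} [Finite α] (s : Finset β) (P : α → β → Prop) :
    Nat.card {p : α × β // p.2 ∈ s ∧ P p.1 p.2} = ∑ b ∈ s, Nat.card {a // P a b} := by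
  rw [← Finset.sum_coe_sort, ← Nat.card_sigma]
  exact Nat.card_congr
    { toFun := fun p => ⟨⟨p.1.2, p.2.1⟩, ⟨p.1.1, p.2.2⟩⟩
      invFun := fun t => ⟨(t.2.1, t.1.1), t.1.2, t.2.2⟩
      left_inv := fun _ => rfl
      right_inv := fun _ => rfl }

/-- Claim 5.21, expectation and variance of the covering number.  Let
`Q ⊆ V` have dimension `a` and let `𝒮` be a `2`-generic family of `m` subspaces of
codimension `r`, all containing `Q`.  For `L ∈ Zoom_j[Q, V]` let `N_𝒮(L)` be the number of
members of `𝒮` containing `L`, and let `p₁` be the probability that a uniformly random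
`L ∈ Zoom_j[Q, V]` is contained in a fixed `W ∈ 𝒮`.  Then `E[N_𝒮(L)] = p₁ m`
(expressed below as (number of incident pairs)/(size of `Zoom_j[Q, V]`)) and
`Var(N_𝒮(L)) = E[N_𝒮(L)²] − E[N_𝒮(L)]² ≤ p₁ m` (with `E[N_𝒮(L)²]` expressed as
(number of incident triples)/(size of `Zoom_j[Q, V]`)). -/
theorem stmt13 (F : Type) [Field F] [Fintype F]
    (V : Type) [AddCommGroup V] [Module F V] [FiniteDimensional F V]
    (a r j m : ℕ) (Q : Submodule F V) (hQ : finrank F ↥Q = a)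
    (𝒮 : Finset (Submodule F V)) (hm : 𝒮.card = m)
    (hQle : ∀ W ∈ 𝒮, Q ≤ W)
    (hcodim : ∀ W ∈ 𝒮, finrank F ↥W + r = finrank F V)
    (hgen : ∀ W₁ ∈ 𝒮, ∀ W₂ ∈ 𝒮, W₁ ≠ W₂ →
      finrank F ↥(W₁ ⊓ W₂) + 2 * r = finrank F V)
    (haj : a ≤ j) (hjr : j + 2 * r ≤ finrank F V)
    (hbig : 2 ^ 100 * Fintype.card F ^ j ≤ finrank F V)
    (W : Submodule F V) (hW : W ∈ 𝒮) (p₁ : ℝ)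
    (hp₁ : p₁ = (Nat.card {L : Submodule F V //
        finrank F ↥L = j ∧ Q ≤ L ∧ L ≤ W} : ℝ) /
      (Nat.card {L : Submodule F V // finrank F ↥L = j ∧ Q ≤ L} : ℝ)) :
    (Nat.card {p : Submodule F V × Submodule F V //
          finrank F ↥p.1 = j ∧ Q ≤ p.1 ∧ p.2 ∈ 𝒮 ∧ p.1 ≤ p.2} : ℝ) /
        (Nat.card {L : Submodule F V // finrank F ↥L = j ∧ Q ≤ L} : ℝ) = p₁ * m ∧
    (Nat.card {u : Submodule F V × Submodule F V × Submodule F V //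
          finrank F ↥u.1 = j ∧ Q ≤ u.1 ∧ u.2.1 ∈ 𝒮 ∧ u.2.2 ∈ 𝒮 ∧
            u.1 ≤ u.2.1 ∧ u.1 ≤ u.2.2} : ℝ) /
        (Nat.card {L : Submodule F V // finrank F ↥L = j ∧ Q ≤ L} : ℝ) -
      ((Nat.card {p : Submodule F V × Submodule F V //
          finrank F ↥p.1 = j ∧ Q ≤ p.1 ∧ p.2 ∈ 𝒮 ∧ p.1 ≤ p.2} : ℝ) /
        (Nat.card {L : Submodule F V // finrank F ↥L = j ∧ Q ≤ L} : ℝ)) ^ 2 ≤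
      p₁ * m := by
  have : Finite V := Module.finite_of_finite F
  have : Finite (Submodule F V) := inferInstance
  classical
  set Z := Nat.card {L : Submodule F V // finrank F ↥L = j ∧ Q ≤ L} with hZ
  set A := Nat.card {L : Submodule F V // finrank F ↥L = j ∧ Q ≤ L ∧ L ≤ W} with hA
  have hQj : finrank F Q ≤ j := hQ.trans_le haj
  have hZtop : Z = Nat.card {L : Submodule F V // finrank F ↥L = j ∧ Q ≤ L ∧ L ≤ ⊤} := by
    simp [hZ]
  have hA' : ∀ W' ∈ 𝒮,
      Nat.card {L : Submodule F V // finrank F ↥L = j ∧ Q ≤ L ∧ L ≤ W'} = A := by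
    intro W' hW'
    have h1 := hcodim W hW
    have h2 := hcodim W' hW'
    exact card_submodule_between_congr j Q W' W (hQle W' hW') (hQle W hW) hQj (by lia) (by lia)
  have hpairs : Nat.card {p : Submodule F V × Submodule F V //
      finrank F ↥p.1 = j ∧ Q ≤ p.1 ∧ p.2 ∈ 𝒮 ∧ p.1 ≤ p.2} = m * A := by
    have h := card_subtype_prod_eq_sum 𝒮
      (fun L W' : Submodule F V => finrank F L = j ∧ Q ≤ L ∧ L ≤ W')
    rw [Finset.sum_congr rfl hA', Finset.sum_const, hm, smul_eq_mul] at h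
    rw [← h]
    exact Nat.card_congr (Equiv.subtypeEquivRight fun p => by tauto)
  have htriples : Nat.card {u : Submodule F V × Submodule F V × Submodule F V //
      finrank F ↥u.1 = j ∧ Q ≤ u.1 ∧ u.2.1 ∈ 𝒮 ∧ u.2.2 ∈ 𝒮 ∧ u.1 ≤ u.2.1 ∧ u.1 ≤ u.2.2} =
      ∑ w ∈ 𝒮 ×ˢ 𝒮,
        Nat.card {L : Submodule F V // finrank F L = j ∧ Q ≤ L ∧ L ≤ w.1 ⊓ w.2} := by
    rw [← card_subtype_prod_eq_sum (𝒮 ×ˢ 𝒮)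
      (fun (L : Submodule F V) (w : Submodule F V × Submodule F V) =>
        finrank F L = j ∧ Q ≤ L ∧ L ≤ w.1 ⊓ w.2)]
    exact Nat.card_congr (Equiv.subtypeEquivRight fun p => by
      rw [Finset.mem_product, le_inf_iff]; tauto)
  have hoff : ∀ W₁ ∈ 𝒮, ∀ W₂ ∈ 𝒮, W₁ ≠ W₂ →
      Z * Nat.card {L : Submodule F V // finrank F L = j ∧ Q ≤ L ∧ L ≤ W₁ ⊓ W₂} ≤ A ^ 2 := by
    intro W₁ h₁ W₂ h₂ hne
    have hc := hcodim W₁ h₁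
    have hg := hgen W₁ h₁ W₂ h₂ hne
    rw [hZtop, ← hA' W₁ h₁]
    exact card_submodule_between_log_concave j r Q (W₁ ⊓ W₂) W₁ ⊤
      (le_inf (hQle W₁ h₁) (hQle W₂ h₂)) inf_le_left le_top hQj (by lia) (by lia)
      (by rw [finrank_top]; exact hc)
  have hsum : Z * ∑ w ∈ 𝒮 ×ˢ 𝒮,
      Nat.card {L : Submodule F V // finrank F L = j ∧ Q ≤ L ∧ L ≤ w.1 ⊓ w.2} ≤
      Z * (m * A) + m ^ 2 * A ^ 2 := by
    calc _ ≤ ∑ w ∈ 𝒮 ×ˢ 𝒮, ((if w.1 = w.2 then Z * A else 0) + A ^ 2) := by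
          rw [Finset.mul_sum]
          refine Finset.sum_le_sum fun w hw => ?_
          obtain ⟨h₁, h₂⟩ := Finset.mem_product.mp hw
          split_ifs with h
          · rw [← h, inf_idem, hA' w.1 h₁]
            exact Nat.le_add_right _ _
          · simpa using hoff w.1 h₁ w.2 h₂ h
      _ = _ := by
          rw [Finset.sum_add_distrib, Finset.sum_product]
          simp [Finset.sum_ite_eq, hm]
          ring
  rw [hpairs, htriples, hp₁]
  refine ⟨by push_cast; ring, ?_⟩
  set T := ∑ w ∈ 𝒮 ×ˢ 𝒮,
      Nat.card {L : Submodule F V // finrank F L = j ∧ Q ≤ L ∧ L ≤ w.1 ⊓ w.2}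
  rcases Nat.eq_zero_or_pos Z with h0 | hpos
  · simp [h0]
  · have hZr : (0 : ℝ) < Z := by exact_mod_cast hpos
    have hs : (Z : ℝ) * T ≤ Z * (m * A) + m ^ 2 * A ^ 2 := by exact_mod_cast hsum
    push_cast
    rw [sub_le_iff_le_add]
    calc (T : ℝ) / Z = Z * T / Z ^ 2 := by field_simp
      _ ≤ (Z * (m * A) + m ^ 2 * A ^ 2) / Z ^ 2 := by gcongr
      _ = _ := by field_simp
end

section
/- Fix δ > 0 and a finite field F_q, and set ξ = δ⁵, δ₂ = ξ/100, and t = (2^{2+10/δ₂})!. Then for all sufficiently large ℓ the following holds for the ambient space F_q^n whenever n ≥ q^ℓ. For any table T on Grass_q(n, 2ℓ), any subspace Q ⊆ F_q^n of dimension r₁ ≤ 10/δ, and any C ≥ q^{−2(1−δ³)ℓ}, the number of zoom-out/function pairs (W, g) that are (C, 1/5)-maximal with respect to T on Q and have codim(W) = r₂ for some r₂ ≤ 10/δ is at most (40/δ)·C^{−2}·q^{100·(t−1)!·(10/δ)²·ℓ·ξ^{−1}}. -/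
open Module

/-- The fraction of `ℓ₂`-dimensional subspaces `L` with `Q ⊆ L ⊆ W` on which the linear
functional `g : W → F` agrees with the table entry `T[L]`. -/
noncomputable def agrFrac (F : Type) [Field F] (n ℓ₂ : ℕ)
    (T : (L : Submodule F (Fin n → F)) → (↥L →ₗ[F] F))
    (Q W : Submodule F (Fin n → F)) (g : ↥W →ₗ[F] F) : ℝ :=
  (Nat.card {L : Submodule F (Fin n → F) //
      finrank F ↥L = ℓ₂ ∧ Q ≤ L ∧ L ≤ W ∧
        ∀ (x : Fin n → F) (hxL : x ∈ L) (hxW : x ∈ W),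
          g ⟨x, hxW⟩ = T L ⟨x, hxL⟩} : ℝ) /
    (Nat.card {L : Submodule F (Fin n → F) //
      finrank F ↥L = ℓ₂ ∧ Q ≤ L ∧ L ≤ W} : ℝ)

/-- A zoom-out/function pair `(W, g)` is `(C, s)`-maximal with respect to the table `T` on
the zoom-in `Q` if `g` agrees with `T` on at least a `C` fraction of `Zoom[Q, W]`, and no
pair `(W', g')` with `W ⊊ W'` and `g'` extending `g` agrees with `T` on at least an `s·C`
fraction of `Zoom[Q, W']`. -/
def IsMaximal (F : Type) [Field F] (n ℓ₂ : ℕ)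
    (T : (L : Submodule F (Fin n → F)) → (↥L →ₗ[F] F))
    (Q : Submodule F (Fin n → F)) (C s : ℝ)
    (W : Submodule F (Fin n → F)) (g : ↥W →ₗ[F] F) : Prop :=
  Q ≤ W ∧ C ≤ agrFrac F n ℓ₂ T Q W g ∧
    ¬∃ (W' : Submodule F (Fin n → F)) (g' : ↥W' →ₗ[F] F), W < W' ∧
      (∀ (x : Fin n → F) (hxW : x ∈ W) (hxW' : x ∈ W'),
        g' ⟨x, hxW'⟩ = g ⟨x, hxW⟩) ∧
      s * C ≤ agrFrac F n ℓ₂ T Q W' g'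

section Counting

variable {F V : Type*} [Field F] [AddCommGroup V] [Module F V] [Finite V]

lemma span_range_coe_eq {k : ℕ} {L : Submodule F V} (hL : finrank F L = k) {s : Fin k → L}
    (hs : LinearIndependent F s) : Submodule.span F (Set.range fun i => (s i : V)) = L := by
  apply Submodule.eq_of_le_of_finrank_eq
  · rw [Submodule.span_le]
    rintro _ ⟨i, rfl⟩
    exact (s i).2
  · have h : LinearIndependent F (fun i => (s i : V)) :=
      hs.map' L.subtype (Submodule.ker_subtype _)
    rw [finrank_span_eq_card h]
    simp [hL]

/-- A linearly independent tuple is a subspace together with a basis of it. -/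
lemma natCard_sigma_basis (k : ℕ) :
    Nat.card (Σ L : {L : Submodule F V // finrank F L = k},
      {s : Fin k → L.1 // LinearIndependent F s}) =
      Nat.card {s : Fin k → V // LinearIndependent F s} := by
  refine Nat.card_congr (Equiv.ofBijective (fun p => ⟨fun i => (p.2.1 i : V),
    p.2.2.map' p.1.1.subtype (Submodule.ker_subtype _)⟩) ⟨?_, ?_⟩)
  · rintro ⟨⟨L, hL⟩, ⟨s, hs⟩⟩ ⟨⟨L', hL'⟩, ⟨s', hs'⟩⟩ h
    have h := congrArg Subtype.val h
    simp only at h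
    have hLL : L = L' := by
      rw [← span_range_coe_eq hL hs, ← span_range_coe_eq hL' hs', h]
    subst hLL
    have hss : s = s' := funext fun i => Subtype.ext (congrFun h i)
    subst hss
    rfl
  · rintro ⟨s, hs⟩
    exact ⟨⟨⟨Submodule.span F (Set.range s), by simpa using finrank_span_eq_card hs⟩,
      ⟨fun i => ⟨s i, Submodule.subset_span ⟨i, rfl⟩⟩,
        LinearIndependent.of_comp (Submodule.subtype _) hs⟩⟩, rfl⟩

lemma natCard_between (Q Z : Submodule F V) (hQ : Q ≤ Z) (k : ℕ) :
    Nat.card {L : Submodule F V // finrank F L = finrank F Q + k ∧ Q ≤ L ∧ L ≤ Z} =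
      Nat.card {L : Submodule F (Z ⧸ Q.comap Z.subtype) // finrank F L = k} := by
  symm
  set Q' := Q.comap Z.subtype with hQ'
  have hmapQ : Q'.map Z.subtype = Q := by
    rw [hQ', Submodule.map_comap_subtype, inf_eq_right.2 hQ]
  have hrQ : finrank F Q' = finrank F Q := by
    rw [← hmapQ, Submodule.finrank_map_subtype_eq]
  have hr (L : Submodule F (Z ⧸ Q')) :
      finrank F ((L.comap Q'.mkQ).map Z.subtype) = finrank F Q + finrank F L := by
    rw [Submodule.finrank_map_subtype_eq]
    have h1 := LinearMap.finrank_range_add_finrank_ker (Q'.mkQ.domRestrict (L.comap Q'.mkQ))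
    have h2 : (Q'.mkQ.domRestrict (L.comap Q'.mkQ)).range = L := by
      rw [LinearMap.range_domRestrict, Submodule.map_comap_eq, Submodule.range_mkQ, top_inf_eq]
    have h3 : finrank F (Q'.mkQ.domRestrict (L.comap Q'.mkQ)).ker = finrank F Q' := by
      rw [LinearMap.ker_domRestrict, Submodule.ker_mkQ, ← Submodule.finrank_map_subtype_eq,
        Submodule.map_comap_subtype, inf_eq_right.2 (Submodule.le_comap_mkQ Q' L)]
    rw [h2, h3] at h1
    omega
  refine Nat.card_congr (Equiv.ofBijective (fun L => ⟨(L.1.comap Q'.mkQ).map Z.subtype, ?_, ?_,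
    Submodule.map_subtype_le _ _⟩) ⟨?_, ?_⟩)
  · rw [hr, L.2]
  · exact hmapQ.symm.le.trans (Submodule.map_mono (Submodule.le_comap_mkQ Q' L.1))
  · rintro ⟨L, hL⟩ ⟨L', hL'⟩ h
    have h := congrArg Subtype.val h
    simp only at h
    have h := Submodule.map_injective_of_injective Z.injective_subtype h
    exact Subtype.ext (Submodule.comap_injective_of_surjective (Submodule.mkQ_surjective _) h)
  · rintro ⟨L, hL, hQL, hLZ⟩
    have key : (((L.comap Z.subtype).map Q'.mkQ).comap Q'.mkQ).map Z.subtype = L := by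
      rw [Submodule.comap_map_mkQ, sup_eq_right.2 (Submodule.comap_mono hQL),
        Submodule.map_comap_subtype, inf_eq_right.2 hLZ]
    refine ⟨⟨(L.comap Z.subtype).map Q'.mkQ, ?_⟩, Subtype.ext key⟩
    have := hr ((L.comap Z.subtype).map Q'.mkQ)
    rw [key] at this
    omega

variable [Fintype F]

/-- Counting linearly independent tuples without restricting their length. -/
lemma natCard_linearIndependent (k : ℕ) :
    Nat.card {s : Fin k → V // LinearIndependent F s} =
      ∏ i : Fin k, (Fintype.card F ^ finrank F V - Fintype.card F ^ (i : ℕ)) := by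
  rcases le_or_gt k (finrank F V) with h | h
  · exact card_linearIndependent h
  · rw [Finset.prod_eq_zero (Finset.mem_univ (⟨finrank F V, h⟩ : Fin k)) (by simp)]
    have : IsEmpty {s : Fin k → V // LinearIndependent F s} :=
      ⟨fun s => h.not_ge (by simpa using s.2.fintype_card_le_finrank)⟩
    exact Nat.card_of_isEmpty

lemma natCard_submodule_mul (k : ℕ) :
    Nat.card {L : Submodule F V // finrank F L = k} *
        ∏ i : Fin k, (Fintype.card F ^ k - Fintype.card F ^ (i : ℕ)) =
      ∏ i : Fin k, (Fintype.card F ^ finrank F V - Fintype.card F ^ (i : ℕ)) := by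
  have : Fintype {L : Submodule F V // finrank F L = k} := Fintype.ofFinite _
  rw [← natCard_linearIndependent (F := F) (V := V), ← natCard_sigma_basis,
    Nat.card_sigma, Finset.sum_congr rfl (g := fun _ =>
      ∏ i : Fin k, (Fintype.card F ^ k - Fintype.card F ^ (i : ℕ)))]
  · simp [Nat.card_eq_fintype_card]
  · rintro ⟨L, hL⟩ -
    rw [natCard_linearIndependent, hL]

/-- The number of `(dim Q + k)`-dimensional subspaces between `Q` and `Z`. -/
lemma natCard_between_mul (Q Z : Submodule F V) (hQ : Q ≤ Z) (k : ℕ) :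
    Nat.card {L : Submodule F V // finrank F L = finrank F Q + k ∧ Q ≤ L ∧ L ≤ Z} *
        ∏ i : Fin k, (Fintype.card F ^ k - Fintype.card F ^ (i : ℕ)) =
      ∏ i : Fin k, (Fintype.card F ^ (finrank F Z - finrank F Q) - Fintype.card F ^ (i : ℕ)) := by
  have : Finite (Z ⧸ Q.comap Z.subtype) := Finite.of_surjective _ (Submodule.mkQ_surjective _)
  rw [natCard_between Q Z hQ, natCard_submodule_mul]
  have h1 := Submodule.finrank_quotient_add_finrank (Q.comap Z.subtype)
  have h2 : finrank F (Q.comap Z.subtype) = finrank F Q := by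
    rw [← Submodule.finrank_map_subtype_eq, Submodule.map_comap_subtype, inf_eq_right.2 hQ]
  rw [show finrank F (Z ⧸ Q.comap Z.subtype) = finrank F Z - finrank F Q by omega]

end Counting

section ZoomRatio

/-- The probability that a uniform `k`-dimensional subspace of an `e`-dimensional space over a
field with `q` elements lies in a fixed subspace of codimension `c`. -/
noncomputable def zoomRatio (q e k c : ℕ) : ℝ :=
  ∏ i : Fin k, ((q ^ (e - c) - q ^ (i : ℕ) : ℕ) : ℝ) / ((q ^ e - q ^ (i : ℕ) : ℕ) : ℝ)

lemma zoomRatio_nonneg (q e k c : ℕ) : 0 ≤ zoomRatio q e k c :=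
  Finset.prod_nonneg fun _ _ => by positivity

variable {q e k : ℕ}

lemma pow_sub_pow_pos (hq : 2 ≤ q) (hk : k ≤ e) (i : Fin k) : 0 < q ^ e - q ^ (i : ℕ) :=
  Nat.sub_pos_of_lt (Nat.pow_lt_pow_right (by omega) (by omega))

lemma pow_sub_pow_mul_le (hq : 2 ≤ q) (a b i : ℕ) :
    (q ^ (e - (a + b)) - q ^ i) * (q ^ e - q ^ i) ≤
      (q ^ (e - a) - q ^ i) * (q ^ (e - b) - q ^ i) := by
  rcases le_or_gt (q ^ (e - (a + b))) (q ^ i) with h | h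
  · simp [Nat.sub_eq_zero_of_le h]
  have hi : i < e - (a + b) := (Nat.pow_lt_pow_iff_right (by omega)).1 h
  have h1 : q ^ i ≤ q ^ e := Nat.pow_le_pow_right (by omega) (by omega)
  have h2 : q ^ i ≤ q ^ (e - a) := Nat.pow_le_pow_right (by omega) (by omega)
  have h3 : q ^ i ≤ q ^ (e - b) := Nat.pow_le_pow_right (by omega) (by omega)
  have e1 : q ^ e = q ^ (e - (a + b)) * q ^ a * q ^ b := by
    rw [← pow_add, ← pow_add]; congr 1; omega
  have e2 : q ^ (e - a) = q ^ (e - (a + b)) * q ^ b := by rw [← pow_add]; congr 1; omega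
  have e3 : q ^ (e - b) = q ^ (e - (a + b)) * q ^ a := by rw [← pow_add]; congr 1; omega
  have hA : 1 ≤ q ^ a := Nat.one_le_pow _ _ (by omega)
  have hB : 1 ≤ q ^ b := Nat.one_le_pow _ _ (by omega)
  zify [h.le, h1, h2, h3] at *
  rw [e1, e2, e3]
  have hy : (0 : ℤ) ≤ (q : ℤ) ^ i := by positivity
  have hU : (0 : ℤ) ≤ (q : ℤ) ^ (e - (a + b)) := by positivity
  have h4 := mul_nonneg (mul_nonneg hy hU) (mul_nonneg (sub_nonneg.2 hA) (sub_nonneg.2 hB))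
  nlinarith [h4]

lemma zoomRatio_add_le (hq : 2 ≤ q) (hk : k ≤ e) (a b : ℕ) :
    zoomRatio q e k (a + b) ≤ zoomRatio q e k a * zoomRatio q e k b := by
  unfold zoomRatio
  rw [← Finset.prod_mul_distrib]
  refine Finset.prod_le_prod (fun _ _ => by positivity) fun i _ => ?_
  have h0 : (0 : ℝ) < ((q ^ e - q ^ (i : ℕ) : ℕ) : ℝ) := by
    exact_mod_cast pow_sub_pow_pos hq hk i
  rw [div_mul_div_comm, div_le_div_iff₀ h0 (by positivity)]
  have := pow_sub_pow_mul_le (e := e) hq a b i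
  calc _ = (((q ^ (e - (a + b)) - q ^ (i : ℕ)) * (q ^ e - q ^ (i : ℕ)) : ℕ) : ℝ) *
        ((q ^ e - q ^ (i : ℕ) : ℕ) : ℝ) := by push_cast; ring
    _ ≤ (((q ^ (e - a) - q ^ (i : ℕ)) * (q ^ (e - b) - q ^ (i : ℕ)) : ℕ) : ℝ) *
        ((q ^ e - q ^ (i : ℕ) : ℕ) : ℝ) := by gcongr
    _ = _ := by push_cast; ring

lemma zoomRatio_mul_le (hq : 2 ≤ q) (hk : k ≤ e) (a b j : ℕ) :
    zoomRatio q e k (a + j * b) ≤ zoomRatio q e k a * zoomRatio q e k b ^ j := by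
  induction j with
  | zero => simp
  | succ j ih =>
    calc zoomRatio q e k (a + (j + 1) * b) = zoomRatio q e k (a + j * b + b) := by ring_nf
      _ ≤ zoomRatio q e k (a + j * b) * zoomRatio q e k b := zoomRatio_add_le hq hk _ _
      _ ≤ zoomRatio q e k a * zoomRatio q e k b ^ j * zoomRatio q e k b := by
        gcongr; exact zoomRatio_nonneg _ _ _ _
      _ = _ := by ring

lemma zoomRatio_one_le (hq : 2 ≤ q) (hk : k ≤ e) : zoomRatio q e k 1 ≤ ((q : ℝ) ^ k)⁻¹ := by
  have : ((q : ℝ) ^ k)⁻¹ = ∏ _i : Fin k, (q : ℝ)⁻¹ := by simp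
  rw [this]
  refine Finset.prod_le_prod (fun _ _ => by positivity) fun i _ => ?_
  have h0 : (0 : ℝ) < ((q ^ e - q ^ (i : ℕ) : ℕ) : ℝ) := by
    exact_mod_cast pow_sub_pow_pos hq hk i
  have hq0 : (0 : ℝ) < q := by exact_mod_cast (by omega : 0 < q)
  rw [div_le_iff₀ h0, inv_mul_eq_div, le_div_iff₀ hq0]
  have : (q ^ (e - 1) - q ^ (i : ℕ)) * q ≤ q ^ e - q ^ (i : ℕ) := by
    have he : q ^ e = q ^ (e - 1) * q := by
      rw [← pow_succ]; congr 1; have := i.isLt; omega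
    rw [Nat.sub_mul, he]
    exact Nat.sub_le_sub_left (Nat.le_mul_of_pos_right _ (by omega)) _
  exact_mod_cast this

lemma le_zoomRatio (hq : 2 ≤ q) {c : ℕ} (hk : k + c ≤ e) :
    ((q : ℝ) ^ ((c + 1) * k))⁻¹ ≤ zoomRatio q e k c := by
  have : ((q : ℝ) ^ ((c + 1) * k))⁻¹ = ∏ _i : Fin k, ((q : ℝ) ^ (c + 1))⁻¹ := by
    simp [pow_mul]
  rw [this]
  refine Finset.prod_le_prod (fun _ _ => by positivity) fun i _ => ?_
  have h0 : (0 : ℝ) < ((q ^ e - q ^ (i : ℕ) : ℕ) : ℝ) := by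
    exact_mod_cast pow_sub_pow_pos hq (by omega) i
  have hq0 : (0 : ℝ) < q := by exact_mod_cast (by omega : 0 < q)
  rw [le_div_iff₀ h0, inv_mul_eq_div, div_le_iff₀ (by positivity)]
  have : q ^ e - q ^ (i : ℕ) ≤ (q ^ (e - c) - q ^ (i : ℕ)) * q ^ (c + 1) := by
    have hi := i.isLt
    have he : q ^ e = q ^ (e - c - 1) * q ^ (c + 1) := by
      rw [← pow_add]; congr 1; omega
    refine (Nat.sub_le _ _).trans ?_
    rw [he]
    gcongr
    have h1 : q ^ (e - c) = q ^ (e - c - 1) * q := by rw [← pow_succ]; congr 1; omega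
    have h2 : q ^ (i : ℕ) ≤ q ^ (e - c - 1) := Nat.pow_le_pow_right (by omega) (by omega)
    have h3 : q ^ (e - c - 1) * 2 ≤ q ^ (e - c - 1) * q := Nat.mul_le_mul_left _ hq
    omega
  exact_mod_cast this

end ZoomRatio

section ZoomSet

variable {F V : Type*} [Field F] [AddCommGroup V] [Module F V] [Finite V]

/-- The subspaces of dimension `s` between `Q` and `W`. -/
noncomputable def zoomSet (Q W : Submodule F V) (s : ℕ) : Finset (Submodule F V) :=
  (Set.toFinite {L : Submodule F V | finrank F L = s ∧ Q ≤ L ∧ L ≤ W}).toFinset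

lemma mem_zoomSet {Q W L : Submodule F V} {s : ℕ} :
    L ∈ zoomSet Q W s ↔ finrank F L = s ∧ Q ≤ L ∧ L ≤ W := by
  simp [zoomSet]

lemma card_zoomSet (Q W : Submodule F V) (s : ℕ) :
    (zoomSet Q W s).card =
      Nat.card {L : Submodule F V // finrank F L = s ∧ Q ≤ L ∧ L ≤ W} := by
  have := Set.ncard_eq_toFinset_card {L : Submodule F V | finrank F L = s ∧ Q ≤ L ∧ L ≤ W}
  rw [zoomSet, ← this]
  rfl

variable [Fintype F]

lemma card_zoomSet_eq {Q Z W : Submodule F V} (hQ : Q ≤ Z) (hZ : Z ≤ W) {c k : ℕ}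
    (hc : finrank F Z + c = finrank F W) (hk : k ≤ finrank F W - finrank F Q) :
    ((zoomSet Q Z (finrank F Q + k)).card : ℝ) =
      zoomRatio (Fintype.card F) (finrank F W - finrank F Q) k c *
        (zoomSet Q W (finrank F Q + k)).card := by
  have hq : 2 ≤ Fintype.card F := Fintype.one_lt_card
  have h1 := natCard_between_mul Q Z hQ k
  have h2 := natCard_between_mul Q W (hQ.trans hZ) k
  rw [← card_zoomSet] at h1 h2
  have h3 : finrank F Z - finrank F Q = finrank F W - finrank F Q - c := by omega
  rw [h3] at h1
  have hD : 0 < ∏ i : Fin k, (Fintype.card F ^ k - Fintype.card F ^ (i : ℕ)) :=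
    Finset.prod_pos fun i _ => pow_sub_pow_pos hq le_rfl i
  have hN : 0 < ∏ i : Fin k,
      (Fintype.card F ^ (finrank F W - finrank F Q) - Fintype.card F ^ (i : ℕ)) :=
    Finset.prod_pos fun i _ => pow_sub_pow_pos hq hk i
  unfold zoomRatio
  rw [Finset.prod_div_distrib]
  simp only [← Nat.cast_prod]
  rw [← h1, ← h2]
  rw [← h2] at hN
  have hW : (zoomSet Q W (finrank F Q + k)).card ≠ 0 := by
    intro h; simp [h] at hN
  generalize ∏ i : Fin k, (Fintype.card F ^ k - Fintype.card F ^ (i : ℕ)) = D at *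
  push_cast
  field_simp

lemma card_zoomSet_le {Q Z W : Submodule F V} (hZ : Z ≤ W) {c k : ℕ}
    (hc : finrank F Z + c = finrank F W) (hk : k ≤ finrank F W - finrank F Q) :
    ((zoomSet Q Z (finrank F Q + k)).card : ℝ) ≤
      zoomRatio (Fintype.card F) (finrank F W - finrank F Q) k c *
        (zoomSet Q W (finrank F Q + k)).card := by
  by_cases hQ : Q ≤ Z
  · exact (card_zoomSet_eq hQ hZ hc hk).le
  · have : zoomSet Q Z (finrank F Q + k) = ∅ := by
      ext L
      simp only [mem_zoomSet, Finset.notMem_empty, iff_false]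
      exact fun h => hQ (h.2.1.trans h.2.2)
    rw [this]
    simpa using mul_nonneg (zoomRatio_nonneg _ _ _ _) (Nat.cast_nonneg _)

end ZoomSet

section Functionals

variable {F V : Type*} [Field F] [AddCommGroup V] [Module F V]

lemma exists_dual_eq_of_eq_zero_on_inf {Z W : Submodule F V} {f : Dual F V}
    (hf : ∀ x ∈ W, x ∈ Z → f x = 0) :
    ∃ ψ : Dual F V, (∀ x ∈ Z, ψ x = 0) ∧ ∀ x ∈ W, ψ x = f x := by
  set u := Z.mkQ ∘ₗ W.subtype
  have h : f ∘ₗ W.subtype ∈ u.ker.dualAnnihilator := by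
    rw [Submodule.mem_dualAnnihilator]
    rintro ⟨x, hx⟩ hxu
    exact hf x hx (by simpa [u] using hxu)
  rw [← LinearMap.range_dualMap_eq_dualAnnihilator_ker] at h
  obtain ⟨χ, hχ⟩ := h
  refine ⟨χ ∘ₗ Z.mkQ, fun x hx => ?_, fun x hx => ?_⟩
  · simp [(Submodule.Quotient.mk_eq_zero Z).2 hx]
  · exact LinearMap.congr_fun hχ ⟨x, hx⟩

variable [Finite V] [Fintype F]

/-- Up to equality on `W`, there are `q ^ b` functionals vanishing on a subspace of `W` of
codimension `b`. -/
lemma exists_finset_dual {Z W : Submodule F V} (hZ : Z ≤ W) {b : ℕ}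
    (hb : finrank F Z + b = finrank F W) :
    ∃ Φ : Finset (Dual F V), Φ.card ≤ Fintype.card F ^ b ∧
      ∀ ψ : Dual F V, (∀ x ∈ Z, ψ x = 0) → ∃ φ ∈ Φ, ∀ x ∈ W, φ x = ψ x := by
  classical
  set Z' := Z.comap W.subtype with hZ'
  have : Finite (W ⧸ Z') := Finite.of_surjective _ (Submodule.mkQ_surjective _)
  have : Finite (Dual F (W ⧸ Z')) := Module.finite_of_finite F
  have : Fintype (Dual F (W ⧸ Z')) := Fintype.ofFinite _
  have hext (χ : Dual F (W ⧸ Z')) : ∃ g : Dual F V, g ∘ₗ W.subtype = χ ∘ₗ Z'.mkQ :=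
    LinearMap.exists_extend _
  choose ext hext using hext
  refine ⟨Finset.univ.image ext, ?_, fun ψ hψ => ?_⟩
  · refine Finset.card_image_le.trans (le_of_eq ?_)
    rw [Finset.card_univ, Module.card_eq_pow_finrank (K := F), Subspace.dual_finrank_eq]
    have h1 := Submodule.finrank_quotient_add_finrank Z'
    have h2 : finrank F Z' = finrank F Z := by
      rw [← Submodule.finrank_map_subtype_eq, Submodule.map_comap_subtype, inf_eq_right.2 hZ]
    congr 1
    omega
  · refine ⟨ext (Z'.liftQ (ψ ∘ₗ W.subtype) fun x hx => hψ x hx),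
      Finset.mem_image_of_mem _ (Finset.mem_univ _), fun x hx => ?_⟩
    exact LinearMap.congr_fun (hext (Z'.liftQ (ψ ∘ₗ W.subtype) fun x hx => hψ x hx)) ⟨x, hx⟩

end Functionals

section Moments

variable {F V ι : Type*} [Field F] [AddCommGroup V] [Module F V] [Finite V]
  {I : Finset ι} {W : ι → Submodule F V} {G : ι → Dual F V} {E : Submodule F V} {η ρ : ℝ}

/-- The points of `Z ⊓ W` at which `g` and `h` agree. -/
abbrev agreeSub (Z W : Submodule F V) (g h : Dual F V) : Submodule F V :=
  Z ⊓ W ⊓ (g - h).ker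

lemma finrank_agreeSub {Z W E : Submodule F V} {g h : Dual F V} (hsup : Z ⊔ W = E)
    (hne : ¬ ∀ x ∈ W, x ∈ Z → g x = h x) {b r : ℕ} (hb : finrank F Z + b = finrank F E)
    (hr : finrank F W + r = finrank F E) :
    finrank F (agreeSub Z W g h) + (b + (r + 1)) = finrank F E := by
  have h1 := Submodule.finrank_sup_add_finrank_inf_eq Z W
  rw [hsup] at h1
  have h2 := Submodule.finrank_sup_add_finrank_inf_eq (Z ⊓ W) (g - h).ker
  push Not at hne
  obtain ⟨x, hxW, hxZ, hx⟩ := hne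
  have hgh : g - h ≠ 0 := fun h0 => hx (by
    have := LinearMap.congr_fun h0 x; simpa [sub_eq_zero] using this)
  have h3 := Module.Dual.finrank_ker_add_one_of_ne_zero hgh
  have h4 : finrank F (g - h).ker < finrank F ((Z ⊓ W) ⊔ (g - h).ker : Submodule F V) := by
    apply Submodule.finrank_lt_finrank_of_lt
    refine lt_of_le_of_ne le_sup_right fun h5 => ?_
    have : x ∈ (g - h).ker := h5 ▸ Submodule.mem_sup_left ⟨hxZ, hxW⟩
    exact hx (by simpa [sub_eq_zero] using this)
  have h5 := Submodule.finrank_le ((Z ⊓ W) ⊔ (g - h).ker : Submodule F V)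
  change finrank F (Z ⊓ W ⊓ (g - h).ker : Submodule F V) + _ = _
  omega

variable [Fintype F]

open Classical in
/-- If few of the `W i` lie in any proper subspace of `E`, most of them span `E` together with
`Z`. -/
lemma card_sup_ne_le (hW : ∀ i ∈ I, W i ≤ E) (hη0 : 0 ≤ η)
    (hη : ∀ X < E, ((I.filter fun i => W i ≤ X).card : ℝ) ≤ η * I.card)
    {Z : Submodule F V} (hZ : Z ≤ E) {b : ℕ} (hb : finrank F Z + b = finrank F E) :
    ((I.filter fun i => Z ⊔ W i ≠ E).card : ℝ) ≤ (Fintype.card F : ℝ) ^ b * (η * I.card) := by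
  obtain ⟨Φ, hΦ, hΦ'⟩ := exists_finset_dual hZ hb
  set Φ' := Φ.filter fun φ => E ⊓ φ.ker < E
  have hsub : (I.filter fun i => Z ⊔ W i ≠ E) ⊆
      Φ'.biUnion fun φ => I.filter fun i => W i ≤ E ⊓ φ.ker := by
    intro i hi
    obtain ⟨hi, hne⟩ := Finset.mem_filter.1 hi
    obtain ⟨x, hxE, hx⟩ := SetLike.exists_of_lt (lt_of_le_of_ne (sup_le hZ (hW i hi)) hne)
    obtain ⟨ψ, hψx, hψ⟩ := Submodule.exists_le_ker_of_notMem hx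
    obtain ⟨φ, hφ, hφψ⟩ := hΦ' ψ fun y hy => hψ (Submodule.mem_sup_left hy)
    simp only [Finset.mem_biUnion, Finset.mem_filter, Φ']
    refine ⟨φ, ⟨hφ, lt_of_le_of_ne inf_le_left fun h => hψx ?_⟩, hi,
      le_inf (hW i hi) fun y hy => ?_⟩
    · rw [← hφψ x hxE]
      exact (inf_eq_left.1 h) hxE
    · rw [LinearMap.mem_ker, hφψ y (hW i hi hy)]
      exact hψ (Submodule.mem_sup_right hy)
  have hcard : ((I.filter fun i => Z ⊔ W i ≠ E).card : ℝ) ≤ Φ'.card * (η * I.card) := by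
    calc _ ≤ ((Φ'.biUnion fun φ => I.filter fun i => W i ≤ E ⊓ φ.ker).card : ℝ) := by
          exact_mod_cast Finset.card_le_card hsub
      _ ≤ ∑ φ ∈ Φ', ((I.filter fun i => W i ≤ E ⊓ φ.ker).card : ℝ) := by
          exact_mod_cast Finset.card_biUnion_le
      _ ≤ ∑ φ ∈ Φ', η * I.card :=
          Finset.sum_le_sum fun φ hφ => hη _ (Finset.mem_filter.1 hφ).2
      _ = _ := by simp
  have hΦc : (Φ'.card : ℝ) ≤ (Fintype.card F : ℝ) ^ b := by
    exact_mod_cast (Finset.card_filter_le _ _).trans hΦ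
  exact hcard.trans (by gcongr)

open Classical in
/-- If no functional restricts to many of the `G i`, then few of the `G i` agree with `h` on
`Z ⊓ W i`. -/
lemma card_eq_on_inf_le (hW : ∀ i ∈ I, W i ≤ E)
    (hρ : ∀ g : Dual F V, ((I.filter fun i => ∀ x ∈ W i, g x = G i x).card : ℝ) ≤ ρ * I.card)
    {Z : Submodule F V} (hZ : Z ≤ E) {b : ℕ} (hb : finrank F Z + b = finrank F E)
    (h : Dual F V) :
    ((I.filter fun i => ∀ x ∈ W i, x ∈ Z → G i x = h x).card : ℝ) ≤
      (Fintype.card F : ℝ) ^ b * (ρ * I.card) := by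
  obtain ⟨Φ, hΦ, hΦ'⟩ := exists_finset_dual hZ hb
  have hsub : (I.filter fun i => ∀ x ∈ W i, x ∈ Z → G i x = h x) ⊆
      Φ.biUnion fun φ => I.filter fun i => ∀ x ∈ W i, (h + φ) x = G i x := by
    intro i hi
    obtain ⟨hi, hih⟩ := Finset.mem_filter.1 hi
    obtain ⟨ψ, hψZ, hψ⟩ := exists_dual_eq_of_eq_zero_on_inf (Z := Z) (W := W i) (f := G i - h)
      fun x hx hxZ => by simp [hih x hx hxZ]
    obtain ⟨φ, hφ, hφψ⟩ := hΦ' ψ hψZ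
    simp only [Finset.mem_biUnion, Finset.mem_filter]
    refine ⟨φ, hφ, hi, fun x hx => ?_⟩
    simp [hφψ x (hW i hi hx), hψ x hx]
  calc _ ≤ ((Φ.biUnion fun φ => I.filter fun i => ∀ x ∈ W i, (h + φ) x = G i x).card : ℝ) := by
        exact_mod_cast Finset.card_le_card hsub
    _ ≤ ∑ φ ∈ Φ, ((I.filter fun i => ∀ x ∈ W i, (h + φ) x = G i x).card : ℝ) := by
        exact_mod_cast Finset.card_biUnion_le
    _ ≤ ∑ φ ∈ Φ, ρ * I.card := Finset.sum_le_sum fun φ _ => hρ _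
    _ = Φ.card * (ρ * I.card) := by simp
    _ ≤ _ := by
        have : 0 ≤ ρ * I.card := (Nat.cast_nonneg _).trans (hρ 0)
        gcongr
        exact_mod_cast hΦ

open Classical in
lemma sum_pow_card_agree_le {r c : ℕ} {β : ℝ} {Om : Finset (Submodule F V)} {π : ℕ → ℝ}
    (hW : ∀ i ∈ I, W i ≤ E) (hr : ∀ i ∈ I, finrank F (W i) + r = finrank F E)
    (hη0 : 0 ≤ η) (hρ0 : 0 ≤ ρ)
    (hη : ∀ X < E, ((I.filter fun i => W i ≤ X).card : ℝ) ≤ η * I.card)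
    (hρ : ∀ g : Dual F V, ((I.filter fun i => ∀ x ∈ W i, g x = G i x).card : ℝ) ≤ ρ * I.card)
    (hβ : (Fintype.card F : ℝ) ^ c * (η + ρ) ≤ β) (hπ0 : ∀ n, 0 ≤ π n)
    (hπ : ∀ Z ≤ E, ∀ b, finrank F Z + b = finrank F E →
      ((Om.filter fun L => L ≤ Z).card : ℝ) ≤ π b * Om.card) (h : Dual F V) (j : ℕ) :
    ∀ (b : ℕ) (Z : Submodule F V), Z ≤ E → finrank F Z + b = finrank F E →
      b + j * (r + 1) ≤ c →
      ∑ L ∈ Om.filter fun L => L ≤ Z,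
        ((I.filter fun i => L ≤ W i ∧ ∀ x ∈ L, G i x = h x).card : ℝ) ^ j ≤
      (I.card : ℝ) ^ j * Om.card * (π (b + j * (r + 1)) + j * β) := by
  have hq1 : (1 : ℝ) ≤ Fintype.card F := by exact_mod_cast Fintype.card_pos
  have hβ0 : 0 ≤ β := le_trans (by positivity) hβ
  induction j with
  | zero =>
    intro b Z hZ hb _
    simpa [mul_comm] using hπ Z hZ b hb
  | succ j ih =>
    intro b Z hZ hb hc
    have hc' : b + (r + 1) + j * (r + 1) ≤ c := by linarith [add_mul j 1 (r + 1)]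
    set m : Submodule F V → ℝ := fun L =>
      ((I.filter fun i => L ≤ W i ∧ ∀ x ∈ L, G i x = h x).card : ℝ) with hm
    have hm0 (L) : 0 ≤ m L := Nat.cast_nonneg _
    have hmI (L) : m L ≤ I.card := Nat.cast_le.2 (Finset.card_filter_le _ _)
    set f : ι → ℝ := fun i => ∑ L ∈ Om.filter fun L => L ≤ agreeSub Z (W i) (G i) h, m L ^ j
      with hf
    have hswap : ∑ L ∈ Om.filter fun L => L ≤ Z, m L ^ (j + 1) = ∑ i ∈ I, f i := by
      have h1 (L) : m L ^ (j + 1) =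
          ∑ i ∈ I, if L ≤ W i ∧ ∀ x ∈ L, G i x = h x then m L ^ j else 0 := by
        rw [← Finset.sum_filter, Finset.sum_const, nsmul_eq_mul, pow_succ']
      simp_rw [h1]
      rw [Finset.sum_comm]
      refine Finset.sum_congr rfl fun i _ => ?_
      rw [hf, ← Finset.sum_filter, Finset.filter_filter]
      refine Finset.sum_congr (Finset.filter_congr fun L _ => ?_) fun _ _ => rfl
      constructor
      · rintro ⟨h1, h2, h3⟩
        exact le_inf (le_inf h1 h2) fun x hx => by simp [h3 x hx]
      · intro h1
        refine ⟨h1.trans (inf_le_left.trans inf_le_left),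
          h1.trans (inf_le_left.trans inf_le_right), fun x hx => ?_⟩
        have := (h1 hx).2
        simpa [sub_eq_zero] using this
    set bad : Finset ι := (I.filter fun i => Z ⊔ W i ≠ E) ∪
      (I.filter fun i => ∀ x ∈ W i, x ∈ Z → G i x = h x) with hbad
    have hbadcard : (bad.card : ℝ) ≤ β * I.card := by
      calc (bad.card : ℝ) ≤ ((I.filter fun i => Z ⊔ W i ≠ E).card : ℝ) +
            (I.filter fun i => ∀ x ∈ W i, x ∈ Z → G i x = h x).card := by
            exact_mod_cast Finset.card_union_le _ _
        _ ≤ (Fintype.card F : ℝ) ^ b * (η * I.card) + (Fintype.card F : ℝ) ^ b * (ρ * I.card) :=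
            add_le_add (card_sup_ne_le hW hη0 hη hZ hb) (card_eq_on_inf_le hW hρ hZ hb h)
        _ = (Fintype.card F : ℝ) ^ b * (η + ρ) * I.card := by ring
        _ ≤ (Fintype.card F : ℝ) ^ c * (η + ρ) * I.card := by
            have hbc : b ≤ c := by omega
            gcongr
        _ ≤ _ := by gcongr
    have hfbad (i) : f i ≤ (I.card : ℝ) ^ j * Om.card := by
      calc f i ≤ ∑ L ∈ Om.filter fun L => L ≤ agreeSub Z (W i) (G i) h, (I.card : ℝ) ^ j :=
            Finset.sum_le_sum fun L _ => pow_le_pow_left₀ (hm0 L) (hmI L) j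
        _ = ((Om.filter fun L => L ≤ agreeSub Z (W i) (G i) h).card : ℝ) * (I.card : ℝ) ^ j := by
            simp
        _ ≤ (Om.card : ℝ) * (I.card : ℝ) ^ j := by
            gcongr
            exact Finset.filter_subset _ _
        _ = _ := by ring
    set D := (I.card : ℝ) ^ j * Om.card * (π (b + (j + 1) * (r + 1)) + j * β) with hD
    have hD0 : 0 ≤ D := by have := hπ0 (b + (j + 1) * (r + 1)); positivity
    have hfgood (i) (hi : i ∈ I) (hib : i ∉ bad) : f i ≤ D := by
      simp only [hbad, Finset.mem_union, Finset.mem_filter, hi, true_and, not_or, not_not] at hib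
      have := ih (b + (r + 1)) (agreeSub Z (W i) (G i) h)
        (inf_le_left.trans (inf_le_left.trans hZ)) (finrank_agreeSub hib.1 hib.2 hb (hr i hi)) hc'
      rw [hD, show b + (j + 1) * (r + 1) = b + (r + 1) + j * (r + 1) by ring]
      exact this
    rw [hswap]
    calc ∑ i ∈ I, f i ≤ ∑ i ∈ I, (D + if i ∈ bad then (I.card : ℝ) ^ j * Om.card else 0) := by
          refine Finset.sum_le_sum fun i hi => ?_
          split_ifs with hib
          · linarith [hfbad i]
          · linarith [hfgood i hi hib]
      _ = I.card * D + bad.card * ((I.card : ℝ) ^ j * Om.card) := by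
          rw [Finset.sum_add_distrib, ← Finset.sum_filter, Finset.filter_mem_eq_inter,
            Finset.inter_eq_right.2 (Finset.union_subset (Finset.filter_subset _ _)
              (Finset.filter_subset _ _))]
          simp only [Finset.sum_const, nsmul_eq_mul]
          rfl
      _ ≤ I.card * D + β * I.card * ((I.card : ℝ) ^ j * Om.card) := by gcongr
      _ = _ := by rw [hD]; push_cast; ring

open Classical in
/-- If every `G i` agrees with `τ` on a fraction `C` of the subspaces in `W i`, the moment of order
`j + 1` of the number of agreements bounds `C`. -/
lemma pow_mul_le_of_agree {r : ℕ} {β C : ℝ} {Om : Finset (Submodule F V)} {π : ℕ → ℝ}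
    {τ : Submodule F V → Dual F V}
    (hW : ∀ i ∈ I, W i ≤ E) (hr : ∀ i ∈ I, finrank F (W i) + r = finrank F E)
    (hη0 : 0 ≤ η) (hρ0 : 0 ≤ ρ)
    (hη : ∀ X < E, ((I.filter fun i => W i ≤ X).card : ℝ) ≤ η * I.card)
    (hρ : ∀ g : Dual F V, ((I.filter fun i => ∀ x ∈ W i, g x = G i x).card : ℝ) ≤ ρ * I.card)
    (j : ℕ) (hβ : (Fintype.card F : ℝ) ^ (r + j * (r + 1)) * (η + ρ) ≤ β)
    (hπ0 : ∀ n, 0 ≤ π n)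
    (hπ : ∀ Z ≤ E, ∀ b, finrank F Z + b = finrank F E →
      ((Om.filter fun L => L ≤ Z).card : ℝ) ≤ π b * Om.card)
    (hC0 : 0 ≤ C)
    (hC : ∀ i ∈ I, C * (π r * Om.card) ≤
      (Om.filter fun L => L ≤ W i ∧ ∀ x ∈ L, G i x = τ L x).card)
    (hI : I.Nonempty) (hOm : Om.Nonempty) :
    (C * π r) ^ (j + 1) ≤ π (r + j * (r + 1)) + j * β := by
  have hI0 : (0 : ℝ) < I.card := by exact_mod_cast hI.card_pos
  have hOm0 : (0 : ℝ) < Om.card := by exact_mod_cast hOm.card_pos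
  set X : Submodule F V → ℝ := fun L =>
    ((I.filter fun i => L ≤ W i ∧ ∀ x ∈ L, G i x = τ L x).card : ℝ) with hX
  have hX0 (L) : 0 ≤ X L := Nat.cast_nonneg _
  have hswap (n : ℕ) : ∑ L ∈ Om, X L ^ (n + 1) =
      ∑ i ∈ I, ∑ L ∈ Om.filter fun L => L ≤ W i ∧ ∀ x ∈ L, G i x = τ L x, X L ^ n := by
    have h1 (L) : X L ^ (n + 1) =
        ∑ i ∈ I, if L ≤ W i ∧ ∀ x ∈ L, G i x = τ L x then X L ^ n else 0 := by
      rw [← Finset.sum_filter, Finset.sum_const, nsmul_eq_mul, pow_succ']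
    simp_rw [h1]
    rw [Finset.sum_comm]
    exact Finset.sum_congr rfl fun i _ => (Finset.sum_filter _ _).symm
  have hlow : I.card * (C * (π r * Om.card)) ≤ ∑ L ∈ Om, X L := by
    have := hswap 0
    simp only [zero_add, pow_one, pow_zero, Finset.sum_const, nsmul_eq_mul, mul_one] at this
    rw [this, ← nsmul_eq_mul]
    exact Finset.card_nsmul_le_sum _ _ _ hC
  have hup : ∑ L ∈ Om, X L ^ (j + 1) ≤
      I.card * ((I.card : ℝ) ^ j * Om.card * (π (r + j * (r + 1)) + j * β)) := by
    rw [hswap j, ← nsmul_eq_mul]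
    refine Finset.sum_le_card_nsmul _ _ _ fun i hi => ?_
    refine le_trans ?_ (sum_pow_card_agree_le hW hr hη0 hρ0 hη hρ hβ hπ0 hπ (G i) j r (W i)
      (hW i hi) (hr i hi) le_rfl)
    refine (Finset.sum_le_sum fun L hL => ?_).trans (Finset.sum_le_sum_of_subset_of_nonneg
      (Finset.monotone_filter_right _ fun L _ hL => hL.1) fun _ _ _ => by positivity)
    refine pow_le_pow_left₀ (hX0 L) (Nat.cast_le.2 (Finset.card_le_card ?_)) j
    refine Finset.monotone_filter_right _ fun i' _ hi' => ⟨hi'.1, fun x hx => ?_⟩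
    rw [hi'.2 x hx, (Finset.mem_filter.1 hL).2.2 x hx]
  have hmean := pow_sum_div_card_le_sum_pow (s := Om) (fun L _ => hX0 L) j
  rw [div_le_iff₀ (by positivity)] at hmean
  have hπr := hπ0 r
  have h1 : (I.card * (C * (π r * Om.card))) ^ (j + 1) ≤
      I.card * ((I.card : ℝ) ^ j * Om.card * (π (r + j * (r + 1)) + j * β)) *
        (Om.card : ℝ) ^ j :=
    (pow_le_pow_left₀ (by positivity) hlow _).trans (hmean.trans (by gcongr))
  have h2 : (I.card * (C * (π r * Om.card))) ^ (j + 1) =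
      (C * π r) ^ (j + 1) * ((I.card : ℝ) ^ (j + 1) * (Om.card : ℝ) ^ (j + 1)) := by ring
  have h3 : I.card * ((I.card : ℝ) ^ j * Om.card * (π (r + j * (r + 1)) + j * β)) *
      (Om.card : ℝ) ^ j =
      (π (r + j * (r + 1)) + j * β) * ((I.card : ℝ) ^ (j + 1) * (Om.card : ℝ) ^ (j + 1)) := by ring
  rw [h2, h3] at h1
  exact le_of_mul_le_mul_right h1 (by positivity)

end Moments

section SecondMoment

variable {F V ι : Type*} [Field F] [AddCommGroup V] [Module F V]
  {W : ι → Submodule F V} {G : ι → Dual F V}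

open Classical in
/-- If `g` restricts to `G i` on `W i` for `i ∈ J`, and each of these agrees with `τ` on a fraction
`C`, then so does `g`, up to a constant factor: this is a second moment argument. -/
lemma le_card_agree {p ε C : ℝ} {Om : Finset (Submodule F V)}
    {τ : Submodule F V → Dual F V} {J : Finset ι} {g : Dual F V}
    (hp0 : 0 ≤ p)
    (hp : ∀ i ∈ J, ((Om.filter fun L => L ≤ W i).card : ℝ) = p * Om.card)
    (hpp : ∀ i ∈ J, ((J.filter fun i' => ¬
      ((Om.filter fun L => L ≤ W i ∧ L ≤ W i').card : ℝ) ≤ p ^ 2 * Om.card).card : ℝ) ≤ ε * J.card)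
    (hg : ∀ i ∈ J, ∀ x ∈ W i, g x = G i x) (hC0 : 0 < C)
    (hC : ∀ i ∈ J, C * (p * Om.card) ≤
      (Om.filter fun L => L ≤ W i ∧ ∀ x ∈ L, G i x = τ L x).card)
    (hε : ε < C * p ^ 2) (hJ : J.Nonempty) (hOm : Om.Nonempty) :
    1 / 5 * C * Om.card ≤ (Om.filter fun L => ∀ x ∈ L, g x = τ L x).card := by
  have hJ0 : (0 : ℝ) < J.card := by exact_mod_cast hJ.card_pos
  have hOm0 : (0 : ℝ) < Om.card := by exact_mod_cast hOm.card_pos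
  by_contra! hlt
  set S := Om.filter fun L => ∀ x ∈ L, g x = τ L x with hS
  set Y : Submodule F V → ℝ := fun L => ((J.filter fun i => L ≤ W i).card : ℝ) with hY
  have hYsum (L) : Y L = ∑ i ∈ J, if L ≤ W i then (1 : ℝ) else 0 := by simp [hY]
  have hsum1 : ∑ L ∈ Om, Y L = J.card * (p * Om.card) := by
    simp_rw [hYsum]
    rw [Finset.sum_comm, Finset.sum_congr rfl (g := fun _ => p * Om.card)]
    · simp
    · intro i hi
      rw [← hp i hi]
      simp
  have hsum2 : ∑ L ∈ Om, Y L ^ 2 ≤ (J.card : ℝ) ^ 2 * Om.card * (p ^ 2 + ε) := by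
    have h1 (L) : Y L ^ 2 = ∑ i ∈ J, ∑ i' ∈ J, if L ≤ W i ∧ L ≤ W i' then (1 : ℝ) else 0 := by
      rw [sq, hYsum, Finset.sum_mul_sum]
      refine Finset.sum_congr rfl fun i _ => Finset.sum_congr rfl fun i' _ => ?_
      split_ifs <;> simp_all
    simp_rw [h1]
    rw [Finset.sum_comm]
    calc _ ≤ ∑ i ∈ J, J.card * Om.card * (p ^ 2 + ε) := by
          refine Finset.sum_le_sum fun i hi => ?_
          rw [Finset.sum_comm]
          calc _ ≤ ∑ i' ∈ J, (p ^ 2 * Om.card + if ¬ ((Om.filter fun L => L ≤ W i ∧ L ≤ W i').card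
                  : ℝ) ≤ p ^ 2 * Om.card then (Om.card : ℝ) else 0) := by
                refine Finset.sum_le_sum fun i' _ => ?_
                rw [Finset.sum_boole]
                by_cases h : ((Om.filter fun L => L ≤ W i ∧ L ≤ W i').card : ℝ) ≤ p ^ 2 * Om.card
                · rw [if_neg (not_not.2 h), add_zero]
                  exact h
                · rw [if_pos h]
                  have : ((Om.filter fun L => L ≤ W i ∧ L ≤ W i').card : ℝ) ≤ Om.card :=
                    Nat.cast_le.2 (Finset.card_filter_le _ _)
                  have : 0 ≤ p ^ 2 * Om.card := by positivity
                  linarith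
            _ = J.card * (p ^ 2 * Om.card) + (J.filter fun i' => ¬ ((Om.filter fun L => L ≤ W i ∧
                  L ≤ W i').card : ℝ) ≤ p ^ 2 * Om.card).card * Om.card := by
                rw [Finset.sum_add_distrib, ← Finset.sum_filter]
                simp
            _ ≤ J.card * (p ^ 2 * Om.card) + ε * J.card * Om.card := by
                gcongr
                exact hpp i hi
            _ = _ := by ring
      _ = _ := by simp; ring
  have hlow : J.card * (C * (p * Om.card)) ≤ ∑ L ∈ S, Y L := by
    simp_rw [hYsum]
    rw [Finset.sum_comm, ← nsmul_eq_mul]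
    refine Finset.card_nsmul_le_sum _ _ _ fun i hi => (hC i hi).trans ?_
    rw [Finset.sum_boole]
    refine Nat.cast_le.2 (Finset.card_le_card fun L hL => ?_)
    simp only [hS, Finset.mem_filter] at hL ⊢
    exact ⟨⟨hL.1, fun x hx => by rw [hg i hi x (hL.2.1 hx), hL.2.2 x hx]⟩, hL.2.1⟩
  have hvar : ∑ L ∈ Om, (Y L - J.card * p) ^ 2 ≤ (J.card : ℝ) ^ 2 * Om.card * ε := by
    have : ∑ L ∈ Om, (Y L - J.card * p) ^ 2 =
        ∑ L ∈ Om, Y L ^ 2 - 2 * (J.card * p) * ∑ L ∈ Om, Y L + Om.card * (J.card * p) ^ 2 := by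
      have h1 (L) : (Y L - J.card * p) ^ 2 =
          Y L ^ 2 - 2 * (J.card * p) * Y L + (J.card * p) ^ 2 := by ring
      simp_rw [h1]
      rw [Finset.sum_add_distrib, Finset.sum_sub_distrib, ← Finset.mul_sum, Finset.sum_const _,
        nsmul_eq_mul]
    rw [this, hsum1]
    nlinarith [hsum2]
  have hcs : (∑ L ∈ S, (Y L - J.card * p)) ^ 2 ≤
      S.card * ((J.card : ℝ) ^ 2 * Om.card * ε) := by
    refine sq_sum_le_card_mul_sum_sq.trans ?_
    gcongr
    refine (Finset.sum_le_sum_of_subset_of_nonneg (Finset.filter_subset _ _)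
      fun _ _ _ => by positivity).trans hvar
  have hε0 : 0 ≤ ε := by
    obtain ⟨i, hi⟩ := hJ
    exact nonneg_of_mul_nonneg_left ((Nat.cast_nonneg _).trans (hpp i hi)) hJ0
  have hp1 : 0 < p := by
    refine lt_of_le_of_ne hp0 fun h => ?_
    rw [← h] at hε
    norm_num at hε
    linarith
  have hdiff : J.card * p * Om.card * (4 / 5 * C) ≤ ∑ L ∈ S, (Y L - J.card * p) := by
    rw [Finset.sum_sub_distrib, Finset.sum_const, nsmul_eq_mul]
    have : S.card * (J.card * p) ≤ 1 / 5 * C * Om.card * (J.card * p) := by gcongr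
    linarith
  have h1 : (J.card * p * Om.card * (4 / 5 * C)) ^ 2 ≤
      1 / 5 * C * Om.card * ((J.card : ℝ) ^ 2 * Om.card * ε) :=
    (pow_le_pow_left₀ (by positivity) hdiff 2).trans (hcs.trans (by gcongr))
  have h2 : 1 / 5 * C * Om.card * ((J.card : ℝ) ^ 2 * Om.card * ε) <
      1 / 5 * C * Om.card * ((J.card : ℝ) ^ 2 * Om.card * (C * p ^ 2)) := by gcongr
  have h3 : 0 < ((J.card : ℝ) * p * Om.card * C) ^ 2 := by positivity
  nlinarith [h1, h2, h3]

end SecondMoment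

section Numeric

variable {Q C P : ℝ} {d ℓ r : ℕ}

lemma moment_bound_false {j k s : ℕ} (hQ : 2 ≤ Q) (hd : j + 1 = d) (hℓ : 3 * d ^ 2 + 1 ≤ ℓ)
    (hC : 0 < C) (hCd : Q ^ (4 * ℓ) ≤ (C * Q ^ (2 * ℓ)) ^ d) (hP : 0 < P)
    (hP1 : 1 ≤ P * Q ^ (8 * d * ℓ)) (hr : r ≤ 3 * d) (hs : s ≤ 3 * d) (hk : s + k = 2 * ℓ)
    (h : (C * P) ^ (j + 1) ≤ P ^ (j + 1) * ((Q ^ k)⁻¹) ^ j +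
      j * (Q ^ (r + j * (r + 1)) * ((Q ^ (50 * d ^ 2 * ℓ))⁻¹ + (Q ^ (20 * d ^ 2 * ℓ))⁻¹))) :
    False := by
  have hQ0 : 0 < Q := by linarith
  have hQ1 : 1 ≤ Q := by linarith
  rw [hd] at h
  have hd1 : 1 ≤ d := by omega
  have h1 : 2 * (Q ^ (k * j))⁻¹ ≤ C ^ d := by
    have he : 1 + 2 * ℓ * d ≤ 4 * ℓ + k * j := by
      subst hd
      nlinarith [Nat.mul_le_mul_right j hs]
    have h2 : 2 * Q ^ (2 * ℓ * d) ≤ C ^ d * Q ^ (2 * ℓ * d) * Q ^ (k * j) := by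
      calc 2 * Q ^ (2 * ℓ * d) ≤ Q * Q ^ (2 * ℓ * d) := by gcongr
        _ = Q ^ (1 + 2 * ℓ * d) := by rw [pow_add, pow_one]
        _ ≤ Q ^ (4 * ℓ + k * j) := pow_le_pow_right₀ hQ1 he
        _ = Q ^ (4 * ℓ) * Q ^ (k * j) := pow_add _ _ _
        _ ≤ (C * Q ^ (2 * ℓ)) ^ d * Q ^ (k * j) := by gcongr
        _ = _ := by rw [mul_pow, ← pow_mul]
    rw [← div_eq_mul_inv, div_le_iff₀ (by positivity)]
    refine le_of_mul_le_mul_right ?_ (by positivity : 0 < Q ^ (2 * ℓ * d))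
    linarith
  have h2 : P ^ d * ((Q ^ k)⁻¹) ^ j ≤ (C * P) ^ d / 2 := by
    rw [inv_pow, ← pow_mul, mul_pow]
    have : 0 < P ^ d := by positivity
    nlinarith
  have h3 : 1 ≤ (C * P) ^ d * Q ^ (10 * d ^ 2 * ℓ) := by
    have h4 : 1 ≤ (C * Q ^ (2 * ℓ)) ^ d := (one_le_pow₀ hQ1).trans hCd
    have h5 : 1 ≤ (P * Q ^ (8 * d * ℓ)) ^ d := one_le_pow₀ hP1
    calc (1 : ℝ) ≤ (C * Q ^ (2 * ℓ)) ^ d * (P * Q ^ (8 * d * ℓ)) ^ d :=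
          one_le_mul_of_one_le_of_one_le h4 h5
      _ = (C * P) ^ d * Q ^ (2 * ℓ * d + 8 * d * ℓ * d) := by
          rw [pow_add, pow_mul Q (2 * ℓ) d, pow_mul Q (8 * d * ℓ) d]; ring
      _ ≤ _ := by
          gcongr
          nlinarith [Nat.mul_le_mul_left (d * ℓ) hd1]
  have h6 : (4 * j : ℝ) * Q ^ (r + j * (r + 1)) < Q ^ (10 * d ^ 2 * ℓ) := by
    have hj : (j : ℝ) < Q ^ d := by
      calc (j : ℝ) < 2 ^ d := by
            exact_mod_cast (by omega : j ≤ d).trans_lt Nat.lt_two_pow_self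
        _ ≤ Q ^ d := by gcongr
    calc (4 * j : ℝ) * Q ^ (r + j * (r + 1)) < Q ^ 2 * Q ^ d * Q ^ (r + j * (r + 1)) := by
          have : (4 : ℝ) ≤ Q ^ 2 := by nlinarith
          refine mul_lt_mul_of_pos_right ?_ (by positivity)
          calc (4 * j : ℝ) ≤ Q ^ 2 * j := by gcongr
            _ < Q ^ 2 * Q ^ d := by gcongr
      _ = Q ^ (2 + d + (r + j * (r + 1))) := by rw [pow_add Q (2 + d), pow_add Q 2]
      _ ≤ _ := by
          refine pow_le_pow_right₀ hQ1 ?_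
          have : r + j * (r + 1) ≤ 3 * d ^ 2 + d := by
            subst hd
            nlinarith [Nat.mul_le_mul_left j hr]
          nlinarith [Nat.mul_le_mul_left (d ^ 2) (by omega : 1 ≤ ℓ), Nat.mul_le_mul_left d hd1]
  have h7 : (Q ^ (50 * d ^ 2 * ℓ))⁻¹ + (Q ^ (20 * d ^ 2 * ℓ))⁻¹ ≤
      2 * (Q ^ (20 * d ^ 2 * ℓ))⁻¹ := by
    have : (Q ^ (50 * d ^ 2 * ℓ))⁻¹ ≤ (Q ^ (20 * d ^ 2 * ℓ))⁻¹ := by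
      gcongr
      norm_num
    linarith
  have h8 : j * (Q ^ (r + j * (r + 1)) * ((Q ^ (50 * d ^ 2 * ℓ))⁻¹ + (Q ^ (20 * d ^ 2 * ℓ))⁻¹)) <
      (C * P) ^ d / 2 := by
    set Y := Q ^ (10 * d ^ 2 * ℓ) with hY
    have hY0 : 0 < Y := by positivity
    have hYY : Q ^ (20 * d ^ 2 * ℓ) = Y * Y := by rw [hY, ← pow_add]; congr 1; ring
    rw [hYY] at h7 ⊢
    calc _ ≤ j * (Q ^ (r + j * (r + 1)) * (2 * (Y * Y)⁻¹)) := by gcongr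
      _ = (4 * j : ℝ) * Q ^ (r + j * (r + 1)) * (Y * Y)⁻¹ / 2 := by ring
      _ < Y * (Y * Y)⁻¹ / 2 := by gcongr
      _ = Y⁻¹ / 2 := by field_simp
      _ ≤ _ := by
        gcongr
        rw [inv_le_iff_one_le_mul₀ hY0]
        linarith
  linarith

lemma variance_bound (hQ : 2 ≤ Q) (hd : 1 ≤ d) (hℓ : 3 * d ^ 2 + 1 ≤ ℓ)
    (hC1 : 1 ≤ C * Q ^ (2 * ℓ)) (hP1 : 1 ≤ P * Q ^ (8 * d * ℓ)) (hr : r ≤ 3 * d) :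
    Q ^ r * ((Q ^ (50 * d ^ 2 * ℓ))⁻¹ * Q ^ (20 * d ^ 2 * ℓ)) < C * P ^ 2 := by
  have hQ0 : 0 < Q := by linarith
  have h1 : 1 ≤ C * P ^ 2 * Q ^ (2 * ℓ + 16 * d * ℓ) := by
    calc (1 : ℝ) ≤ C * Q ^ (2 * ℓ) * (P * Q ^ (8 * d * ℓ)) ^ 2 :=
          one_le_mul_of_one_le_of_one_le hC1 (one_le_pow₀ hP1)
      _ = _ := by
        rw [pow_add, show 16 * d * ℓ = (8 * d * ℓ) * 2 by ring, pow_mul Q (8 * d * ℓ) 2]; ring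
  have h2 : Q ^ (r + 20 * d ^ 2 * ℓ + (2 * ℓ + 16 * d * ℓ)) < Q ^ (50 * d ^ 2 * ℓ) := by
    refine pow_lt_pow_right₀ (by linarith) ?_
    nlinarith [Nat.mul_le_mul_left (d * ℓ) hd, Nat.mul_le_mul_left ℓ hd,
      Nat.mul_le_mul_left d hd, Nat.mul_le_mul_left (d ^ 2) (by omega : 1 ≤ ℓ)]
  have h3 : 0 < Q ^ (2 * ℓ + 16 * d * ℓ) := by positivity
  refine lt_of_mul_lt_mul_right ?_ h3.le
  refine lt_of_lt_of_le ?_ h1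
  have h4 : Q ^ r * ((Q ^ (50 * d ^ 2 * ℓ))⁻¹ * Q ^ (20 * d ^ 2 * ℓ)) *
      Q ^ (2 * ℓ + 16 * d * ℓ) =
      Q ^ (r + 20 * d ^ 2 * ℓ + (2 * ℓ + 16 * d * ℓ)) / Q ^ (50 * d ^ 2 * ℓ) := by
    rw [pow_add Q (r + _), pow_add Q r]; ring
  rw [h4, div_lt_one (by positivity)]
  exact h2

end Numeric

section Count

variable {F V ι : Type*} [Field F] [AddCommGroup V] [Module F V] [Finite V]
  {I : Finset ι} {W : ι → Submodule F V} {G : ι → Dual F V} {E Q : Submodule F V} {C : ℝ}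
  {d ℓ r : ℕ} {τ : Submodule F V → Dual F V}

open Classical in
/-- Some `E` contains many of the `W i`, but each proper subspace of `E` contains few of those. -/
lemma exists_concentrated (I : Finset ι) (W : ι → Submodule F V) {M : ℝ} (hM : 1 ≤ M) :
    ∃ E : Submodule F V,
      (I.card : ℝ) ≤ (I.filter fun i => W i ≤ E).card * M ^ (finrank F V - finrank F E) ∧
      ∀ X < E, (((I.filter fun i => W i ≤ E).filter fun i => W i ≤ X).card : ℝ) ≤
        M⁻¹ * (I.filter fun i => W i ≤ E).card := by
  have hM0 : 0 < M := by linarith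
  obtain ⟨E, hE, hmin⟩ := (wellFounded_lt (α := Submodule F V)).has_min
    {E | (I.card : ℝ) ≤ (I.filter fun i => W i ≤ E).card * M ^ (finrank F V - finrank F E)}
    ⟨⊤, by simp⟩
  refine ⟨E, hE, fun X hX => ?_⟩
  have h1 := hmin X
  simp only [Set.mem_ofPred_eq] at h1 hE
  have h2 : ((I.filter fun i => W i ≤ X).card : ℝ) * M ^ (finrank F V - finrank F X) < I.card :=
    lt_of_not_ge fun h => h1 h hX
  have h3 := Submodule.finrank_lt_finrank_of_lt hX
  have h4 := Submodule.finrank_le E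
  have h5 : (((I.filter fun i => W i ≤ E).filter fun i => W i ≤ X).card : ℝ) ≤
      (I.filter fun i => W i ≤ X).card := by
    refine Nat.cast_le.2 (Finset.card_le_card ?_)
    exact Finset.filter_subset_filter _ (Finset.filter_subset _ _)
  rw [le_inv_mul_iff₀ hM0]
  refine le_of_mul_le_mul_right ?_
    (by positivity : 0 < M ^ (finrank F V - finrank F E))
  calc _ ≤ M * (I.filter fun i => W i ≤ X).card * M ^ (finrank F V - finrank F E) := by gcongr
    _ = (I.filter fun i => W i ≤ X).card * M ^ (finrank F V - finrank F E + 1) := by ring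
    _ ≤ (I.filter fun i => W i ≤ X).card * M ^ (finrank F V - finrank F X) := by
        gcongr
        omega
    _ ≤ _ := h2.le.trans hE

open Classical in
lemma filter_zoomSet_le {Z : Submodule F V} (hZ : Z ≤ E) (s : ℕ) :
    ((zoomSet Q E s).filter fun L => L ≤ Z) = zoomSet Q Z s := by
  ext L
  simp only [Finset.mem_filter, mem_zoomSet]
  exact ⟨fun h => ⟨h.1.1, h.1.2.1, h.2⟩, fun h => ⟨⟨h.1, h.2.1, h.2.2.trans hZ⟩, h.2.2⟩⟩

variable [Fintype F]

open Classical in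
lemma false_of_concentrated (hd : 1 ≤ d) (hℓ : 3 * d ^ 2 + 1 ≤ ℓ) (hr : r ≤ 3 * d)
    (hQ : finrank F Q ≤ 3 * d) (hC0 : 0 < C)
    (hCd : (Fintype.card F : ℝ) ^ (4 * ℓ) ≤ (C * (Fintype.card F : ℝ) ^ (2 * ℓ)) ^ d)
    (hC1 : 1 ≤ C * (Fintype.card F : ℝ) ^ (2 * ℓ))
    (hQW : ∀ i ∈ I, Q ≤ W i) (hW : ∀ i ∈ I, W i ≤ E)
    (hWr : ∀ i ∈ I, finrank F (W i) + r = finrank F E)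
    (hne : ∀ i ∈ I, (zoomSet Q (W i) (2 * ℓ)).Nonempty)
    (hC : ∀ i ∈ I, C * (zoomSet Q (W i) (2 * ℓ)).card ≤
      ((zoomSet Q (W i) (2 * ℓ)).filter fun L => ∀ x ∈ L, G i x = τ L x).card)
    (hmax : ∀ i ∈ I, ∀ E > W i, ∀ g : Dual F V, (∀ x ∈ W i, g x = G i x) →
      (((zoomSet Q E (2 * ℓ)).filter fun L => ∀ x ∈ L, g x = τ L x).card : ℝ) <
        1 / 5 * C * (zoomSet Q E (2 * ℓ)).card)
    (hinj : ∀ i ∈ I, ∀ j ∈ I, W i = W j → (∀ x ∈ W i, G i x = G j x) → i = j)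
    (hη : ∀ X < E, ((I.filter fun i => W i ≤ X).card : ℝ) ≤
      ((Fintype.card F : ℝ) ^ (50 * d ^ 2 * ℓ))⁻¹ * I.card)
    (hI : (Fintype.card F : ℝ) ^ (50 * d ^ 2 * ℓ) ≤ I.card) : False := by
  have hq : 2 ≤ Fintype.card F := Fintype.one_lt_card
  have hq' : (2 : ℝ) ≤ Fintype.card F := by exact_mod_cast hq
  set q : ℝ := (Fintype.card F : ℝ) with hqdef
  have hI0 : (0 : ℝ) < I.card := lt_of_lt_of_le (by positivity) hI
  have hIne : I.Nonempty := Finset.card_pos.1 (by exact_mod_cast hI0)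
  obtain ⟨k, hk⟩ : ∃ k, finrank F Q + k = 2 * ℓ :=
    Nat.exists_eq_add_of_le (by nlinarith) |>.imp fun _ h => h.symm
  have hdim : k + r ≤ finrank F E - finrank F Q := by
    obtain ⟨i, hi⟩ := hIne
    obtain ⟨L, hL⟩ := hne i hi
    rw [mem_zoomSet] at hL
    have := Submodule.finrank_mono hL.2.2
    have := hWr i hi
    omega
  have hQE : Q ≤ E := by
    obtain ⟨i, hi⟩ := hIne
    exact (hQW i hi).trans (hW i hi)
  set e := finrank F E - finrank F Q
  set Om := zoomSet Q E (2 * ℓ) with hOm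
  have hOmne : Om.Nonempty := by
    obtain ⟨i, hi⟩ := hIne
    obtain ⟨L, hL⟩ := hne i hi
    rw [mem_zoomSet] at hL
    exact ⟨L, mem_zoomSet.2 ⟨hL.1, hL.2.1, hL.2.2.trans (hW i hi)⟩⟩
  have hOm0 : (0 : ℝ) < Om.card := by exact_mod_cast hOmne.card_pos
  set π := zoomRatio (Fintype.card F) e k with hπdef
  have hπle : ∀ Z ≤ E, ∀ b, finrank F Z + b = finrank F E →
      ((Om.filter fun L => L ≤ Z).card : ℝ) ≤ π b * Om.card := by
    intro Z hZ b hb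
    rw [hOm, filter_zoomSet_le hZ, ← hk]
    exact card_zoomSet_le hZ hb (by omega)
  have hπeq : ∀ i ∈ I, ((zoomSet Q (W i) (2 * ℓ)).card : ℝ) = π r * Om.card := by
    intro i hi
    rw [hOm, ← hk]
    exact card_zoomSet_eq (hQW i hi) (hW i hi) (hWr i hi) (by omega)
  have hagree : ∀ i ∈ I, C * (π r * Om.card) ≤
      (Om.filter fun L => L ≤ W i ∧ ∀ x ∈ L, G i x = τ L x).card := by
    intro i hi
    rw [← hπeq i hi, ← Finset.filter_filter, hOm, filter_zoomSet_le (hW i hi)]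
    exact hC i hi
  have hP1 : 1 ≤ π r * q ^ (8 * d * ℓ) := by
    have h1 : (q ^ ((r + 1) * k))⁻¹ ≤ π r := le_zoomRatio hq hdim
    have h2 : q ^ ((r + 1) * k) ≤ q ^ (8 * d * ℓ) := by
      refine pow_le_pow_right₀ (by linarith) ?_
      calc (r + 1) * k ≤ (4 * d) * (2 * ℓ) := Nat.mul_le_mul (by omega) (by omega)
        _ = _ := by ring
    rw [inv_le_iff_one_le_mul₀ (by positivity)] at h1
    have := zoomRatio_nonneg (Fintype.card F) e k r
    exact h1.trans (by gcongr)
  have hP0 : 0 < π r := by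
    by_contra! h
    have : π r * q ^ (8 * d * ℓ) ≤ 0 := mul_nonpos_of_nonpos_of_nonneg h (by positivity)
    linarith
  by_cases hρ : ∀ g : Dual F V, ((I.filter fun i => ∀ x ∈ W i, g x = G i x).card : ℝ) ≤
      (q ^ (20 * d ^ 2 * ℓ))⁻¹ * I.card
  · obtain ⟨j, rfl⟩ := Nat.exists_eq_add_of_le' hd
    have h := pow_mul_le_of_agree hW hWr (by positivity) (by positivity) hη hρ j le_rfl
      (zoomRatio_nonneg _ _ _) hπle hC0.le hagree hIne hOmne
    refine moment_bound_false hq' rfl hℓ hC0 hCd hP0 hP1 hr hQ hk (h.trans ?_)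
    gcongr
    calc π (r + j * (r + 1)) ≤ π r * π (r + 1) ^ j := zoomRatio_mul_le hq (by omega) _ _ _
      _ ≤ π r * (π r * (q ^ k)⁻¹) ^ j := by
        have h1 := zoomRatio_add_le hq (by omega : k ≤ e) r 1
        have h2 := zoomRatio_one_le hq (by omega : k ≤ e)
        have h3 := zoomRatio_nonneg (Fintype.card F) e k (r + 1)
        gcongr
        exact h1.trans (by gcongr)
      _ = _ := by ring
  · push Not at hρ
    obtain ⟨g, hg⟩ := hρ
    set J := I.filter fun i => ∀ x ∈ W i, g x = G i x with hJ
    have hJI : J ⊆ I := Finset.filter_subset _ _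
    have hJg : ∀ i ∈ J, ∀ x ∈ W i, g x = G i x := fun i hi => (Finset.mem_filter.1 hi).2
    have hIJ : (I.card : ℝ) ≤ q ^ (20 * d ^ 2 * ℓ) * J.card := by
      rw [inv_mul_lt_iff₀ (by positivity)] at hg
      exact hg.le
    have hJ1 : (1 : ℝ) < J.card := by
      have h1 : q ^ (20 * d ^ 2 * ℓ) * 1 < q ^ (20 * d ^ 2 * ℓ) * J.card := by
        refine lt_of_lt_of_le ?_ (hI.trans hIJ)
        rw [mul_one]
        refine pow_lt_pow_right₀ (by linarith) ?_
        have : 0 < d ^ 2 * ℓ := Nat.mul_pos (by positivity) (by omega)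
        nlinarith
      exact lt_of_mul_lt_mul_left h1 (by positivity)
    have hJ1' : 1 < J.card := by exact_mod_cast hJ1
    have hlarge := le_card_agree (Om := Om) (τ := τ) (J := J) (g := g) (W := W) (G := G)
      (p := π r) (ε := q ^ r * ((q ^ (50 * d ^ 2 * ℓ))⁻¹ * q ^ (20 * d ^ 2 * ℓ))) hP0.le
      (fun i hi => by
        rw [← hπeq i (hJI hi), hOm, filter_zoomSet_le (hW i (hJI hi))]) ?_ hJg hC0
      (fun i hi => hagree i (hJI hi)) (variance_bound hq' hd hℓ hC1 hP1 hr)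
      (Finset.card_pos.1 (by omega)) hOmne
    · by_cases hE : ∃ i ∈ J, W i ≠ E
      · obtain ⟨i, hi, hiE⟩ := hE
        exact absurd hlarge (not_le.2 (hmax i (hJI hi) E (lt_of_le_of_ne (hW i (hJI hi)) hiE) g
          (hJg i hi)))
      · push Not at hE
        obtain ⟨i, hi, j, hj, hij⟩ := Finset.one_lt_card.1 hJ1'
        refine hij (hinj i (hJI hi) j (hJI hj) ((hE i hi).trans (hE j hj).symm) fun x hx => ?_)
        rw [← hJg i hi x hx, hJg j hj x ((hE j hj).symm ▸ hE i hi ▸ hx)]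
    · intro i hi
      have h1 := card_sup_ne_le hW (by positivity) hη (hW i (hJI hi)) (hWr i (hJI hi))
      have h2 : ((J.filter fun i' => ¬ ((Om.filter fun L => L ≤ W i ∧ L ≤ W i').card : ℝ) ≤
          π r ^ 2 * Om.card).card : ℝ) ≤ (I.filter fun i' => W i ⊔ W i' ≠ E).card := by
        refine Nat.cast_le.2 (Finset.card_le_card fun i' hi' => ?_)
        rw [Finset.mem_filter] at hi' ⊢
        refine ⟨hJI hi'.1, fun hsup => hi'.2 ?_⟩
        have h3 := Submodule.finrank_sup_add_finrank_inf_eq (W i) (W i')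
        rw [hsup] at h3
        have h4 := hWr i (hJI hi)
        have h5 := hWr i' (hJI hi'.1)
        have h6 := hπle (W i ⊓ W i') (inf_le_left.trans (hW i (hJI hi))) (r + r) (by omega)
        simp only [le_inf_iff] at h6
        refine h6.trans ?_
        rw [sq]
        gcongr
        exact zoomRatio_add_le hq (by omega) r r
      refine h2.trans (h1.trans ?_)
      calc q ^ r * ((q ^ (50 * d ^ 2 * ℓ))⁻¹ * I.card) ≤
          q ^ r * ((q ^ (50 * d ^ 2 * ℓ))⁻¹ * (q ^ (20 * d ^ 2 * ℓ) * J.card)) := by gcongr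
        _ = _ := by ring

open Classical in
/-- The number of maximal pairs in which the domain has a fixed codimension is bounded. -/
lemma card_maximal_le (hd : 1 ≤ d) (hℓ : 3 * d ^ 2 + 1 ≤ ℓ) (hr : r ≤ 3 * d)
    (hQ : finrank F Q ≤ 3 * d) (hC0 : 0 < C)
    (hCd : (Fintype.card F : ℝ) ^ (4 * ℓ) ≤ (C * (Fintype.card F : ℝ) ^ (2 * ℓ)) ^ d)
    (hC1 : 1 ≤ C * (Fintype.card F : ℝ) ^ (2 * ℓ))
    (hQW : ∀ i ∈ I, Q ≤ W i)
    (hWr : ∀ i ∈ I, finrank F (W i) + r = finrank F V)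
    (hne : ∀ i ∈ I, (zoomSet Q (W i) (2 * ℓ)).Nonempty)
    (hC : ∀ i ∈ I, C * (zoomSet Q (W i) (2 * ℓ)).card ≤
      ((zoomSet Q (W i) (2 * ℓ)).filter fun L => ∀ x ∈ L, G i x = τ L x).card)
    (hmax : ∀ i ∈ I, ∀ E > W i, ∀ g : Dual F V, (∀ x ∈ W i, g x = G i x) →
      (((zoomSet Q E (2 * ℓ)).filter fun L => ∀ x ∈ L, g x = τ L x).card : ℝ) <
        1 / 5 * C * (zoomSet Q E (2 * ℓ)).card)
    (hinj : ∀ i ∈ I, ∀ j ∈ I, W i = W j → (∀ x ∈ W i, G i x = G j x) → i = j) :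
    (I.card : ℝ) ≤ ((Fintype.card F : ℝ) ^ (50 * d ^ 2 * ℓ)) ^ (3 * d + 1) := by
  by_contra! hlt
  have hq' : (1 : ℝ) ≤ Fintype.card F := by exact_mod_cast Fintype.card_pos
  have hM : 1 ≤ (Fintype.card F : ℝ) ^ (50 * d ^ 2 * ℓ) := one_le_pow₀ hq'
  set M := (Fintype.card F : ℝ) ^ (50 * d ^ 2 * ℓ) with hMdef
  obtain ⟨E, hE, hη⟩ := exists_concentrated I W hM
  set I' := I.filter fun i => W i ≤ E with hI'
  have hsub : I' ⊆ I := Finset.filter_subset _ _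
  have hW : ∀ i ∈ I', W i ≤ E := fun i hi => (Finset.mem_filter.1 hi).2
  have hne' : I'.Nonempty := by
    by_contra! h
    rw [h] at hE
    have : 0 < M ^ (3 * d + 1) := by positivity
    simp at hE
    simp [hE] at hlt
    linarith
  obtain ⟨i₀, hi₀⟩ := hne'
  have h0 := hWr i₀ (hsub hi₀)
  have h1 := Submodule.finrank_mono (hW i₀ hi₀)
  have h2 := Submodule.finrank_le E
  refine false_of_concentrated (r := r - (finrank F V - finrank F E)) hd hℓ (by omega) hQ hC0 hCd
    hC1 (fun i hi => hQW i (hsub hi)) hW (fun i hi => ?_) (fun i hi => hne i (hsub hi))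
    (fun i hi => hC i (hsub hi)) (fun i hi => hmax i (hsub hi))
    (fun i hi j hj => hinj i (hsub hi) j (hsub hj)) hη ?_
  · have := hWr i (hsub hi)
    omega
  · refine le_of_mul_le_mul_right ?_ (by positivity : 0 < M ^ (3 * d))
    calc M * M ^ (3 * d) = M ^ (3 * d + 1) := by ring
      _ ≤ I.card := hlt.le
      _ ≤ I'.card * M ^ (finrank F V - finrank F E) := hE
      _ ≤ _ := by
        gcongr
        omega

end Count

section Parameters

variable {δ : ℝ} {d : ℕ}

lemma le_factorial_sub_one {t : ℕ} (ht : t = Nat.factorial (2 ^ (2 + d))) (hd : 1 ≤ d) :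
    400 * d ^ 2 ≤ Nat.factorial (t - 1) := by
  have h1 : 2 ^ 3 ≤ 2 ^ (2 + d) := Nat.pow_le_pow_right (by norm_num) (by omega)
  have h2 : d < 2 ^ d := Nat.lt_two_pow_self
  have h3 : Nat.factorial 7 ≤ Nat.factorial (2 ^ (2 + d) - 1) :=
    Nat.factorial_le (by omega)
  have h4 : d ^ 2 ≤ 2 ^ (2 + d) := by
    have h5 : ∀ m : ℕ, m ^ 2 ≤ 2 ^ (2 + m) := by
      intro m
      induction m with
      | zero => norm_num
      | succ m ih =>
        have h6 : m < 2 ^ m := Nat.lt_two_pow_self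
        have h7 : 2 ^ (2 + (m + 1)) = 2 * 2 ^ (2 + m) := by ring
        have h8 : 2 ^ (2 + m) = 4 * 2 ^ m := by ring
        rw [h7]
        nlinarith
    exact h5 d
  have h5 : t = 2 ^ (2 + d) * Nat.factorial (2 ^ (2 + d) - 1) := by
    rw [ht, Nat.mul_factorial_pred (by positivity)]
  have h6 : Nat.factorial 7 = 5040 := by decide
  have h7 : 2 ^ (2 + d) * 5040 ≤ t := by
    rw [h5]
    exact Nat.mul_le_mul_left _ (h6 ▸ h3)
  have h8 := Nat.self_le_factorial (t - 1)
  omega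

lemma natCast_mul_pow_five (hδ : 0 < δ) (hd : (d : ℝ) = 10 / (δ ^ 5 / 100)) :
    d * δ ^ 5 = 1000 := by
  rw [hd]
  field_simp
  norm_num

lemma one_le_of_eq (hδ : 0 < δ) (hd : (d : ℝ) = 10 / (δ ^ 5 / 100)) : 1 ≤ d := by
  rcases Nat.eq_zero_or_pos d with rfl | h
  · have := natCast_mul_pow_five hδ hd
    norm_num at this
  · exact h

lemma lt_four (hδ : 0 < δ) (hd : (d : ℝ) = 10 / (δ ^ 5 / 100)) : δ < 4 := by
  by_contra! h
  have h1 : (1 : ℝ) ≤ d := by exact_mod_cast one_le_of_eq hδ hd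
  have h2 := natCast_mul_pow_five hδ hd
  have h3 : (4 : ℝ) ^ 5 ≤ δ ^ 5 := by gcongr
  nlinarith

lemma ten_div_le (hδ : 0 < δ) (hd : (d : ℝ) = 10 / (δ ^ 5 / 100)) : 10 / δ ≤ 3 * d := by
  have h2 := natCast_mul_pow_five hδ hd
  have h3 : δ ^ 4 ≤ 4 ^ 4 := by
    have := (lt_four hδ hd).le
    gcongr
  rw [div_le_iff₀ hδ]
  refine le_of_mul_le_mul_right ?_ (by positivity : 0 < δ ^ 4)
  nlinarith

lemma two_le_pow_three_mul (hδ : 0 < δ) (hd : (d : ℝ) = 10 / (δ ^ 5 / 100)) :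
    2 ≤ δ ^ 3 * d := by
  have h2 := natCast_mul_pow_five hδ hd
  have h3 : δ ^ 2 ≤ 4 ^ 2 := by
    have := (lt_four hδ hd).le
    gcongr
  refine le_of_mul_le_mul_right ?_ (by positivity : 0 < δ ^ 2)
  nlinarith

lemma exponent_le {t ℓ : ℕ} (hδ : 0 < δ) (hd : (d : ℝ) = 10 / (δ ^ 5 / 100))
    (ht : t = Nat.factorial (2 ^ (2 + d))) :
    (201 * d ^ 3 * ℓ : ℝ) ≤
      100 * (Nat.factorial (t - 1) : ℝ) * (10 / δ) ^ 2 * (ℓ : ℝ) / δ ^ 5 := by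
  have h1 : (400 * d ^ 2 : ℝ) ≤ Nat.factorial (t - 1) := by
    exact_mod_cast le_factorial_sub_one ht (one_le_of_eq hδ hd)
  have h2 := natCast_mul_pow_five hδ hd
  have h3 : δ ^ 2 ≤ 4 ^ 2 := by
    have := (lt_four hδ hd).le
    gcongr
  have h4 : 100 * (Nat.factorial (t - 1) : ℝ) * (10 / δ) ^ 2 * (ℓ : ℝ) / δ ^ 5 =
      10 * Nat.factorial (t - 1) * d * ℓ / δ ^ 2 := by
    field_simp
    linear_combination -(ℓ : ℝ) * h2
  rw [h4, le_div_iff₀ (by positivity)]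
  calc (201 * d ^ 3 * ℓ : ℝ) * δ ^ 2 ≤ 201 * d ^ 3 * ℓ * 4 ^ 2 := by gcongr
    _ ≤ (10 * (400 * d ^ 2) * d * ℓ : ℝ) := by
      have : (0 : ℝ) ≤ d ^ 3 * ℓ := by positivity
      nlinarith
    _ ≤ _ := by gcongr

lemma count_le {q C N : ℝ} {t ℓ : ℕ} (hq : 2 ≤ q) (hδ : 0 < δ)
    (hd : (d : ℝ) = 10 / (δ ^ 5 / 100)) (ht : t = Nat.factorial (2 ^ (2 + d)))
    (hℓ : 3 * d ^ 2 + 1 ≤ ℓ) (hC0 : 0 < C) (hC1 : C ≤ 1)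
    (hN : N ≤ (3 * d + 1) * (q ^ (50 * d ^ 2 * ℓ)) ^ (3 * d + 1)) :
    N ≤ (40 / δ) * (C ^ 2)⁻¹ *
      q ^ (100 * (Nat.factorial (t - 1) : ℝ) * (10 / δ) ^ 2 * (ℓ : ℝ) / δ ^ 5) := by
  have hd1 := one_le_of_eq hδ hd
  have h1 : (3 * d + 1 : ℝ) ≤ q ^ (d ^ 3 * ℓ) := by
    calc (3 * d + 1 : ℝ) ≤ 2 ^ (3 * d + 1) := by exact_mod_cast Nat.lt_two_pow_self.le
      _ ≤ q ^ (3 * d + 1) := by gcongr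
      _ ≤ q ^ (d ^ 3 * ℓ) := by
        refine pow_le_pow_right₀ (by linarith) ?_
        have h2 : d ≤ d ^ 2 := Nat.le_self_pow (by norm_num) d
        have h3 : 1 ≤ d ^ 3 := Nat.one_le_pow _ _ hd1
        nlinarith
  have h2 : (1 : ℝ) ≤ 40 / δ * (C ^ 2)⁻¹ := by
    refine one_le_mul_of_one_le_of_one_le ?_ ?_
    · rw [one_le_div hδ]
      linarith [lt_four hδ hd]
    · exact (one_le_inv₀ (by positivity)).2 (pow_le_one₀ hC0.le hC1)
  calc N ≤ (3 * d + 1) * (q ^ (50 * d ^ 2 * ℓ)) ^ (3 * d + 1) := hN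
    _ ≤ q ^ (d ^ 3 * ℓ) * (q ^ (50 * d ^ 2 * ℓ)) ^ (3 * d + 1) := by gcongr
    _ = q ^ (d ^ 3 * ℓ + 50 * d ^ 2 * ℓ * (3 * d + 1)) := by rw [← pow_mul, ← pow_add]
    _ ≤ q ^ (201 * d ^ 3 * ℓ) := by
      refine pow_le_pow_right₀ (by linarith) ?_
      nlinarith [Nat.mul_le_mul_left (d ^ 2 * ℓ) hd1]
    _ = q ^ (201 * d ^ 3 * ℓ : ℝ) := by
      rw [← Real.rpow_natCast]
      push_cast
      rfl
    _ ≤ q ^ (100 * (Nat.factorial (t - 1) : ℝ) * (10 / δ) ^ 2 * (ℓ : ℝ) / δ ^ 5) :=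
      Real.rpow_le_rpow_of_exponent_le (by linarith) (exponent_le hδ hd ht)
    _ ≤ _ := le_mul_of_one_le_left (by positivity) h2

lemma rpow_le_mul_pow {q C : ℝ} {ℓ : ℕ} (hq : 0 < q)
    (hC : q ^ (-(2 * (1 - δ ^ 3) * (ℓ : ℝ))) ≤ C) :
    q ^ (2 * δ ^ 3 * ℓ : ℝ) ≤ C * q ^ (2 * ℓ) := by
  calc q ^ (2 * δ ^ 3 * ℓ : ℝ) = q ^ (-(2 * (1 - δ ^ 3) * (ℓ : ℝ))) * q ^ (2 * ℓ) := by
        rw [← Real.rpow_natCast q (2 * ℓ), ← Real.rpow_add hq]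
        congr 1
        push_cast
        ring
    _ ≤ _ := by gcongr

lemma pow_four_mul_le {q C : ℝ} {ℓ : ℕ} (hq : 1 ≤ q) (hδ : 0 < δ)
    (hd : (d : ℝ) = 10 / (δ ^ 5 / 100)) (hC : q ^ (-(2 * (1 - δ ^ 3) * (ℓ : ℝ))) ≤ C) :
    q ^ (4 * ℓ) ≤ (C * q ^ (2 * ℓ)) ^ d := by
  have h1 := two_le_pow_three_mul hδ hd
  calc q ^ (4 * ℓ) = q ^ ((4 * ℓ : ℕ) : ℝ) := (Real.rpow_natCast _ _).symm
    _ ≤ q ^ (2 * δ ^ 3 * ℓ * d : ℝ) := by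
      refine Real.rpow_le_rpow_of_exponent_le hq ?_
      push_cast
      have : (0 : ℝ) ≤ ℓ := Nat.cast_nonneg _
      nlinarith
    _ = (q ^ (2 * δ ^ 3 * ℓ : ℝ)) ^ d := by
      rw [Real.rpow_mul (by linarith), Real.rpow_natCast]
    _ ≤ _ := by
      gcongr
      exact rpow_le_mul_pow (by linarith) hC

lemma one_le_mul_pow {q C : ℝ} {ℓ : ℕ} (hq : 1 ≤ q) (hδ : 0 < δ)
    (hC : q ^ (-(2 * (1 - δ ^ 3) * (ℓ : ℝ))) ≤ C) : 1 ≤ C * q ^ (2 * ℓ) :=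
  (Real.one_le_rpow hq (by positivity)).trans (rpow_le_mul_pow (by linarith) hC)

end Parameters

section Agreement

variable {F : Type} [Field F] {n s : ℕ}
  {T : (L : Submodule F (Fin n → F)) → (↥L →ₗ[F] F)} {Q W : Submodule F (Fin n → F)}

lemma agrFrac_le_one [Finite F] (g : ↥W →ₗ[F] F) : agrFrac F n s T Q W g ≤ 1 := by
  refine div_le_one_of_le₀ (Nat.cast_le.2 ?_) (Nat.cast_nonneg _)
  exact Nat.card_le_card_of_injective (fun L => ⟨L.1, L.2.1, L.2.2.1, L.2.2.2.1⟩)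
    fun L L' h => Subtype.ext (Subtype.mk.inj h)

open Classical in
lemma agrFrac_eq [Finite F] {g : ↥W →ₗ[F] F} {h : Dual F (Fin n → F)}
    {τ : Submodule F (Fin n → F) → Dual F (Fin n → F)} (hh : ∀ x : W, h x = g x)
    (hτ : ∀ (L : Submodule F (Fin n → F)) (x : L), τ L x = T L x) :
    agrFrac F n s T Q W g =
      ((zoomSet Q W s).filter fun L => ∀ x ∈ L, h x = τ L x).card / (zoomSet Q W s).card := by
  rw [agrFrac, ← card_zoomSet, Nat.subtype_card ((zoomSet Q W s).filter fun L =>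
    ∀ x ∈ L, h x = τ L x)]
  intro L
  simp only [Finset.mem_filter, mem_zoomSet, and_assoc]
  refine and_congr_right fun _ => and_congr_right fun _ => and_congr_right fun hLW =>
    forall_congr' fun x => ⟨fun H hxL hxW => ?_, fun H hxL => ?_⟩
  · rw [← hh ⟨x, hxW⟩, ← hτ L ⟨x, hxL⟩, H hxL]
  · rw [hh ⟨x, hLW hxL⟩, hτ L ⟨x, hxL⟩, H hxL (hLW hxL)]

open Classical in
lemma card_isMaximal_le [Fintype F] {C : ℝ} {d ℓ r : ℕ} (hd : 1 ≤ d) (hℓ : 3 * d ^ 2 + 1 ≤ ℓ)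
    (hr : r ≤ 3 * d) (hQ : finrank F Q ≤ 3 * d) (hC0 : 0 < C)
    (hCd : (Fintype.card F : ℝ) ^ (4 * ℓ) ≤ (C * (Fintype.card F : ℝ) ^ (2 * ℓ)) ^ d)
    (hC1 : 1 ≤ C * (Fintype.card F : ℝ) ^ (2 * ℓ))
    {I : Finset ((W : Submodule F (Fin n → F)) × (↥W →ₗ[F] F))}
    (hI : ∀ p ∈ I, IsMaximal F n (2 * ℓ) T Q C (1 / 5) p.1 p.2 ∧ n - finrank F ↥p.1 = r) :
    (I.card : ℝ) ≤ ((Fintype.card F : ℝ) ^ (50 * d ^ 2 * ℓ)) ^ (3 * d + 1) := by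
  have hext (W : Submodule F (Fin n → F)) (g : ↥W →ₗ[F] F) :
      ∃ h : Dual F (Fin n → F), ∀ x : W, h x = g x := by
    obtain ⟨h, hh⟩ := g.exists_extend
    exact ⟨h, fun x => LinearMap.congr_fun hh x⟩
  choose ext hext using hext
  have hagr (p : (W : Submodule F (Fin n → F)) × (↥W →ₗ[F] F)) :=
    agrFrac_eq (s := 2 * ℓ) (Q := Q) (hext p.1 p.2) fun L => hext L (T L)
  have hpos : ∀ p ∈ I, (0 : ℝ) < (zoomSet Q p.1 (2 * ℓ)).card := by
    intro p hp
    have h1 := (hI p hp).1.2.1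
    rw [hagr] at h1
    by_contra! h
    rw [le_antisymm h (Nat.cast_nonneg _), div_zero] at h1
    linarith
  refine card_maximal_le (W := fun p => p.1) (G := fun p => ext p.1 p.2) hd hℓ hr hQ hC0 hCd hC1
    (τ := fun L => ext L (T L))
    (fun p hp => (hI p hp).1.1) (fun p hp => ?_)
    (fun p hp => Finset.card_pos.1 (by exact_mod_cast hpos p hp)) (fun p hp => ?_)
    (fun p hp E hE g hg => ?_) (fun p hp p' hp' hW hG => ?_)
  · have h1 := (hI p hp).2
    have h2 := Submodule.finrank_le p.1
    rw [Module.finrank_fin_fun] at h2 ⊢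
    omega
  · have h1 := (hI p hp).1.2.1
    rwa [hagr, le_div_iff₀ (hpos p hp)] at h1
  · have h1 : (0 : ℝ) < (zoomSet Q E (2 * ℓ)).card := by
      refine (hpos p hp).trans_le (Nat.cast_le.2 (Finset.card_le_card fun L hL => ?_))
      rw [mem_zoomSet] at hL ⊢
      exact ⟨hL.1, hL.2.1, hL.2.2.trans hE.le⟩
    by_contra! h2
    refine (hI p hp).1.2.2 ⟨E, g.domRestrict E, hE, fun x hx _ => ?_, ?_⟩
    · rw [LinearMap.domRestrict_apply, hg x hx, hext p.1 p.2 ⟨x, hx⟩]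
    · rw [agrFrac_eq (h := g) (fun _ => rfl) fun L => hext L (T L), le_div_iff₀ h1]
      exact h2
  · obtain ⟨W, g⟩ := p
    obtain ⟨W', g'⟩ := p'
    obtain rfl : W = W' := hW
    obtain rfl : g = g' := LinearMap.ext fun x => by
      rw [← hext W g x, ← hext W g' x, hG x x.2]
    rfl

end Agreement

/-- Theorem 5.25, the number of maximal zoom-outs is bounded.  Fix
`δ > 0`, a finite field of order `q`, and set `ξ = δ⁵`, `δ₂ = ξ/100` (with `10/δ₂ ∈ ℕ`)
and `t = (2^(2+10/δ₂))!`.  For all sufficiently large `ℓ` and all `n ≥ q^ℓ`, for any table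
`T` on `Grass_q(n, 2ℓ)`, any zoom-in `Q` of dimension `r₁ ≤ 10/δ` and any
`C ≥ q^(-2(1-δ³)ℓ)`, the number of `(C, 1/5)`-maximal zoom-out/function pairs `(W, g)`
with respect to `T` on `Q` of codimension at most `10/δ` is at most
`(40/δ)·C⁻²·q^(100·(t−1)!·(10/δ)²·ℓ·ξ⁻¹)`. -/
theorem stmt15 (F : Type) [Field F] [Fintype F] (δ : ℝ) (hδ : 0 < δ)
    (d : ℕ) (hd : (d : ℝ) = 10 / (δ ^ 5 / 100))
    (t : ℕ) (ht : t = Nat.factorial (2 ^ (2 + d))) :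
    ∃ ℓ₀ : ℕ, ∀ ℓ : ℕ, ℓ₀ ≤ ℓ →
      ∀ n : ℕ, Fintype.card F ^ ℓ ≤ n →
      ∀ (T : (L : Submodule F (Fin n → F)) → (↥L →ₗ[F] F))
        (Q : Submodule F (Fin n → F)), (finrank F ↥Q : ℝ) ≤ 10 / δ →
      ∀ C : ℝ, (Fintype.card F : ℝ) ^ (-(2 * (1 - δ ^ 3) * (ℓ : ℝ))) ≤ C →
        (Nat.card {p : (W : Submodule F (Fin n → F)) × (↥W →ₗ[F] F) //
            IsMaximal F n (2 * ℓ) T Q C (1 / 5) p.1 p.2 ∧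
            ((n - finrank F ↥p.1 : ℕ) : ℝ) ≤ 10 / δ} : ℝ) ≤
          (40 / δ) * (C ^ 2)⁻¹ *
            (Fintype.card F : ℝ) ^
              (100 * (Nat.factorial (t - 1) : ℝ) * (10 / δ) ^ 2 * (ℓ : ℝ) / δ ^ 5) := by
  classical
  refine ⟨3 * d ^ 2 + 1, fun ℓ hℓ n _ T Q hQ C hC => ?_⟩
  have hq : (2 : ℝ) ≤ Fintype.card F := by exact_mod_cast Fintype.one_lt_card (α := F)
  have hC0 : 0 < C := lt_of_lt_of_le (Real.rpow_pos_of_pos (by linarith) _) hC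
  have hd10 := ten_div_le hδ hd
  have hle (m : ℕ) (hm : (m : ℝ) ≤ 10 / δ) : m ≤ 3 * d := by exact_mod_cast hm.trans hd10
  have hfin (W : Submodule F (Fin n → F)) : Finite (↥W →ₗ[F] F) := DFunLike.finite _
  have hA := Set.toFinite {p : (W : Submodule F (Fin n → F)) × (↥W →ₗ[F] F) |
    IsMaximal F n (2 * ℓ) T Q C (1 / 5) p.1 p.2 ∧ ((n - finrank F ↥p.1 : ℕ) : ℝ) ≤ 10 / δ}
  have hmem (p) : p ∈ hA.toFinset ↔ IsMaximal F n (2 * ℓ) T Q C (1 / 5) p.1 p.2 ∧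
      ((n - finrank F ↥p.1 : ℕ) : ℝ) ≤ 10 / δ := hA.mem_toFinset
  rw [Nat.subtype_card _ hmem]
  generalize hA.toFinset = A at hmem
  rcases A.eq_empty_or_nonempty with rfl | ⟨p₀, hp₀⟩
  · simp only [Finset.card_empty, Nat.cast_zero]
    positivity
  refine count_le hq hδ hd ht hℓ hC0 (((hmem p₀).1 hp₀).1.2.1.trans (agrFrac_le_one _)) ?_
  rw [Finset.card_eq_sum_card_fiberwise
    (f := fun p : (W : Submodule F (Fin n → F)) × (↥W →ₗ[F] F) => n - finrank F ↥p.1)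
    (t := Finset.range (3 * d + 1))
    fun p hp => Finset.mem_coe.2 (Finset.mem_range_succ_iff.2 (hle _ ((hmem p).1 hp).2))]
  push_cast
  refine (Finset.sum_le_card_nsmul _ _ _ fun r hr => ?_).trans_eq
    (by rw [Finset.card_range, nsmul_eq_mul]; push_cast; rfl)
  refine card_isMaximal_le (T := T) (Q := Q) (one_le_of_eq hδ hd) hℓ
    (Finset.mem_range_succ_iff.1 hr) (hle _ hQ) hC0
    (pow_four_mul_le (by linarith) hδ hd hC) (one_le_mul_pow (by linarith) hδ hC) fun p hp => ?_
  rw [Finset.mem_filter] at hp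
  exact ⟨((hmem p).1 hp.1).1, hp.2⟩
end

section
/- Let q be a prime power, V a finite-dimensional F_q-vector space, s ≥ 1, and let 𝒲 = {W₁, …, W_m} be a set of m distinct subspaces of V, each of codimension s, that is 4-generic with respect to V. For each i let f_i : W_i → F_q be an F_q-linear function. Define a graph G on vertex set {1, …, m} in which i and j are adjacent if and only if i ≠ j and f_i and f_j agree on W_i ∩ W_j. Then any two distinct non-adjacent vertices of G have at most one common neighbor. -/
open Module

theorem Submodule.finrank_add_finrank_le_finrank_inf_add {K E : Type*} [DivisionRing K]
    [AddCommGroup E] [Module K E] [FiniteDimensional K E] (X Y : Submodule K E) :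
    finrank K X + finrank K Y ≤ finrank K ↥(X ⊓ Y) + finrank K E := by
  have h := Submodule.finrank_sup_add_finrank_inf_eq X Y
  have h' := Submodule.finrank_le (X ⊔ Y)
  omega

/-- Claim 6.3, near-transitivity of the agreement graph.  Let `𝒲 =
{W₁, …, W_m}` be a `4`-generic family of distinct codimension-`s` subspaces of `V` and let
`f_i` be a linear functional on `W_i` for each `i`.  In the graph on `{1, …, m}` where `i`
and `j` are adjacent iff `i ≠ j` and `f_i`, `f_j` agree on `W_i ∩ W_j`, any two distinct
non-adjacent vertices have at most one common neighbor. -/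
theorem stmt19 (F : Type) [Field F] [Fintype F]
    (V : Type) [AddCommGroup V] [Module F V] [FiniteDimensional F V]
    (s m : ℕ) (hs : 1 ≤ s)
    (W : Fin m → Submodule F V) (hinj : Function.Injective W)
    (hcodim : ∀ i, finrank F ↥(W i) + s = finrank F V)
    (hgen : ∀ a b c d : Fin m, a ≠ b → a ≠ c → a ≠ d → b ≠ c → b ≠ d → c ≠ d →
      finrank F ↥(W a ⊓ W b ⊓ W c ⊓ W d) + 4 * s = finrank F V)
    (f : (i : Fin m) → (↥(W i) →ₗ[F] F))
    (Adj : Fin m → Fin m → Prop)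
    (hAdj : ∀ i j, Adj i j ↔ i ≠ j ∧
      ∀ (x : V) (hxi : x ∈ W i) (hxj : x ∈ W j), f i ⟨x, hxi⟩ = f j ⟨x, hxj⟩) :
    ∀ i j : Fin m, i ≠ j → ¬Adj i j →
      ∀ a b : Fin m, Adj i a → Adj j a → Adj i b → Adj j b → a = b := by
  intro i j hij hnadj a b hia hja hib hjb
  by_contra hab
  rw [hAdj] at hia hja hib hjb
  refine hnadj ((hAdj i j).2 ⟨hij, ?_⟩)
  have hsup : (W i ⊓ W j ⊓ W a) ⊔ (W i ⊓ W j ⊓ W b) = W i ⊓ W j := by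
    refine Submodule.eq_of_le_of_finrank_le (sup_le inf_le_left inf_le_left) ?_
    have hg := hgen i j a b hij hia.1 hib.1 hja.1 hjb.1 hab
    have hdim := Submodule.finrank_sup_add_finrank_inf_eq (W i ⊓ W j ⊓ W a) (W i ⊓ W j ⊓ W b)
    rw [← inf_inf_distrib_left, ← inf_assoc] at hdim
    have ha := Submodule.finrank_add_finrank_le_finrank_inf_add (W i ⊓ W j) (W a)
    have hb := Submodule.finrank_add_finrank_le_finrank_inf_add (W i ⊓ W j) (W b)
    have h_ij := Submodule.finrank_add_finrank_le_finrank_inf_add (W i) (W j)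
    have hci := hcodim i
    have hcj := hcodim j
    have hca := hcodim a
    have hcb := hcodim b
    omega
  intro x hxi hxj
  obtain ⟨y, ⟨⟨hyi, hyj⟩, hya⟩, z, ⟨⟨hzi, hzj⟩, hzb⟩, rfl⟩ :=
    Submodule.mem_sup.1 (hsup.ge ⟨hxi, hxj⟩)
  have hy : f i ⟨y, hyi⟩ = f j ⟨y, hyj⟩ :=
    (hia.2 y hyi hya).trans (hja.2 y hyj hya).symm
  have hz : f i ⟨z, hzi⟩ = f j ⟨z, hzj⟩ :=
    (hib.2 z hzi hzb).trans (hjb.2 z hzj hzb).symm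
  calc f i ⟨y + z, hxi⟩ = f i ⟨y, hyi⟩ + f i ⟨z, hzi⟩ := map_add (f i) ⟨y, hyi⟩ ⟨z, hzi⟩
    _ = f j ⟨y, hyj⟩ + f j ⟨z, hzj⟩ := by rw [hy, hz]
    _ = f j ⟨y + z, hxj⟩ := (map_add (f j) ⟨y, hyj⟩ ⟨z, hzj⟩).symm
end
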